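/- Let A be a separable nuclear C*-algebra and let I be a closed two-sided ideal of A such that the extension 0 → I → A → A/I → 0 is quasidiagonal, i.e. there is a sequence (p_n) of projections in I that is an approximate identity for I (‖p_n x − x‖ → 0 for all x ∈ I) and is quasicentral in A (‖p_n a − a p_n‖ → 0 for all a ∈ A). Let Q be a C*-algebra and π : A → Q a surjective *-homomorphism with kernel I (so Q is isomorphic to the quotient A/I). Then nucdim(A) = max{nucdim(I), nucdim(Q)}. -/

import Mathlib

/-- A bundled (possibly non-unital, possibly non-separable) C*-algebra. -/
structure CStarBundle : Type 1 where
  X : Type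
  [inst : NonUnitalCStarAlgebra X]

attribute [instance] CStarBundle.inst

/-- An element of a C*-algebra (or of a matrix algebra over one) is positive
iff it is of the form `star b * b`. -/
def IsPositiveElem {X : Type*} [NonUnitalRing X] [StarRing X] (a : X) : Prop :=
  ∃ b, a = star b * b

/-- A (ℂ-)linear map between C*-algebras is completely positive if all its
matrix amplifications map positive elements to positive elements. -/
def IsCPMap {X Y : Type*} [NonUnitalRing X] [StarRing X] [Module ℂ X]
    [NonUnitalRing Y] [StarRing Y] [Module ℂ Y] (f : X →ₗ[ℂ] Y) : Prop :=
  ∀ (n : ℕ) (M : Matrix (Fin n) (Fin n) X),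
    IsPositiveElem M → IsPositiveElem (M.map f)

/-- A map has order zero if it sends pairs of orthogonal positive elements to
orthogonal elements: `f a * f b = 0` whenever `a, b` are positive with
`a * b = 0`. -/
def IsOrderZero {X Y : Type*} [NonUnitalRing X] [StarRing X] [Module ℂ X]
    [NonUnitalRing Y] [StarRing Y] [Module ℂ Y] (f : X →ₗ[ℂ] Y) : Prop :=
  ∀ a b : X, IsPositiveElem a → IsPositiveElem b → a * b = 0 →
    f a * f b = 0

/-- A C*-algebra is finite-dimensional if it is so as a complex vector
space. -/
def IsFDAlgebra (A : CStarBundle) : Prop := FiniteDimensional ℂ A.X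

/-- `A` has nuclear dimension at most `d`: for every finite `S ⊆ A` and
`ε > 0` there are a finite-dimensional C*-algebra `F = F⁰ ⊕ ⋯ ⊕ F^d`, a CP
contraction `ψ : A → F` and a CP map `φ : F → A` restricting to an order-zero
CP contraction on each summand, with `‖φ (ψ a) − a‖ < ε` for `a ∈ S`. -/
def NucDimLE (A : CStarBundle) (d : ℕ) : Prop :=
  ∀ (S : Finset A.X) (ε : ℝ), 0 < ε →
    ∃ (F : Fin (d + 1) → CStarBundle)
      (ψ : A.X →ₗ[ℂ] ∀ i, (F i).X)
      (φ : (∀ i, (F i).X) →ₗ[ℂ] A.X),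
      (∀ i, IsFDAlgebra (F i)) ∧
      IsCPMap ψ ∧ (∀ a, ‖ψ a‖ ≤ ‖a‖) ∧ IsCPMap φ ∧
      (∀ i : Fin (d + 1),
        IsCPMap (φ.comp (LinearMap.single ℂ (fun j => (F j).X) i)) ∧
        IsOrderZero (φ.comp (LinearMap.single ℂ (fun j => (F j).X) i)) ∧
        ∀ x : (F i).X, ‖φ ((LinearMap.single ℂ (fun j => (F j).X) i) x)‖ ≤ ‖x‖) ∧
      ∀ a ∈ S, ‖φ (ψ a) - a‖ < ε

/-- The nuclear dimension of a C*-algebra, in `ℕ∞` (`⊤` if no finite `d`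
works). -/
noncomputable def nucDim (A : CStarBundle) : ℕ∞ :=
  sInf {d : ℕ∞ | ∃ k : ℕ, (k : ℕ∞) = d ∧ NucDimLE A k}

/-- `A` is a nuclear C*-algebra: the identity map is a pointwise-norm limit of
CP contractions through finite-dimensional C*-algebras. -/
def IsNuclearCStar (A : CStarBundle) : Prop :=
  ∀ (S : Finset A.X) (ε : ℝ), 0 < ε →
    ∃ (F : CStarBundle) (ψ : A.X →ₗ[ℂ] F.X) (φ : F.X →ₗ[ℂ] A.X),
      IsFDAlgebra F ∧ IsCPMap ψ ∧ (∀ a, ‖ψ a‖ ≤ ‖a‖) ∧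
      IsCPMap φ ∧ (∀ x, ‖φ x‖ ≤ ‖x‖) ∧
      ∀ a ∈ S, ‖φ (ψ a) - a‖ < ε

section Positivity

attribute [local instance] CStarAlgebra.spectralOrder CStarAlgebra.spectralOrderedRing

variable {X Y Z : Type} [NonUnitalCStarAlgebra X] [NonUnitalCStarAlgebra Y]
  [NonUnitalCStarAlgebra Z]

lemma isPositiveElem_iff_nonneg {a : X} : IsPositiveElem a ↔ 0 ≤ a :=
  CStarAlgebra.nonneg_iff_eq_star_mul_self.symm

lemma isPositiveElem_matrix_iff {n : Type} [Fintype n] {M : Matrix n n X} :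
    IsPositiveElem M ↔ 0 ≤ CStarMatrix.ofMatrix M :=
  (isPositiveElem_iff_nonneg (X := CStarMatrix n n X) (a := CStarMatrix.ofMatrix M))

lemma IsPositiveElem.matrix_add {n : Type} [Fintype n] {M N : Matrix n n X}
    (hM : IsPositiveElem M) (hN : IsPositiveElem N) : IsPositiveElem (M + N) := by
  rw [isPositiveElem_matrix_iff] at *
  exact add_nonneg (α := CStarMatrix n n X) hM hN

lemma IsPositiveElem.matrix_sum {n κ : Type} [Fintype n] (s : Finset κ)
    {M : κ → Matrix n n X} (hM : ∀ k ∈ s, IsPositiveElem (M k)) :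
    IsPositiveElem (∑ k ∈ s, M k) := by
  classical
  induction s using Finset.induction_on with
  | empty => exact ⟨0, by simp⟩
  | insert a s ha ih =>
    rw [Finset.sum_insert ha]
    exact (hM a (by simp)).matrix_add (ih fun k hk => hM k (by simp [hk]))

lemma isPositiveElem_gram {n : Type} [Fintype n] [DecidableEq n] (w : n → X) :
    IsPositiveElem (Matrix.of fun i j => star (w i) * w j) := by
  rcases isEmpty_or_nonempty n with h | ⟨⟨i₀⟩⟩
  · exact ⟨0, by ext i; exact h.elim i⟩
  · refine ⟨Matrix.of fun i j => if i = i₀ then w j else 0, ?_⟩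
    ext i j
    simp [Matrix.mul_apply, Matrix.star_apply, apply_ite star]

lemma isPositiveElem_of_sum_gram {n κ : Type} [Fintype n] [DecidableEq n] [Fintype κ]
    {M : Matrix n n X} (B : κ → n → X) (h : ∀ i j, M i j = ∑ k, star (B k i) * B k j) :
    IsPositiveElem M := by
  have : M = ∑ k, Matrix.of fun i j => star (B k i) * B k j := by
    ext i j
    simp [h, Matrix.sum_apply]
  rw [this]
  exact IsPositiveElem.matrix_sum _ fun k _ => isPositiveElem_gram _

lemma IsPositiveElem.exists_gram {n : Type} [Fintype n] {M : Matrix n n X}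
    (h : IsPositiveElem M) : ∃ B : n → n → X, ∀ i j, M i j = ∑ k, star (B k i) * B k j := by
  obtain ⟨B, rfl⟩ := h
  exact ⟨B, fun i j => by simp [Matrix.mul_apply, Matrix.star_apply]⟩

lemma isCPMap_of_gram (f : X →ₗ[ℂ] Y)
    (h : ∀ (n : ℕ) (w : Fin n → X), IsPositiveElem (Matrix.of fun i j => f (star (w i) * w j))) :
    IsCPMap f := by
  intro n M hM
  obtain ⟨B, hB⟩ := hM.exists_gram
  have : M.map f = ∑ k, Matrix.of fun i j => f (star (B k i) * B k j) := by
    ext i j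
    simp [hB, Matrix.sum_apply]
  rw [this]
  exact IsPositiveElem.matrix_sum _ fun k _ => h n _

lemma isCPMap_of_sum_gram {κ : Type} [Fintype κ] (f : X →ₗ[ℂ] Y) (g : κ → X → Y)
    (h : ∀ x y, f (star x * y) = ∑ k, star (g k x) * g k y) : IsCPMap f :=
  isCPMap_of_gram f fun _ w => isPositiveElem_of_sum_gram (fun k i => g k (w i)) (by simp [h])

lemma IsCPMap.gram {f : X →ₗ[ℂ] Y} (hf : IsCPMap f) {n : ℕ} (w : Fin n → X) :
    ∃ B : Fin n → Fin n → Y, ∀ i j, f (star (w i) * w j) = ∑ k, star (B k i) * B k j :=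
  (hf n _ (isPositiveElem_gram w)).exists_gram

lemma IsCPMap.comp {g : Y →ₗ[ℂ] Z} {f : X →ₗ[ℂ] Y} (hg : IsCPMap g) (hf : IsCPMap f) :
    IsCPMap (g ∘ₗ f) := fun n M hM => by
  have := hg n _ (hf n M hM)
  rwa [Matrix.map_map] at this

lemma IsCPMap.add {f g : X →ₗ[ℂ] Y} (hf : IsCPMap f) (hg : IsCPMap g) : IsCPMap (f + g) :=
  fun n M hM => by
    have := (hf n _ hM).matrix_add (hg n M hM)
    convert this using 1
    ext i j
    rfl

lemma isCPMap_zero : IsCPMap (0 : X →ₗ[ℂ] Y) := fun n M _ => ⟨0, by ext; simp⟩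

lemma IsCPMap.sum {κ : Type} (s : Finset κ) {f : κ → X →ₗ[ℂ] Y} (hf : ∀ k ∈ s, IsCPMap (f k)) :
    IsCPMap (∑ k ∈ s, f k) := by
  classical
  induction s using Finset.induction_on with
  | empty => exact isCPMap_zero
  | insert a s ha ih =>
    rw [Finset.sum_insert ha]
    exact (hf a (by simp)).add (ih fun k hk => hf k (by simp [hk]))

lemma isCPMap_of_starHom (f : X →ₗ[ℂ] Y) (h : ∀ x y, f (star x * y) = star (f x) * f y) :
    IsCPMap f :=
  isCPMap_of_sum_gram (κ := Unit) f (fun _ => f) (by simp [h])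

lemma isCPMap_starAlgHom (f : X →⋆ₙₐ[ℂ] Y) : IsCPMap (f : X →ₗ[ℂ] Y) :=
  isCPMap_of_starHom _ fun x y => by simp [map_star]

lemma IsCPMap.smul {f : X →ₗ[ℂ] Y} (hf : IsCPMap f) {r : ℝ} (hr : 0 ≤ r) :
    IsCPMap ((r : ℂ) • f) := fun n M hM => by
  obtain ⟨B, hB⟩ := hf n M hM
  refine ⟨((Real.sqrt r : ℝ) : ℂ) • B, ?_⟩
  have : (M.map ((r : ℂ) • f)) = (r : ℂ) • M.map f := by ext; simp
  rw [this, hB, star_smul, smul_mul_smul_comm]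
  congr 1
  simp only [RCLike.star_def, Complex.conj_ofReal]
  rw [← Complex.ofReal_mul, Real.mul_self_sqrt hr]

/-- Two-sided multiplication `x ↦ star c * x * c`. -/
noncomputable def compress (c : X) : X →ₗ[ℂ] X :=
  (LinearMap.mulRight ℂ c).comp (LinearMap.mulLeft ℂ (star c))

@[simp] lemma compress_apply (c x : X) : compress c x = star c * x * c := rfl

lemma isCPMap_compress (c : X) : IsCPMap (compress c) :=
  isCPMap_of_sum_gram (κ := Unit) _ (fun _ x => x * c) (by simp [mul_assoc])

/-- The compression `x ↦ (1 - p) x (1 - p)` by the formal complement of `p`. -/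
noncomputable def cut (p : X) : X →ₗ[ℂ] X :=
  LinearMap.id - LinearMap.mulRight ℂ p - LinearMap.mulLeft ℂ (star p) + compress p

@[simp] lemma cut_apply (p x : X) : cut p x = x - x * p - star p * x + star p * x * p := by
  simp [cut]

lemma isCPMap_cut (p : X) : IsCPMap (cut p) :=
  isCPMap_of_sum_gram (κ := Unit) _ (fun _ x => x - x * p) (fun x y => by
    simp [mul_assoc, sub_mul, mul_sub]; abel)

lemma IsCPMap.isPositiveElem {f : X →ₗ[ℂ] Y} (hf : IsCPMap f) {a : X} (ha : IsPositiveElem a) :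
    IsPositiveElem (f a) := by
  obtain ⟨b, rfl⟩ := ha
  obtain ⟨B, hB⟩ := hf.gram (n := 1) (fun _ => b)
  exact ⟨B 0 0, by simpa using hB 0 0⟩

lemma IsCPMap.map_nonneg {f : X →ₗ[ℂ] Y} (hf : IsCPMap f) {a : X} (ha : 0 ≤ a) : 0 ≤ f a := by
  rw [← isPositiveElem_iff_nonneg] at *
  exact hf.isPositiveElem ha

lemma IsCPMap.mono {f : X →ₗ[ℂ] Y} (hf : IsCPMap f) {a b : X} (h : a ≤ b) : f a ≤ f b := by
  rw [← sub_nonneg, ← map_sub]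
  exact hf.map_nonneg (sub_nonneg.2 h)

lemma IsCPMap.map_isSelfAdjoint {f : X →ₗ[ℂ] Y} (hf : IsCPMap f) {a : X}
    (ha : IsSelfAdjoint a) : IsSelfAdjoint (f a) := by
  rw [← CFC.posPart_sub_negPart a ha, map_sub]
  exact (hf.map_nonneg (CFC.posPart_nonneg a)).isSelfAdjoint.sub
    (hf.map_nonneg (CFC.negPart_nonneg a)).isSelfAdjoint

lemma IsCPMap.map_star {f : X →ₗ[ℂ] Y} (hf : IsCPMap f) (a : X) : f (star a) = star (f a) := by
  have h := realPart_add_I_smul_imaginaryPart a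
  rw [← h]
  have h1 := (hf.map_isSelfAdjoint (realPart a).2).star_eq
  have h2 := (hf.map_isSelfAdjoint (imaginaryPart a).2).star_eq
  simp only [star_add, star_smul, map_add, map_smul, h1, h2]
  simp [selfAdjoint.mem_iff.1 (realPart a).2, selfAdjoint.mem_iff.1 (imaginaryPart a).2]

end Positivity

section FiniteDimensional

attribute [local instance] CStarAlgebra.spectralOrder CStarAlgebra.spectralOrderedRing

variable {F : Type} [NonUnitalCStarAlgebra F] 

lemma norm_mem_quasispectrum {x : F} (hx : 0 ≤ x) : ‖x‖ ∈ quasispectrum ℝ x := by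
  rw [Unitization.quasispectrum_eq_spectrum_inr' ℝ ℂ, ← Unitization.norm_inr (𝕜 := ℂ)]
  exact CStarAlgebra.norm_mem_spectrum_of_nonneg (Unitization.inr_nonneg_iff.2 hx)

variable [FiniteDimensional ℂ F]

lemma finite_quasispectrum_real (x : F) : (quasispectrum ℝ x).Finite := by
  rw [Unitization.quasispectrum_eq_spectrum_inr' ℝ ℂ]
  let f : ℂ × F →ₗ[ℂ] Unitization ℂ F :=
    { toFun := fun z => (Unitization.inl z.1 + (z.2 : Unitization ℂ F) : Unitization ℂ F)
      map_add' := fun y z => by simp [add_add_add_comm]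
      map_smul' := fun c z => by
        rw [smul_add, Prod.smul_fst, Prod.smul_snd, Unitization.inl_smul, Unitization.inr_smul]
        rfl }
  have : Module.Finite ℂ (Unitization ℂ F) := Module.Finite.of_surjective f fun z =>
    ⟨(z.fst, z.snd), Unitization.inl_fst_add_inr_snd_eq z⟩
  have : Module.Finite ℝ (Unitization ℂ F) := Module.Finite.trans ℂ _
  obtain ⟨p, hp, h⟩ := Algebra.IsIntegral.isIntegral (R := ℝ) (x : Unitization ℂ F)
  refine (p.rootSet_finite ℝ).subset fun r hr => ?_
  have h1 := spectrum.subset_polynomial_aeval (x : Unitization ℂ F) p ⟨r, hr, rfl⟩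
  rw [← Polynomial.aeval_def] at h
  rw [h, spectrum.zero_eq] at h1
  simpa [Polynomial.mem_rootSet, hp.ne_zero] using h1

/-- The spectral projection of a self-adjoint element for the spectral value `r`. -/
noncomputable def specProj (x : F) (r : ℝ) : F := cfcₙ (fun t : ℝ => if t = r then 1 else 0) x

lemma continuousOn_qs (f : ℝ → ℝ) (x : F) : ContinuousOn f (quasispectrum ℝ x) :=
  (finite_quasispectrum_real x).continuousOn _

lemma specProj_mul {x : F} (r s : ℝ) (hr : r ≠ 0) (hs : s ≠ 0) :
    specProj x r * specProj x s = if r = s then specProj x r else 0 := by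
  unfold specProj
  rw [← cfcₙ_mul _ _ x (continuousOn_qs _ _) (by simp [hr.symm]) (continuousOn_qs _ _)
    (by simp [hs.symm])]
  split_ifs with h
  · congr 1; ext t; simp [h]
  · rw [← cfcₙ_const_zero ℝ x]; congr 1; ext t
    by_cases h1 : t = r <;> by_cases h2 : t = s <;> simp_all

lemma isSelfAdjoint_specProj {G : Type} [NonUnitalCStarAlgebra G] (x : G) (r : ℝ) : IsSelfAdjoint (specProj x r) :=
  IsSelfAdjoint.cfcₙ

lemma exists_spectral_decomposition {x : F} (hx : IsSelfAdjoint x) :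
    ∃ s : Finset ℝ, 0 ∉ s ∧ x = ∑ r ∈ s, (r : ℂ) • specProj x r := by
  refine ⟨(finite_quasispectrum_real x).toFinset.erase 0, by simp, ?_⟩
  conv_lhs => rw [← cfcₙ_id' ℝ x]
  have : ∀ r ∈ (finite_quasispectrum_real x).toFinset.erase 0, (r : ℂ) • specProj x r =
      cfcₙ (fun t : ℝ => r * if t = r then 1 else 0) x := fun r hr => by
    rw [cfcₙ_const_mul _ _ _ (continuousOn_qs _ _)
      (by simpa using (Finset.ne_of_mem_erase hr).symm)]
    rw [Complex.coe_smul]; rfl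
  rw [Finset.sum_congr rfl this, ← cfcₙ_sum _ x _ (fun _ _ => continuousOn_qs _ _)
    (fun r hr => by simpa using fun h => (Finset.ne_of_mem_erase hr h.symm).elim)]
  refine cfcₙ_congr fun t ht => ?_
  rcases eq_or_ne t 0 with rfl | h0
  · simp
  · simp [h0, ht]

lemma exists_norm_projection {x : F} (hx : 0 ≤ x) (h0 : x ≠ 0) : ∃ g : F, star g = g ∧ g * g = g ∧
    g ≠ 0 ∧ x * g = (‖x‖ : ℂ) • g ∧ g * x = (‖x‖ : ℂ) • g := by
  have hn : ‖x‖ ≠ 0 := by simpa using h0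
  have hsa := hx.isSelfAdjoint
  have key : x * specProj x ‖x‖ = (‖x‖ : ℂ) • specProj x ‖x‖ := by
    rw [Complex.coe_smul]
    unfold specProj
    rw [← cfcₙ_const_mul _ _ _ (continuousOn_qs _ _) (by simpa using hn.symm)]
    nth_rewrite 1 [← cfcₙ_id' ℝ x]
    rw [← cfcₙ_mul _ _ x (continuousOn_qs _ _) (by simp) (continuousOn_qs _ _) (by simp [hn.symm])]
    congr 1; ext t; by_cases h : t = ‖x‖ <;> simp [h]
  refine ⟨specProj x ‖x‖, (isSelfAdjoint_specProj _ _).star_eq, ?_, ?_, key, ?_⟩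
  · rw [specProj_mul _ _ hn hn, if_pos rfl]
  · intro h
    have : (1 : ℝ) ∈ quasispectrum ℝ (specProj x ‖x‖) := by
      unfold specProj
      rw [cfcₙ_map_quasispectrum _ _ (continuousOn_qs _ _) (by simp [hn.symm])]
      exact ⟨‖x‖, norm_mem_quasispectrum hx, by simp⟩
    rw [h, CFC.quasispectrum_zero_eq] at this
    simp at this
  · have := congrArg star key
    simpa [(isSelfAdjoint_specProj _ _).star_eq, hsa.star_eq] using this

end FiniteDimensional

/-- A system of matrix units in column form: `v s * star (v t)` for `b s = b t` are matrix units. -/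
structure MatUnits (F : Type) [NonUnitalCStarAlgebra F] where
  N : ℕ
  b : Fin N → Fin N
  v : Fin N → F
  c : Fin N → Fin N → F →ₗ[ℂ] ℂ
  b_b : ∀ s, b (b s) = b s
  star_v_b : ∀ s, star (v (b s)) = v (b s)
  idem : ∀ s, v (b s) * v (b s) = v (b s)
  ne_zero : ∀ s, v (b s) ≠ 0
  orth : ∀ s t, s ≠ t → star (v s) * v t = 0
  same : ∀ s, star (v s) * v s = v (b s)
  unit_mul : ∀ x, (∑ s, v s * star (v s)) * x = x
  coef : ∀ s t x, b s = b t → star (v s) * x * v t = c s t x • v (b s)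
  coef_zero : ∀ s t x, b s ≠ b t → star (v s) * x * v t = 0

section Existence

attribute [local instance] CStarAlgebra.spectralOrder CStarAlgebra.spectralOrderedRing

variable {F : Type} [NonUnitalCStarAlgebra F]

/-- A family of nonzero pairwise orthogonal projections. -/
def IsOrthProj {N : ℕ} (f : Fin N → F) : Prop :=
  (∀ s, star (f s) = f s) ∧ (∀ s, f s * f s = f s) ∧ (∀ s, f s ≠ 0) ∧ ∀ s t, s ≠ t → f s * f t = 0

lemma IsOrthProj.cons {N : ℕ} {f : Fin N → F} (hf : IsOrthProj f) {g : F} (h1 : star g = g)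
    (h2 : g * g = g) (h3 : g ≠ 0) (h4 : ∀ s, f s * g = 0) :
    IsOrthProj (Fin.cons g f : Fin (N + 1) → F) := by
  obtain ⟨a1, a2, a3, a4⟩ := hf
  have h5 : ∀ s, g * f s = 0 := fun s => by
    have := congrArg star (h4 s); simpa [a1, h1] using this
  refine ⟨fun s => ?_, fun s => ?_, fun s => ?_, fun s t hst => ?_⟩
  · refine Fin.cases ?_ (fun s => ?_) s <;> simp [*]
  · refine Fin.cases ?_ (fun s => ?_) s <;> simp [*]
  · refine Fin.cases ?_ (fun s => ?_) s <;> simp [*]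
  · revert hst
    refine Fin.cases ?_ (fun s => ?_) s <;> refine Fin.cases ?_ (fun t => ?_) t <;> simp [*]
    exact a4 s t

variable [FiniteDimensional ℂ F]

lemma IsOrthProj.card_le {N : ℕ} {f : Fin N → F} (hf : IsOrthProj f) :
    N ≤ Module.finrank ℂ F := by
  have : LinearIndependent ℂ f := by
    rw [Fintype.linearIndependent_iff]
    intro g hg i
    have h : f i * ∑ j, g j • f j = g i • f i := by
      rw [Finset.mul_sum, Finset.sum_eq_single i]
      · rw [mul_smul_comm, hf.2.1]
      · intro j _ hj
        rw [mul_smul_comm, hf.2.2.2 i j hj.symm, smul_zero]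
      · simp
    rw [hg, mul_zero] at h
    exact (smul_eq_zero.1 h.symm).resolve_right (hf.2.2.1 i)
  simpa using this.fintype_card_le_finrank

lemma exists_maximal_orthProj : ∃ (N : ℕ) (f : Fin N → F), IsOrthProj f ∧
    ∀ f' : Fin (N + 1) → F, ¬ IsOrthProj f' := by
  classical
  let P : ℕ → Prop := fun N => ∃ f : Fin N → F, IsOrthProj f
  have hP0 : P 0 := ⟨Fin.elim0, fun s => s.elim0, fun s => s.elim0, fun s => s.elim0,
    fun s => s.elim0⟩
  have hN := Nat.findGreatest_spec (P := P) (Nat.zero_le (Module.finrank ℂ F)) hP0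
  obtain ⟨f, hf⟩ := hN
  refine ⟨_, f, hf, fun f' hf' => ?_⟩
  have := Nat.le_findGreatest (P := P) hf'.card_le ⟨f', hf'⟩
  omega

lemma exists_minimal_orthProj : ∃ (N : ℕ) (f : Fin N → F), IsOrthProj f ∧
    (∀ x, (∑ s, f s) * x = x) ∧ ∀ s x, ∃ c : ℂ, f s * x * f s = c • f s := by
  classical
  obtain ⟨N, f, hf, hmax⟩ := exists_maximal_orthProj (F := F)
  have hfo := hf
  obtain ⟨a1, a2, a3, a4⟩ := hf
  refine ⟨N, f, hfo, fun x => ?_, fun s x => ?_⟩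
  · by_contra hne
    set e := ∑ s, f s with he
    have hfe : ∀ s, f s * e = f s := fun s => by
      rw [he, Finset.mul_sum, Finset.sum_eq_single s, a2]
      · intro j _ hj; exact a4 s j hj.symm
      · simp
    set z := x - e * x with hz
    have hz0 : z ≠ 0 := fun h => hne (sub_eq_zero.1 h).symm
    have hfz : ∀ s, f s * z = 0 := fun s => by
      rw [hz, mul_sub, ← mul_assoc, hfe, sub_self]
    obtain ⟨g, g1, g2, g3, g4, g5⟩ := exists_norm_projection (mul_star_self_nonneg z)
      (by simpa [CStarRing.mul_star_self_eq_zero_iff] using hz0)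
    refine hmax _ (hfo.cons g1 g2 g3 fun s => ?_)
    have h : f s * (z * star z * g) = 0 := by rw [mul_assoc, ← mul_assoc, hfz, zero_mul]
    rw [g4, mul_smul_comm, smul_eq_zero] at h
    refine h.resolve_left ?_
    simpa [CStarRing.mul_star_self_eq_zero_iff] using hz0
  · have key : ∀ y : F, 0 ≤ y → ∃ c : ℂ, f s * y * f s = c • f s := by
      intro y hy
      rcases eq_or_ne (f s * y * f s) 0 with h0 | h0
      · exact ⟨0, by simpa using h0⟩
      have hpos : 0 ≤ f s * y * f s := by
        simpa [a1] using star_left_conjugate_nonneg hy (f s)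
      set w := f s * y * f s with hw
      have hn : (‖w‖ : ℂ) ≠ 0 := by simpa using h0
      obtain ⟨g, g1, g2, g3, g4, g5⟩ := exists_norm_projection hpos h0
      have hfg : f s * g = g := by
        have : f s * (w * g) = w * g := by rw [hw]; simp only [← mul_assoc, a2]
        rw [g4, mul_smul_comm] at this
        exact smul_right_injective _ hn this
      have hgf : g * f s = g := by simpa [a1, g1] using congrArg star hfg
      by_cases hgs : g = f s
      · refine ⟨‖w‖, ?_⟩
        rw [← hgs, ← g4, hgs, hw]; simp only [mul_assoc, a2]
      · exfalso
        have ho : IsOrthProj (Function.update f s g) := by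
          refine ⟨fun t => ?_, fun t => ?_, fun t => ?_, fun t u htu => ?_⟩
          · by_cases h : t = s
            · subst h; simp [g1]
            · simp [h, a1]
          · by_cases h : t = s
            · subst h; simp [g2]
            · simp [h, a2]
          · by_cases h : t = s
            · subst h; simp [g3]
            · simp [h, a3]
          · by_cases h : t = s
            · subst h
              rw [Function.update_self, Function.update_of_ne htu.symm, ← hgf, mul_assoc,
                a4 _ _ htu, mul_zero]
            · by_cases h' : u = s
              · subst h'
                rw [Function.update_self, Function.update_of_ne htu, ← hfg, ← mul_assoc,
                  a4 _ _ htu, zero_mul]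
              · simp [h, h', a4 _ _ htu]
        refine hmax _ (ho.cons (g := f s - g) (by simp [a1, g1]) ?_ (fun h => hgs ?_) fun t => ?_)
        · simp [mul_sub, sub_mul, a2, g2, hfg, hgf]
        · exact (sub_eq_zero.1 h).symm
        · by_cases h : t = s
          · subst h; simp [mul_sub, hgf, g2]
          · rw [Function.update_of_ne h, mul_sub, a4 _ _ h, ← hfg, ← mul_assoc, a4 _ _ h]; simp
    obtain ⟨y, hy, -, hxy⟩ := CStarAlgebra.exists_sum_four_nonneg x
    choose c hc using fun i => key (y i) (hy i)
    refine ⟨∑ i : Fin 4, Complex.I ^ (i : ℕ) * c i, ?_⟩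
    conv_lhs => rw [hxy]
    rw [Finset.mul_sum, Finset.sum_mul, Finset.sum_smul]
    exact Finset.sum_congr rfl fun i _ => by
      rw [mul_smul_comm, smul_mul_assoc, hc, smul_smul]

end Existence

section Existence

attribute [local instance] CStarAlgebra.spectralOrder CStarAlgebra.spectralOrderedRing

variable {F : Type} [NonUnitalCStarAlgebra F]

/-- Murray-von Neumann equivalence of the members of a family of projections. -/
def mvnSetoid {N : ℕ} (f : Fin N → F) (hf : IsOrthProj f) : Setoid (Fin N) where
  r s t := ∃ v, star v * v = f t ∧ v * star v = f s
  iseqv :=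
    { refl := fun s => ⟨f s, by rw [hf.1, hf.2.1], by rw [hf.1, hf.2.1]⟩
      symm := fun ⟨v, h1, h2⟩ => ⟨star v, by simpa using h2, by simpa using h1⟩
      trans := fun {s t u} ⟨v, h1, h2⟩ ⟨w, h3, h4⟩ => by
        have e1 : f t * w = w := by
          have h : star (f t * w - w) * (f t * w - w) = 0 := by
            have : star w * (f t * w) = star w * w := by
              rw [← h4, mul_assoc, h3, ← mul_assoc, h3, hf.2.1]
            rw [star_sub, star_mul, hf.1, sub_mul, mul_sub, mul_sub, mul_assoc, mul_assoc,
              ← mul_assoc (f t) (f t), hf.2.1, this]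
            abel
          exact sub_eq_zero.1 (CStarRing.star_mul_self_eq_zero_iff _ |>.1 h)
        have e2 : v * f t = v := by
          have h : (v * f t - v) * star (v * f t - v) = 0 := by
            have : v * (f t * star v) = v * star v := by
              rw [← h1, mul_assoc, h2, ← mul_assoc, h2, hf.2.1]
            rw [star_sub, star_mul, hf.1, sub_mul, mul_sub, mul_sub, mul_assoc, mul_assoc,
              ← mul_assoc (f t) (f t), hf.2.1, this]
            abel
          exact sub_eq_zero.1 (CStarRing.mul_star_self_eq_zero_iff _ |>.1 h)
        refine ⟨v * w, ?_, ?_⟩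
        · rw [star_mul, mul_assoc, ← mul_assoc (star v), h1, e1, h3]
        · rw [star_mul, mul_assoc, ← mul_assoc w, h4, ← mul_assoc, e2, h2] }

lemma mvnSetoid_of_ne_zero {N : ℕ} {f : Fin N → F} (hf : IsOrthProj f)
    (hmin : ∀ s x, ∃ c : ℂ, f s * x * f s = c • f s) {s t : Fin N} {x : F}
    (hx : f s * x * f t ≠ 0) : (mvnSetoid f hf).r s t := by
  have hsa := hf.1
  have hid := hf.2.1
  have hne := hf.2.2.1
  have hnf : ∀ s, ‖f s‖ = 1 := fun s => by
    have := CStarRing.norm_star_mul_self (x := f s)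
    rw [hsa, hid] at this
    have h0 : ‖f s‖ ≠ 0 := by simpa using hne s
    field_simp at this
    simpa using this.symm
  set y := f s * x * f t with hy
  have hn0 : ‖y‖ ≠ 0 := by simpa using hx
  have hfy : f s * y = y := by rw [hy, ← mul_assoc, ← mul_assoc, hid]
  have hyf : y * f t = y := by rw [hy, mul_assoc, hid]
  have hfy' : star y * f s = star y := by simpa [hsa] using congrArg star hfy
  have hyf' : f t * star y = star y := by simpa [hsa] using congrArg star hyf
  have key : ∀ (u : Fin N) (a : F), 0 ≤ a → f u * a * f u = a → a = (‖a‖ : ℂ) • f u := by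
    intro u a ha hau
    obtain ⟨c, hc⟩ := hmin u a
    rw [hau] at hc
    rcases eq_or_ne a 0 with h0 | h0
    · simp [h0]
    have h1 : ‖a‖ = ‖c‖ := by rw [hc, norm_smul, hnf, mul_one]
    -- `c` is a nonnegative real because `a` is positive of the form `c • f u`
    have h2 : a * a = c • a := by
      conv_lhs => rw [hc]
      rw [smul_mul_smul_comm, hid, mul_smul, ← hc]
    have h3 : star a = a := ha.isSelfAdjoint.star_eq
    have h4 : star c = c := by
      have : star a = star c • f u := by rw [hc, star_smul, hsa]
      rw [h3, hc] at this
      exact (smul_left_injective ℂ (hne u) this).symm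
    have h5 : c = (c.re : ℂ) := (Complex.conj_eq_iff_re.1 h4).symm
    have h6 : 0 ≤ c.re := by
      by_contra hneg
      push Not at hneg
      have h7 : a = c.re • f u := by rw [hc]; conv_lhs => rw [h5]; rw [Complex.coe_smul]
      have h8 : 0 ≤ f u := by
        have := star_mul_self_nonneg (f u)
        rwa [hsa, hid] at this
      have h9 : a ≤ 0 := by
        rw [h7]; exact smul_nonpos_of_nonpos_of_nonneg hneg.le h8
      exact h0 (le_antisymm h9 ha)
    rw [h1]
    rw [h5, Complex.norm_of_nonneg h6, ← h5, ← hc]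
  have h1 : star y * y = ((‖y‖ : ℂ) * ‖y‖) • f t := by
    have := key t (star y * y) (star_mul_self_nonneg y) (by
      rw [mul_assoc, mul_assoc, hyf, ← mul_assoc, hyf'])
    rw [this, CStarRing.norm_star_mul_self]; simp
  have h2 : y * star y = ((‖y‖ : ℂ) * ‖y‖) • f s := by
    have := key s (y * star y) (mul_star_self_nonneg y) (by
      rw [mul_assoc, mul_assoc, hfy', ← mul_assoc, hfy])
    rw [this, CStarRing.norm_self_mul_star]; simp
  have hn : (‖y‖ : ℂ) ≠ 0 := by simpa using hx
  refine ⟨(‖y‖⁻¹ : ℂ) • y, ?_, ?_⟩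
  · rw [star_smul, smul_mul_smul_comm, h1, smul_smul]
    have : star (‖y‖⁻¹ : ℂ) = (‖y‖⁻¹ : ℂ) := by simp
    rw [this]
    field_simp
    simp
  · rw [star_smul, smul_mul_smul_comm, h2, smul_smul]
    have : star (‖y‖⁻¹ : ℂ) = (‖y‖⁻¹ : ℂ) := by simp
    rw [this]
    field_simp
    simp

theorem nonempty_matUnits [FiniteDimensional ℂ F] : Nonempty (MatUnits F) := by
  classical
  obtain ⟨N, f, hf, hunit, hmin⟩ := exists_minimal_orthProj (F := F)
  have hsa := hf.1
  have hid := hf.2.1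
  have hne := hf.2.2.1
  have hor := hf.2.2.2
  let S := mvnSetoid f hf
  let b : Fin N → Fin N := fun s => (Quotient.mk S s).out
  have hbr : ∀ s, S.r s (b s) := fun s => S.symm (Quotient.mk_out s)
  have hbeq : ∀ s t, S.r s t → b s = b t := fun s t h => by
    show (Quotient.mk S s).out = (Quotient.mk S t).out
    rw [Quotient.sound h]
  have hbb : ∀ s, b (b s) = b s := fun s => (hbeq _ _ (hbr s)).symm
  have hv : ∀ s, ∃ v, star v * v = f (b s) ∧ v * star v = f s ∧ (b s = s → v = f s) := by
    intro s
    by_cases h : b s = s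
    · exact ⟨f s, by rw [hsa, hid, h], by rw [hsa, hid], fun _ => rfl⟩
    · obtain ⟨v, h1, h2⟩ := hbr s
      exact ⟨v, h1, h2, fun h' => absurd h' h⟩
  choose v hv1 hv2 hv3 using hv
  have hvb : ∀ s, v (b s) = f (b s) := fun s => hv3 _ (hbb s)
  have hvf : ∀ s, v s * f (b s) = v s := fun s => by
    have h : star (v s * f (b s) - v s) * (v s * f (b s) - v s) = 0 := by
      rw [star_sub, star_mul, hsa]
      have := hv1 s
      simp only [sub_mul, mul_sub, mul_assoc]
      rw [← mul_assoc (star (v s)), this, hid, hid]; simp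
    exact sub_eq_zero.1 (CStarRing.star_mul_self_eq_zero_iff _ |>.1 h)
  have hfv : ∀ s, f s * v s = v s := fun s => by
    have h : (f s * v s - v s) * star (f s * v s - v s) = 0 := by
      rw [star_sub, star_mul, hsa]
      have := hv2 s
      simp only [sub_mul, mul_sub, mul_assoc]
      rw [← mul_assoc (v s), this, hid, hid]; simp
    exact sub_eq_zero.1 (CStarRing.mul_star_self_eq_zero_iff _ |>.1 h)
  have hfv' : ∀ s, star (v s) * f s = star (v s) := fun s => by
    simpa [hsa] using congrArg star (hfv s)
  have hvf' : ∀ s, f (b s) * star (v s) = star (v s) := fun s => by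
    simpa [hsa] using congrArg star (hvf s)
  have hdual : ∀ s, ∃ l : F →ₗ[ℂ] ℂ, l (f s) = 1 := fun s => by
    obtain ⟨l, hl⟩ := SeparatingDual.exists_eq_one (R := ℂ) (hne s)
    exact ⟨l, hl⟩
  choose l hl using hdual
  have hsand : ∀ s t x, star (v s) * x * v t = f (b s) * (star (v s) * x * v t) * f (b t) := by
    intro s t x
    rw [mul_assoc (f (b s)), mul_assoc _ (v t), hvf, ← mul_assoc, ← mul_assoc, hvf']
  refine ⟨⟨N, b, v, fun s t => (l (b s)).comp
    ((LinearMap.mulRight ℂ (v t)).comp (LinearMap.mulLeft ℂ (star (v s)))), hbb, fun s => ?_,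
    fun s => ?_, fun s => ?_, fun s t hst => ?_, fun s => ?_, fun x => ?_, fun s t x hst => ?_,
    fun s t x hst => ?_⟩⟩
  · rw [hvb, hsa]
  · rw [hvb, hid]
  · rw [hvb]; exact hne _
  · rw [← hfv s, ← hfv t, star_mul, hsa, mul_assoc, ← mul_assoc (f s), hor _ _ hst]; simp
  · rw [hv1, hvb]
  · simp_rw [hv2]; exact hunit x
  · obtain ⟨c, hc⟩ := hmin (b s) (star (v s) * x * v t)
    have h1 : star (v s) * x * v t = c • f (b s) := by rw [hsand, ← hst, hc]
    simp only [LinearMap.comp_apply, LinearMap.mulLeft_apply, LinearMap.mulRight_apply, h1, hvb,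
      map_smul, hl, smul_eq_mul, mul_one]
  · by_contra h
    rw [hsand] at h
    have := hbeq _ _ (mvnSetoid_of_ne_zero hf hmin h)
    rw [hbb, hbb] at this
    exact hst this

end Existence

section OrderZero

attribute [local instance] CStarAlgebra.spectralOrder CStarAlgebra.spectralOrderedRing

variable {F X : Type} [NonUnitalCStarAlgebra F] [NonUnitalCStarAlgebra X]

lemma exists_fdUnit [FiniteDimensional ℂ F] : ∃ e : F, star e = e ∧ ∀ x, e * x = x ∧ x * e = x := by
  obtain ⟨M⟩ := nonempty_matUnits (F := F)
  have h1 : star (∑ s, M.v s * star (M.v s)) = ∑ s, M.v s * star (M.v s) := by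
    simp [star_sum]
  refine ⟨∑ s, M.v s * star (M.v s), h1, fun x => ⟨M.unit_mul x, ?_⟩⟩
  have := congrArg star (M.unit_mul (star x))
  rwa [star_mul, star_star, h1] at this

variable (F) in
/-- The unit of a finite-dimensional C*-algebra. -/
noncomputable def fdUnit [FiniteDimensional ℂ F] : F := exists_fdUnit.choose

section
variable [FiniteDimensional ℂ F]

@[simp] lemma star_fdUnit : star (fdUnit F) = fdUnit F := exists_fdUnit.choose_spec.1
@[simp] lemma fdUnit_mul (x : F) : fdUnit F * x = x := (exists_fdUnit.choose_spec.2 x).1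
@[simp] lemma mul_fdUnit (x : F) : x * fdUnit F = x := (exists_fdUnit.choose_spec.2 x).2

lemma norm_proj_le {q : X} (h1 : star q = q) (h2 : q * q = q) : ‖q‖ ≤ 1 := by
  have := CStarRing.norm_star_mul_self (x := q)
  rw [h1, h2] at this
  nlinarith [norm_nonneg q]

lemma norm_fdUnit_le : ‖fdUnit F‖ ≤ 1 := norm_proj_le star_fdUnit (fdUnit_mul _)

lemma fdUnit_nonneg : 0 ≤ fdUnit F := by
  have := star_mul_self_nonneg (fdUnit F)
  simpa using this

lemma le_norm_smul_fdUnit {y : F} (hy : 0 ≤ y) : y ≤ ‖y‖ • fdUnit F := by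
  simpa using CStarAlgebra.star_left_conjugate_le_norm_smul (a := fdUnit F) (b := y)

end

lemma mul_eq_zero_of_conj_eq_zero {a d : X} (ha : 0 ≤ a) (h : star d * a * d = 0) : a * d = 0 := by
  obtain ⟨b, rfl⟩ := CStarAlgebra.nonneg_iff_eq_star_mul_self.1 ha
  have : b * d = 0 := by
    rw [← CStarRing.star_mul_self_eq_zero_iff, star_mul, ← h]; simp only [mul_assoc]
  rw [mul_assoc, this, mul_zero]

variable [FiniteDimensional ℂ F] {φ : F →ₗ[ℂ] X}

lemma IsOrderZero.proj (hz : IsOrderZero φ) {q : F} (h1 : star q = q)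
    (h2 : q * q = q) : φ q * φ (fdUnit F) = φ q * φ q ∧ φ (fdUnit F) * φ q = φ q * φ q := by
  have hq : IsPositiveElem q := ⟨q, by rw [h1, h2]⟩
  have hq' : IsPositiveElem (fdUnit F - q) := ⟨fdUnit F - q, by simp [h1, mul_sub, sub_mul, h2]⟩
  have e1 := hz _ _ hq hq' (by simp [mul_sub, h2])
  have e2 := hz _ _ hq' hq (by simp [sub_mul, h2])
  rw [map_sub, mul_sub, sub_eq_zero] at e1
  rw [map_sub, sub_mul, sub_eq_zero] at e2
  exact ⟨e1, e2⟩

lemma IsOrderZero.selfAdjoint_aux (hz : IsOrderZero φ) {x : F}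
    (hx : IsSelfAdjoint x) : φ x * φ (fdUnit F) = φ (fdUnit F) * φ x ∧
      φ x * φ x = φ (fdUnit F) * φ (x * x) := by
  obtain ⟨s, h0, hs⟩ := exists_spectral_decomposition hx
  have hq : ∀ r ∈ s, specProj x r * specProj x r = specProj x r := fun r hr => by
    have : r ≠ 0 := fun h => h0 (h ▸ hr)
    simpa using specProj_mul (x := x) r r this this
  have hqq : ∀ r ∈ s, ∀ t ∈ s, r ≠ t → specProj x r * specProj x t = 0 := fun r hr t ht hne => by
    simpa [hne] using specProj_mul (x := x) r t (fun h => h0 (h ▸ hr)) (fun h => h0 (h ▸ ht))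
  have hp : ∀ r ∈ s, IsPositiveElem (specProj x r) := fun r hr =>
    ⟨specProj x r, by rw [(isSelfAdjoint_specProj x r).star_eq, hq r hr]⟩
  have hpr := fun r hr => hz.proj (isSelfAdjoint_specProj x r).star_eq (hq r hr)
  have hφ : φ x = ∑ r ∈ s, (r : ℂ) • φ (specProj x r) := by
    conv_lhs => rw [hs]
    simp
  have hxx : x * x = ∑ r ∈ s, ((r : ℂ) * r) • specProj x r := by
    conv_lhs => rw [hs, Finset.sum_mul_sum]
    refine Finset.sum_congr rfl fun r hr => ?_
    rw [Finset.sum_eq_single_of_mem r hr, smul_mul_smul_comm, hq r hr]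
    intro t ht hne
    rw [smul_mul_smul_comm, hqq r hr t ht hne.symm, smul_zero]
  constructor
  · rw [hφ, Finset.sum_mul, Finset.mul_sum]
    refine Finset.sum_congr rfl fun r hr => ?_
    rw [smul_mul_assoc, mul_smul_comm, (hpr r hr).1, (hpr r hr).2]
  · rw [hxx, map_sum, Finset.mul_sum, hφ, Finset.sum_mul_sum]
    refine Finset.sum_congr rfl fun r hr => ?_
    rw [Finset.sum_eq_single_of_mem r hr, smul_mul_smul_comm, map_smul, mul_smul_comm,
      (hpr r hr).2]
    intro t ht hne
    rw [smul_mul_smul_comm, hz _ _ (hp r hr) (hp t ht) (hqq r hr t ht hne.symm), smul_zero]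

lemma IsOrderZero.comm_unit (hz : IsOrderZero φ) (x : F) :
    φ (fdUnit F) * φ x = φ x * φ (fdUnit F) := by
  have h := realPart_add_I_smul_imaginaryPart x
  have h1 := (hz.selfAdjoint_aux (realPart x).2).1
  have h2 := (hz.selfAdjoint_aux (imaginaryPart x).2).1
  rw [← h, map_add, map_smul, mul_add, add_mul, h1, mul_smul_comm, smul_mul_assoc, h2]

lemma IsOrderZero.sq_aux (hz : IsOrderZero φ) (x : F) :
    φ (star x) * φ x + φ x * φ (star x) = φ (fdUnit F) * φ (star x * x + x * star x) := by
  have h := realPart_add_I_smul_imaginaryPart x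
  have h1 := (hz.selfAdjoint_aux (realPart x).2).2
  have h2 := (hz.selfAdjoint_aux (imaginaryPart x).2).2
  set a : F := (realPart x : F)
  set b : F := (imaginaryPart x : F)
  have ha : star a = a := (realPart x).2
  have hb : star b = b := (imaginaryPart x).2
  have e1 : star x * x + x * star x = (2 : ℂ) • (a * a) + (2 : ℂ) • (b * b) := by
    rw [← h, star_add, star_smul, ha, hb]
    simp only [add_mul, mul_add, smul_mul_assoc, mul_smul_comm]
    match_scalars <;> simp <;> norm_num
  have e2 : φ (star x) * φ x + φ x * φ (star x) =
      (2 : ℂ) • (φ a * φ a) + (2 : ℂ) • (φ b * φ b) := by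
    rw [← h, star_add, star_smul, ha, hb]
    simp only [map_add, map_smul, add_mul, mul_add, smul_mul_assoc, mul_smul_comm]
    match_scalars <;> simp <;> norm_num
  rw [e1, e2, h1, h2, map_add, map_smul, map_smul, mul_add, mul_smul_comm, mul_smul_comm]

lemma IsOrderZero.star_mul_aux (hc : IsCPMap φ) (hz : IsOrderZero φ) (x : F) :
    φ (star x) * φ x = φ (fdUnit F) * φ (star x * x) := by
  set h := φ (fdUnit F) with hh
  have hsa : star h = h := by rw [hh, ← hc.map_star, star_fdUnit]
  have hpos : 0 ≤ h := hc.map_nonneg fdUnit_nonneg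
  have hcomm : ∀ y, h * φ y = φ y * h := hz.comm_unit
  have hP : ∀ y, 0 ≤ h * (h * φ (star y * y) - φ (star y) * φ y) := by
    intro y
    obtain ⟨B, hB⟩ := hc.gram ![y, fdUnit F]
    have b00 := hB 0 0
    have b01 := hB 0 1
    have b10 := hB 1 0
    have b11 := hB 1 1
    simp only [Matrix.cons_val_zero, Matrix.cons_val_one, star_fdUnit, mul_fdUnit, fdUnit_mul,
      Fin.sum_univ_two, Matrix.cons_val_fin_one] at b00 b01 b10 b11
    have : h * (h * φ (star y * y) - φ (star y) * φ y) =
        ∑ k, star (B k 0 * h - B k 1 * φ y) * (B k 0 * h - B k 1 * φ y) := by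
      have e : ∀ k, star (B k 0 * h - B k 1 * φ y) * (B k 0 * h - B k 1 * φ y) =
          h * (star (B k 0) * B k 0) * h - h * (star (B k 0) * B k 1) * φ y
          - star (φ y) * (star (B k 1) * B k 0) * h
          + star (φ y) * (star (B k 1) * B k 1) * φ y := fun k => by
        simp only [star_sub, star_mul, hsa, sub_mul, mul_sub, mul_assoc]; abel
      have e2 : ∑ k, star (B k 0 * h - B k 1 * φ y) * (B k 0 * h - B k 1 * φ y) =
          h * φ (star y * y) * h - h * φ (star y) * φ y - star (φ y) * φ y * h
            + star (φ y) * h * φ y := by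
        have b11' : h = _ := b11
        generalize φ y = z, φ (star y) = z', φ (star y * y) = t at b00 b01 b10 e ⊢
        rw [Fin.sum_univ_two, e, e]
        calc _ = h * (star (B 0 0) * B 0 0 + star (B 1 0) * B 1 0) * h
              - h * (star (B 0 0) * B 0 1 + star (B 1 0) * B 1 1) * z
              - star z * (star (B 0 1) * B 0 0 + star (B 1 1) * B 1 0) * h
              + star z * (star (B 0 1) * B 0 1 + star (B 1 1) * B 1 1) * z := by
              simp only [mul_add, add_mul]; abel
          _ = _ := by rw [← b00, ← b01, ← b10, ← b11']
      rw [e2, ← hc.map_star, ← hcomm (star y), mul_assoc _ _ h, mul_assoc (φ (star y)) (φ y) h,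
        ← hcomm (star y * y), ← hcomm y, ← mul_assoc (φ (star y)) h, ← hcomm (star y)]
      simp only [mul_sub, mul_assoc]; abel
    rw [this]
    exact Finset.sum_nonneg fun k _ => star_mul_self_nonneg _
  have hsum : h * (h * φ (star x * x) - φ (star x) * φ x) +
      h * (h * φ (star (star x) * star x) - φ (star (star x)) * φ (star x)) = 0 := by
    rw [← mul_add, star_star]
    have := hz.sq_aux x
    rw [map_add, mul_add, ← hh] at this
    have e : h * φ (star x * x) - φ (star x) * φ x + (h * φ (x * star x) - φ x * φ (star x)) =
      h * φ (star x * x) + h * φ (x * star x) - (φ (star x) * φ x + φ x * φ (star x)) := by abel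
    rw [e, this, sub_self, mul_zero]
  set D := h * φ (star x * x) - φ (star x) * φ x with hD
  have hhD : h * D = 0 := by
    have h1 := hP x
    have h2 := hP (star x)
    rw [add_eq_zero_iff_of_nonneg h1 h2] at hsum
    exact hsum.1
  have hDsa : star D = D := by
    rw [hD, star_sub, star_mul, star_mul, hsa, ← hc.map_star, ← hc.map_star, ← hc.map_star,
      star_mul, star_star, hcomm]
  have hyD : ∀ y, φ y * D = 0 := by
    intro y
    obtain ⟨w, hw, -, hyw⟩ := CStarAlgebra.exists_sum_four_nonneg y
    rw [hyw, map_sum, Finset.sum_mul]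
    refine Finset.sum_eq_zero fun i _ => ?_
    rw [map_smul, smul_mul_assoc]
    have hle : φ (w i) ≤ ‖w i‖ • h := by
      have := hc.mono (le_norm_smul_fdUnit (hw i))
      rwa [← Complex.coe_smul, map_smul, Complex.coe_smul] at this
    rw [mul_eq_zero_of_conj_eq_zero (hc.map_nonneg (hw i)), smul_zero]
    refine le_antisymm ?_ (star_left_conjugate_nonneg (hc.map_nonneg (hw i)) D)
    have := star_left_conjugate_le_conjugate hle D
    rwa [mul_smul_comm, smul_mul_assoc, mul_assoc (star D) h D, hhD, mul_zero, smul_zero] at this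
  have hDD : star D * D = 0 := by
    rw [hDsa]
    nth_rewrite 1 [hD]
    rw [sub_mul, mul_assoc, mul_assoc, hyD, hyD]; simp
  exact (sub_eq_zero.1 ((CStarRing.star_mul_self_eq_zero_iff _).1 hDD)).symm

/-- The structure relation of completely positive order-zero maps. -/
theorem IsOrderZero.mul_eq (hc : IsCPMap φ) (hz : IsOrderZero φ) (x y : F) :
    φ x * φ y = φ (fdUnit F) * φ (x * y) := by
  have key : ∀ x y, φ (star x) * φ y = φ (fdUnit F) * φ (star x * y) := by
    intro x y
    have h := hz.star_mul_aux hc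
    have h1 := h (x + y)
    have h2 := h (x + Complex.I • y)
    have hx := h x
    have hy := h y
    simp only [star_add, star_smul, map_add, map_smul, add_mul, mul_add, smul_mul_assoc,
      mul_smul_comm, hx, hy, RCLike.star_def, Complex.conj_I] at h1 h2
    have h3 : (2 : ℂ) • (φ (star x) * φ y - φ (fdUnit F) * φ (star x * y)) = 0 := by
      have h4 := congrArg₂ (fun u v => u - Complex.I • v) (sub_eq_zero.2 h1) (sub_eq_zero.2 h2)
      rw [smul_zero, sub_zero] at h4
      rw [← h4]
      match_scalars <;> ring_nf <;> simp <;> norm_num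
    exact sub_eq_zero.1 ((smul_eq_zero_iff_right two_ne_zero).1 h3)
  simpa using key (star x) y

lemma IsOrderZero.norm_le (hc : IsCPMap φ) (hz : IsOrderZero φ) (x : F) :
    ‖φ x‖ ≤ ‖φ (fdUnit F)‖ * ‖x‖ := by
  have h1 : ‖φ (star x * x)‖ ≤ ‖x‖ * ‖x‖ * ‖φ (fdUnit F)‖ := by
    have := hc.mono (le_norm_smul_fdUnit (star_mul_self_nonneg x))
    rw [← Complex.coe_smul, map_smul, Complex.coe_smul, CStarRing.norm_star_mul_self] at this
    refine (CStarAlgebra.norm_le_norm_of_nonneg_of_le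
      (hc.map_nonneg (star_mul_self_nonneg x)) this).trans ?_
    rw [norm_smul, Real.norm_of_nonneg (by positivity)]
  have h2 : ‖φ x‖ * ‖φ x‖ ≤ ‖φ (fdUnit F)‖ * (‖x‖ * ‖x‖ * ‖φ (fdUnit F)‖) := by
    rw [← CStarRing.norm_star_mul_self, ← hc.map_star, hz.star_mul_aux hc]
    exact (norm_mul_le _ _).trans (by gcongr)
  refine abs_le_of_sq_le_sq' ?_ (by positivity) |>.2
  nlinarith

end OrderZero

section Pieces

/-- A factorization of a completely positive contraction on `X` through a finite-dimensional
C*-algebra, whose upward map has order zero. -/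
structure Piece (X : Type) [NonUnitalCStarAlgebra X] : Type 1 where
  F : CStarBundle
  fd : FiniteDimensional ℂ F.X
  ψ : X →ₗ[ℂ] F.X
  φ : F.X →ₗ[ℂ] X
  cp_ψ : IsCPMap ψ
  norm_ψ : ∀ a, ‖ψ a‖ ≤ ‖a‖
  cp_φ : IsCPMap φ
  zero_φ : IsOrderZero φ
  norm_φ : ∀ y, ‖φ y‖ ≤ ‖y‖

attribute [instance] Piece.fd

variable {X Y : Type} [NonUnitalCStarAlgebra X] [NonUnitalCStarAlgebra Y]

/-- The composite `φ ∘ ψ` of a piece. -/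
def Piece.θ (P : Piece X) : X →ₗ[ℂ] X := P.φ ∘ₗ P.ψ

lemma Piece.θ_apply (P : Piece X) (a : X) : P.θ a = P.φ (P.ψ a) := rfl

lemma Piece.cp_θ (P : Piece X) : IsCPMap P.θ := P.cp_φ.comp P.cp_ψ

/-- Approximation of the identity by sums of pieces indexed by a finite type `κ`. -/
def Decomposes (κ : Type) [Fintype κ] (X : Type) [NonUnitalCStarAlgebra X] : Prop :=
  ∀ (S : Finset X) (ε : ℝ), 0 < ε → ∃ P : κ → Piece X, ∀ a ∈ S, ‖∑ i, (P i).θ a - a‖ < ε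

lemma isCPMap_proj {κ : Type} [Fintype κ] {F : κ → CStarBundle} (i : κ) :
    IsCPMap (LinearMap.proj i : (∀ j, (F j).X) →ₗ[ℂ] (F i).X) :=
  isCPMap_of_starHom _ fun _ _ => rfl

lemma IsCPMap.pi {κ : Type} [Fintype κ] {F : κ → CStarBundle} {f : ∀ i, X →ₗ[ℂ] (F i).X}
    (hf : ∀ i, IsCPMap (f i)) : IsCPMap (LinearMap.pi f) := fun n M hM => by
  choose B hB using fun i => hf i n M hM
  refine ⟨Matrix.of fun j k i => B i j k, ?_⟩
  ext j k i
  have := congrFun (congrFun (hB i) j) k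
  simp only [Matrix.map_apply, Matrix.mul_apply, Matrix.star_apply] at this
  simp [Matrix.mul_apply, Matrix.star_apply, this]

lemma nucDimLE_iff {A : CStarBundle} {d : ℕ} : NucDimLE A d ↔ Decomposes (Fin (d + 1)) A.X := by
  constructor
  · intro h S ε hε
    obtain ⟨F, ψ, φ, hF, h1, h2, -, h4, h5⟩ := h S ε hε
    have : ∀ i, FiniteDimensional ℂ (F i).X := hF
    refine ⟨fun i => ⟨F i, hF i, LinearMap.proj i ∘ₗ ψ,
      φ.comp (LinearMap.single ℂ (fun j => (F j).X) i), (isCPMap_proj i).comp h1,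
      fun a => (norm_le_pi_norm _ i).trans (h2 a), (h4 i).1, (h4 i).2.1, (h4 i).2.2⟩,
      fun a ha => ?_⟩
    convert h5 a ha using 3
    simp only [Piece.θ_apply, LinearMap.comp_apply]
    rw [← map_sum]
    congr 1
    exact LinearMap.sum_single_apply (fun j => (F j).X) (ψ a)
  · intro h S ε hε
    obtain ⟨P, hP⟩ := h S ε hε
    have key : ∀ i, (∑ j, (P j).φ ∘ₗ (LinearMap.proj j : (∀ j, (P j).F.X) →ₗ[ℂ] (P j).F.X)).comp
        (LinearMap.single ℂ (fun j => (P j).F.X) i) = (P i).φ := by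
      intro i
      ext x
      simp only [LinearMap.comp_apply, LinearMap.sum_apply, LinearMap.proj_apply,
        LinearMap.single_apply]
      rw [Finset.sum_eq_single i]
      · simp
      · intro j _ hj; simp [hj]
      · simp
    refine ⟨fun i => (P i).F, LinearMap.pi fun i => (P i).ψ,
      ∑ i, (P i).φ ∘ₗ LinearMap.proj i, fun i => (P i).fd, IsCPMap.pi fun i => (P i).cp_ψ,
      fun a => (pi_norm_le_iff_of_nonneg (norm_nonneg _)).2 fun i => (P i).norm_ψ a,
      IsCPMap.sum _ fun i _ => (P i).cp_φ.comp (isCPMap_proj i), fun i => ?_, fun a ha => ?_⟩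
    · rw [key i]
      refine ⟨(P i).cp_φ, (P i).zero_φ, fun x => ?_⟩
      have := congrArg (fun f => f x) (key i)
      simp only [LinearMap.comp_apply] at this
      exact this ▸ (P i).norm_φ x
    · convert hP a ha using 3
      simp [Piece.θ_apply]

/-- The zero piece. -/
noncomputable def Piece.zero (X : Type) [NonUnitalCStarAlgebra X] : Piece X where
  F := ⟨ℂ⟩
  fd := inferInstanceAs (FiniteDimensional ℂ ℂ)
  ψ := 0
  φ := 0
  cp_ψ := isCPMap_zero
  norm_ψ := by simp
  cp_φ := isCPMap_zero
  zero_φ := fun _ _ _ _ _ => by simp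
  norm_φ := by simp

lemma NucDimLE.mono {A : CStarBundle} {d e : ℕ} (h : NucDimLE A d) (hde : d ≤ e) :
    NucDimLE A e := by
  obtain ⟨k, rfl⟩ := Nat.exists_eq_add_of_le hde
  induction k with
  | zero => exact h
  | succ k ih =>
    have := ih (Nat.le_add_right _ _)
    rw [nucDimLE_iff] at this ⊢
    intro S ε hε
    obtain ⟨P, hP⟩ := this S ε hε
    refine ⟨Fin.snoc (α := fun _ => Piece A.X) P (Piece.zero A.X), fun a ha => ?_⟩
    have e0 : (Piece.zero A.X).θ a = 0 := rfl
    have : ∑ i : Fin (d + (k + 1) + 1),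
        (Fin.snoc (α := fun _ => Piece A.X) P (Piece.zero A.X) i : Piece A.X).θ a =
        ∑ i, (P i).θ a := by
      rw [Fin.sum_univ_castSucc]
      have : (Fin.snoc (α := fun _ => Piece A.X) P (Piece.zero A.X) (Fin.last (d + (k + 1))) :
        Piece A.X) = Piece.zero A.X := Fin.snoc_last (α := fun _ => Piece A.X) _ _
      rw [this, e0, add_zero]
      refine Finset.sum_congr rfl fun i _ => ?_
      rw [Fin.snoc_castSucc (α := fun _ => Piece A.X)]
    rw [this]
    exact hP a ha

lemma nucDim_le_iff {A : CStarBundle} {d : ℕ} : nucDim A ≤ d ↔ NucDimLE A d := by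
  refine ⟨fun h => ?_, fun h => sInf_le ⟨d, rfl, h⟩⟩
  have hne : {d : ℕ∞ | ∃ k : ℕ, (k : ℕ∞) = d ∧ NucDimLE A k}.Nonempty := by
    by_contra hne
    rw [Set.not_nonempty_iff_eq_empty] at hne
    rw [nucDim, hne, sInf_empty] at h
    exact absurd h (by simp)
  obtain ⟨k, hk, hA⟩ := csInf_mem hne
  have : (k : ℕ∞) ≤ d := hk.le.trans h
  exact hA.mono (by exact_mod_cast this)

lemma nucDim_eq_max {A I Q : CStarBundle}
    (h : ∀ d, NucDimLE A d ↔ NucDimLE I d ∧ NucDimLE Q d) :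
    nucDim A = max (nucDim I) (nucDim Q) := by
  refine eq_of_forall_ge_iff fun c => ?_
  induction c using ENat.recTopCoe with
  | top => simp
  | coe d =>
    have := h d
    rw [← nucDim_le_iff, ← nucDim_le_iff, ← nucDim_le_iff] at this
    rw [max_le_iff]
    exact this

end Pieces

section Corner

attribute [local instance] CStarAlgebra.spectralOrder CStarAlgebra.spectralOrderedRing

variable {X Y Z : Type} [NonUnitalCStarAlgebra X] [NonUnitalCStarAlgebra Y]
  [NonUnitalCStarAlgebra Z]

lemma map_cfcₙ_real (f : X →⋆ₙₐ[ℂ] Y) (g : ℝ → ℝ) {a : X} (ha : IsSelfAdjoint a)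
    (hg : Continuous g) (h0 : g 0 = 0) : f (cfcₙ g a) = cfcₙ g (f a) := by
  have hf : Continuous f := map_continuous f
  have := NonUnitalStarAlgHomClass.map_cfcₙ (R := ℝ) (S := ℂ) f g a hg.continuousOn h0 hf
    ha (ha.map f)
  exact this

lemma nonneg_of_map_nonneg (f : X →⋆ₙₐ[ℂ] Y) (hf : Function.Injective f) {a : X} (h : 0 ≤ f a) :
    0 ≤ a := by
  have ha : IsSelfAdjoint a := hf (by rw [map_star, h.isSelfAdjoint.star_eq])
  have h1 : f (a⁻) = 0 := by
    rw [CFC.negPart_def, map_cfcₙ_real f _ ha continuous_negPart (by simp), ← CFC.negPart_def]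
    exact (CFC.negPart_eq_zero_iff _).2 h
  rw [← CFC.negPart_eq_zero_iff a ha]
  exact hf (by rw [h1, map_zero])

lemma isCPMap_of_injective_comp (f : Y →⋆ₙₐ[ℂ] Z) (hf : Function.Injective f) {g : X →ₗ[ℂ] Y}
    (h : IsCPMap ((f : Y →ₗ[ℂ] Z) ∘ₗ g)) : IsCPMap g := fun n M hM => by
  have := h n M hM
  rw [isPositiveElem_matrix_iff] at this ⊢
  refine nonneg_of_map_nonneg (CStarMatrix.mapₙₐ f) (fun A B hAB => ?_) this
  ext i j
  exact hf (congrFun (congrFun hAB i) j)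

/-- The corner `q X q` of a C*-algebra. -/
def corner (q : X) (h1 : star q = q) : NonUnitalStarSubalgebra ℂ X where
  carrier := {x | q * x = x ∧ x * q = x}
  add_mem' := fun ha hb => ⟨by rw [mul_add, ha.1, hb.1], by rw [add_mul, ha.2, hb.2]⟩
  zero_mem' := by simp
  mul_mem' := fun ha hb => ⟨by rw [← mul_assoc, ha.1], by rw [mul_assoc, hb.2]⟩
  smul_mem' := fun c x ha => ⟨by rw [mul_smul_comm, ha.1], by rw [smul_mul_assoc, ha.2]⟩
  star_mem' := fun {a} ha => ⟨by simpa [h1] using congrArg star ha.2, by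
    simpa [h1] using congrArg star ha.1⟩

lemma isClosed_corner (q : X) (h1 : star q = q) : IsClosed (corner q h1 : Set X) :=
  (isClosed_eq (by fun_prop) continuous_id).inter (isClosed_eq (by fun_prop) continuous_id)

lemma cut_cfcₙ {h : X} (hh : IsSelfAdjoint h) {g : ℝ → ℝ} (hg : ContinuousOn g (quasispectrum ℝ h))
    (g0 : g 0 = 0) : cut (cfcₙ g h) h =
    cfcₙ (fun t => t - t * g t - g t * t + g t * t * g t) h := by
  have hid : ContinuousOn (fun t : ℝ => t) (quasispectrum ℝ h) := continuousOn_id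
  rw [cfcₙ_add _ _ h, cfcₙ_sub _ _ h, cfcₙ_sub _ _ h, cfcₙ_mul _ _ h, cfcₙ_mul _ _ h,
    cfcₙ_mul _ _ h,
    cfcₙ_mul _ _ h, cfcₙ_id' ℝ h, cut_apply, (IsSelfAdjoint.cfcₙ (f := g) (a := h)).star_eq]

lemma norm_cut_cfcₙ_le {h : X} (hh : 0 ≤ h) {g : ℝ → ℝ} (hg : ContinuousOn g (quasispectrum ℝ h))
    (g0 : g 0 = 0) {c : ℝ} (hc : ∀ t, 0 ≤ t → t * (1 - g t) ^ 2 ≤ c) : ‖cut (cfcₙ g h) h‖ ≤ c := by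
  rw [cut_cfcₙ hh.isSelfAdjoint hg g0]
  refine norm_cfcₙ_le fun t ht => ?_
  have h0 : 0 ≤ t := quasispectrum_nonneg_of_nonneg h hh t ht
  have : t - t * g t - g t * t + g t * t * g t = t * (1 - g t) ^ 2 := by ring
  rw [this, Real.norm_of_nonneg (by positivity)]
  exact hc t h0

/-- If `q` almost acts as a unit on `D ≥ Y ≥ 0`, then `q Y q` is close to `Y`. -/
lemma norm_sub_conj_le {Y D q : X} (hY : 0 ≤ Y) (hYD : Y ≤ D) (hq : star q = q) (hq1 : ‖q‖ ≤ 1)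
    {μ ν : ℝ} (hμ : ‖cut q D‖ ≤ μ) (hν : ‖Y‖ ≤ ν) : ‖Y - q * Y * q‖ ≤ 2 * √(ν * μ) := by
  have h1 : ‖cut q Y‖ ≤ μ := (CStarAlgebra.norm_le_norm_of_nonneg_of_le
    ((isCPMap_cut q).map_nonneg hY) ((isCPMap_cut q).mono hYD)).trans hμ
  obtain ⟨b, rfl⟩ := CStarAlgebra.nonneg_iff_eq_star_mul_self.1 hY
  have h2 : ‖b - b * q‖ * ‖b - b * q‖ ≤ μ := by
    rw [← CStarRing.norm_star_mul_self]
    convert h1 using 2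
    simp [mul_sub, sub_mul, mul_assoc]; abel
  have h3 : ‖b‖ * ‖b‖ ≤ ν := by rwa [← CStarRing.norm_star_mul_self]
  have h4 : ‖star b * b - star b * b * q‖ ≤ √(ν * μ) := by
    refine Real.le_sqrt_of_sq_le ?_
    have e : star b * b - star b * b * q = star b * (b - b * q) := by rw [mul_sub, mul_assoc]
    rw [e]
    have := norm_mul_le (star b) (b - b * q)
    rw [norm_star] at this
    calc _ ≤ (‖b‖ * ‖b - b * q‖) ^ 2 := by gcongr
      _ = (‖b‖ * ‖b‖) * (‖b - b * q‖ * ‖b - b * q‖) := by ring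
      _ ≤ _ := by gcongr; exact (by positivity : (0:ℝ) ≤ ‖b‖ * ‖b‖).trans h3
  have h5 : star b * b - q * (star b * b) * q = star (star b * b - star b * b * q) +
      q * (star b * b - star b * b * q) := by
    simp [hq, mul_sub, mul_assoc]
  rw [h5]
  refine (norm_add_le _ _).trans ?_
  rw [norm_star]
  have h6 := norm_mul_le q (star b * b - star b * b * q)
  nlinarith [norm_nonneg q, norm_nonneg (star b * b - star b * b * q)]

lemma exists_spectral_cut [FiniteDimensional ℂ X] {D : X} (hD : 0 ≤ D) {η : ℝ} (hη : 0 < η) :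
    ∃ q : X, star q = q ∧ q * q = q ∧ η • q ≤ D ∧ ‖cut q D‖ ≤ η := by
  have hc := fun f : ℝ → ℝ => continuousOn_qs f D
  let f : ℝ → ℝ := fun t => if η ≤ t then 1 else 0
  have f0 : f 0 = 0 := by simp [f, hη]
  refine ⟨cfcₙ f D, IsSelfAdjoint.cfcₙ, ?_, ?_, norm_cut_cfcₙ_le hD (hc _) f0 fun t ht => ?_⟩
  · rw [← cfcₙ_mul _ _ D (hc _) f0 (hc _) f0]
    congr 1; ext t; simp only [f]; split_ifs <;> simp
  · rw [← cfcₙ_const_mul η f D (hc _) f0]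
    conv_rhs => rw [← cfcₙ_id' ℝ D hD.isSelfAdjoint]
    refine cfcₙ_mono (fun t ht => ?_) (hc _) (hc _) (by simp [f0]) rfl
    have h0 : 0 ≤ t := quasispectrum_nonneg_of_nonneg D hD t ht
    simp only [f]; split_ifs <;> simp [*]
  · simp only [f]; split_ifs with h
    · simp [hη.le]
    · simp; linarith

end Corner

section Compression

attribute [local instance] CStarAlgebra.spectralOrder CStarAlgebra.spectralOrderedRing

variable {X : Type} [NonUnitalCStarAlgebra X]

lemma norm_sum_four_le {Y : Type} [NonUnitalCStarAlgebra Y] (f : X →ₗ[ℂ] Y) {C : ℝ}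
    (h : ∀ x : X, 0 ≤ x → ‖f x‖ ≤ C * ‖x‖) (hC : 0 ≤ C) (x : X) : ‖f x‖ ≤ 4 * C * ‖x‖ := by
  obtain ⟨w, h1, h2, h3⟩ := CStarAlgebra.exists_sum_four_nonneg x
  conv_lhs => rw [h3]
  rw [map_sum]
  refine (norm_sum_le _ _).trans ?_
  calc _ ≤ ∑ i : Fin 4, C * ‖x‖ := Finset.sum_le_sum fun i _ => by
        rw [map_smul, norm_smul, norm_pow, Complex.norm_I, one_pow, one_mul]
        exact (h _ (h1 i)).trans (by gcongr; exact h2 i)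
    _ = _ := by simp; ring

lemma norm_conj_le {q : X} (hq : ‖q‖ ≤ 1) (a : X) : ‖q * a * q‖ ≤ ‖a‖ := by
  have h1 := norm_mul₃_le (a := q) (b := a) (c := q)
  have h2 : ‖q‖ * ‖a‖ ≤ ‖a‖ := mul_le_of_le_one_left (norm_nonneg _) hq
  have h3 : ‖q‖ * ‖a‖ * ‖q‖ ≤ ‖q‖ * ‖a‖ := mul_le_of_le_one_right (by positivity) hq
  linarith

lemma norm_le_one_of_cfcₙ {h : X} {g : ℝ → ℝ} (hg : ∀ t, |g t| ≤ 1) : ‖cfcₙ g h‖ ≤ 1 :=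
  norm_cfcₙ_le fun t _ => hg t

set_option maxHeartbeats 1000000 in
theorem Piece.exists_compressed (P : Piece X) {p : X} (hp : star p = p) (hpp : p * p = p)
    {η γ δ : ℝ} (hη : 0 < η) (hγ : 0 < γ) (hδ : ‖cut p (P.θ p)‖ ≤ δ) :
    ∃ (P' : Piece X) (k : X), star k = k ∧ ‖k‖ ≤ 1 ∧ (∀ y, k * P'.φ y = P'.φ y) ∧
      ‖k - k * p‖ ^ 2 ≤ δ / (η * γ) ∧
      ∀ x, ‖P'.θ x - P.θ (p * x * p)‖ ≤ 8 * (√η + √(2 * γ)) * ‖x‖ := by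
  have hp0 : 0 ≤ p := by simpa [hp, hpp] using star_mul_self_nonneg p
  have hD : 0 ≤ P.ψ p := P.cp_ψ.map_nonneg hp0
  obtain ⟨q, q1, q2, q3, q4⟩ := exists_spectral_cut hD hη
  have hq0 : 0 ≤ q := by simpa [q1, q2] using star_mul_self_nonneg q
  have hqn : ‖q‖ ≤ 1 := norm_proj_le q1 q2
  set h := P.φ q with hh
  have hh0 : 0 ≤ h := P.cp_φ.map_nonneg hq0
  let gf : ℝ → ℝ := fun t => max 0 (min 1 (t / γ - 1))
  let kf : ℝ → ℝ := fun t => max 0 (min 1 (t / γ))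
  have gc : Continuous gf := by fun_prop
  have kc : Continuous kf := by fun_prop
  have g0 : gf 0 = 0 := by simp [gf]
  have k0 : kf 0 = 0 := by simp [kf]
  set g := cfcₙ gf h with hg
  set k := cfcₙ kf h with hk
  have gsa : star g = g := IsSelfAdjoint.cfcₙ
  have ksa : star k = k := IsSelfAdjoint.cfcₙ
  have gn : ‖g‖ ≤ 1 := norm_le_one_of_cfcₙ fun t => by
    rw [abs_of_nonneg (le_max_left _ _)]; exact max_le zero_le_one (min_le_left _ _)
  have kn : ‖k‖ ≤ 1 := norm_le_one_of_cfcₙ fun t => by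
    rw [abs_of_nonneg (le_max_left _ _)]; exact max_le zero_le_one (min_le_left _ _)
  have kg : k * g = g := by
    rw [hk, hg, ← cfcₙ_mul _ _ h kc.continuousOn k0 gc.continuousOn g0]
    congr 1; ext t
    simp only [gf, kf]
    rcases le_total (t / γ) 1 with h | h
    · rw [max_eq_left (b := min 1 (t / γ - 1)) ((min_le_right _ _).trans (by linarith)), mul_zero]
    · rw [min_eq_left h, max_eq_right zero_le_one, one_mul]
  have gcut : ‖cut g h‖ ≤ 2 * γ := norm_cut_cfcₙ_le hh0 gc.continuousOn g0 fun t ht => by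
    simp only [gf]
    rcases le_total (t / γ) 2 with h | h
    · have h1 : t ≤ 2 * γ := by rwa [div_le_iff₀ hγ] at h
      have h2 : 0 ≤ max 0 (min 1 (t / γ - 1)) := le_max_left _ _
      have h3 : max 0 (min 1 (t / γ - 1)) ≤ 1 := max_le zero_le_one (min_le_left _ _)
      calc _ ≤ t * 1 := by gcongr; nlinarith
        _ ≤ _ := by linarith
    · rw [min_eq_left (by linarith), max_eq_right zero_le_one]; simp [hγ.le]
  have kcut : ‖k - k * p‖ ^ 2 ≤ δ / (η * γ) := by
    have e1 : ‖k - k * p‖ ^ 2 = ‖cut p (k * k)‖ := by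
      rw [sq, ← CStarRing.norm_star_mul_self]
      congr 1
      simp [mul_sub, sub_mul, mul_assoc, ksa]; abel
    have e2 : k * k ≤ (η⁻¹ * γ⁻¹) • P.θ p := by
      have e3 : k * k ≤ γ⁻¹ • h := by
        rw [hk, ← cfcₙ_mul _ _ h kc.continuousOn k0 kc.continuousOn k0]
        have e : γ⁻¹ • h = cfcₙ (fun t => γ⁻¹ * t) h := by
          rw [cfcₙ_const_mul γ⁻¹ (fun t : ℝ => t) h continuousOn_id rfl,
            cfcₙ_id' ℝ h hh0.isSelfAdjoint]
        rw [e]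
        refine cfcₙ_mono (fun t ht => ?_) (kc.mul kc).continuousOn (by fun_prop) (by simp [k0])
          (by simp)
        have h0 : 0 ≤ t := quasispectrum_nonneg_of_nonneg h hh0 t ht
        have h1 : 0 ≤ t / γ := by positivity
        simp only [kf]
        rw [max_eq_right (le_min zero_le_one h1), inv_mul_eq_div]
        rcases le_total (t / γ) 1 with h | h
        · rw [min_eq_right h]; nlinarith
        · rw [min_eq_left h]; nlinarith
      have e4 : h ≤ η⁻¹ • P.θ p := by
        have := P.cp_φ.mono q3
        rw [← Complex.coe_smul, map_smul, Complex.coe_smul] at this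
        rw [le_inv_smul_iff_of_pos hη]
        exact this
      refine e3.trans ?_
      rw [mul_comm, mul_smul]
      exact smul_le_smul_of_nonneg_left e4 (by positivity)
    rw [e1]
    have hkk : 0 ≤ k * k := by have := star_mul_self_nonneg k; rwa [ksa] at this
    refine (CStarAlgebra.norm_le_norm_of_nonneg_of_le
      ((isCPMap_cut p).map_nonneg hkk) ((isCPMap_cut p).mono e2)).trans ?_
    rw [← Complex.coe_smul, map_smul, Complex.coe_smul, norm_smul,
      Real.norm_of_nonneg (by positivity)]
    calc _ ≤ η⁻¹ * γ⁻¹ * δ := by gcongr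
      _ = _ := by field_simp
  have hcl := isClosed_corner q q1
  have hgφ : ∀ a ∈ corner q q1, P.φ a * g = g * P.φ a := fun a ha => by
    have hc : Commute h (P.φ a) := by
      rw [Commute, SemiconjBy, hh, P.zero_φ.mul_eq P.cp_φ q a, P.zero_φ.mul_eq P.cp_φ a q,
        ha.1, ha.2]
    exact ((hc.cfcₙ_real gf).eq).symm
  let ψ' : X →ₗ[ℂ] corner q q1 :=
    { toFun := fun x => ⟨q * P.ψ (p * x * p) * q, by rw [← mul_assoc, ← mul_assoc, q2], by
        rw [mul_assoc, q2]⟩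
      map_add' := fun x y => Subtype.ext (by simp [mul_add, add_mul])
      map_smul' := fun c x => Subtype.ext (by
        simp only [mul_smul_comm, smul_mul_assoc, map_smul, RingHom.id_apply]; rfl) }
  let inc : corner q q1 →⋆ₙₐ[ℂ] P.F.X := NonUnitalStarSubalgebraClass.subtype _
  have hinc : Function.Injective inc := Subtype.val_injective
  let P' : Piece X :=
    { F := ⟨corner q q1⟩
      fd := FiniteDimensional.of_injective (inc : corner q q1 →ₗ[ℂ] P.F.X) hinc
      ψ := ψ'
      φ := compress g ∘ₗ P.φ ∘ₗ (inc : corner q q1 →ₗ[ℂ] P.F.X)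
      cp_ψ := isCPMap_of_injective_comp inc hinc <| by
        have : (inc : corner q q1 →ₗ[ℂ] P.F.X) ∘ₗ ψ' = compress q ∘ₗ P.ψ ∘ₗ compress p := by
          ext x
          simp only [LinearMap.comp_apply, compress_apply, q1, hp]
          rfl
        rw [this]
        exact (isCPMap_compress q).comp (P.cp_ψ.comp (isCPMap_compress p))
      norm_ψ := fun a => by
        have hpn : ‖p‖ ≤ 1 := norm_proj_le hp hpp
        have e : ‖ψ' a‖ = ‖q * P.ψ (p * a * p) * q‖ := rfl
        rw [e]
        exact (norm_conj_le hqn _).trans ((P.norm_ψ _).trans (norm_conj_le hpn _))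
      cp_φ := (isCPMap_compress g).comp (P.cp_φ.comp (isCPMap_starAlgHom inc))
      zero_φ := fun a b ha hb hab => by
        have h0 : P.φ (a : P.F.X) * P.φ (b : P.F.X) = 0 := by
          refine P.zero_φ _ _ ?_ ?_ ?_
          · obtain ⟨c, rfl⟩ := ha; exact ⟨c, rfl⟩
          · obtain ⟨c, rfl⟩ := hb; exact ⟨c, rfl⟩
          · exact congrArg Subtype.val hab
        change star g * P.φ (a : P.F.X) * g * (star g * P.φ (b : P.F.X) * g) = 0
        have e1 : g * P.φ (a : P.F.X) * g = g * g * P.φ a := by rw [mul_assoc, hgφ a a.2, mul_assoc]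
        have e2 : g * P.φ (b : P.F.X) * g = P.φ b * g * g := by rw [← hgφ b b.2]
        rw [gsa, e1, e2, mul_assoc (P.φ _), mul_assoc (g * g), ← mul_assoc (P.φ (a : P.F.X)), h0,
          zero_mul, mul_zero]
      norm_φ := fun y => by
        change ‖star g * P.φ (y : P.F.X) * g‖ ≤ ‖(y : P.F.X)‖
        rw [gsa]
        exact (norm_conj_le gn _).trans (P.norm_φ _) }
  refine ⟨P', k, ksa, kn, fun y => ?_, kcut, fun x => ?_⟩
  · change k * (star g * P.φ (y : P.F.X) * g) = star g * P.φ (y : P.F.X) * g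
    rw [gsa, ← mul_assoc, ← mul_assoc, kg]
  · have key : ∀ x, (P'.θ - P.θ ∘ₗ compress p) x = P'.θ x - P.θ (p * x * p) := fun x => by
      simp [hp]
    rw [← key]
    have h8 : 8 * (√η + √(2 * γ)) * ‖x‖ = 4 * (2 * (√η + √(2 * γ))) * ‖x‖ := by ring
    rw [h8]
    refine norm_sum_four_le _ (fun x hx => ?_) (by positivity) x
    rw [key]
    set Y := P.ψ (p * x * p) with hY
    have hpx : p * x * p ≤ ‖x‖ • p := by
      have := CStarAlgebra.star_left_conjugate_le_norm_smul (a := p) (b := x) hx.isSelfAdjoint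
      rwa [hp, hpp] at this
    have hpx0 : 0 ≤ p * x * p := by have := star_left_conjugate_nonneg hx p; rwa [hp] at this
    have hpn : ‖p‖ ≤ 1 := norm_proj_le hp hpp
    have hYn : ‖Y‖ ≤ ‖x‖ := (P.norm_ψ _).trans (norm_conj_le hpn _)
    have hY0 : 0 ≤ Y := P.cp_ψ.map_nonneg hpx0
    have hYD : Y ≤ ‖x‖ • P.ψ p := by
      have := P.cp_ψ.mono hpx
      rwa [← Complex.coe_smul, map_smul, Complex.coe_smul] at this
    have s1 : ‖Y - q * Y * q‖ ≤ 2 * √(‖x‖ * (‖x‖ * η)) := by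
      refine norm_sub_conj_le hY0 hYD q1 hqn ?_ hYn
      rw [← Complex.coe_smul, map_smul, norm_smul, Complex.norm_real, norm_norm]
      exact mul_le_mul_of_nonneg_left q4 (norm_nonneg _)
    have hq0' : 0 ≤ q * Y * q := by have := star_left_conjugate_nonneg hY0 q; rwa [q1] at this
    have hqY : q * Y * q ≤ ‖x‖ • q := by
      have := CStarAlgebra.star_left_conjugate_le_norm_smul (a := q) (b := Y) hY0.isSelfAdjoint
      rw [q1, q2] at this
      exact this.trans (smul_le_smul_of_nonneg_right hYn hq0)
    have s2 : ‖P.φ (q * Y * q) - g * P.φ (q * Y * q) * g‖ ≤ 2 * √(‖x‖ * (‖x‖ * (2 * γ))) := by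
      have hle : P.φ (q * Y * q) ≤ ‖x‖ • h := by
        have := P.cp_φ.mono hqY
        rwa [← Complex.coe_smul, map_smul, Complex.coe_smul] at this
      refine norm_sub_conj_le (P.cp_φ.map_nonneg hq0') hle gsa gn ?_
        ((P.norm_φ _).trans ((norm_conj_le hqn _).trans hYn))
      rw [← Complex.coe_smul, map_smul, norm_smul, Complex.norm_real, norm_norm]
      exact mul_le_mul_of_nonneg_left gcut (norm_nonneg _)
    have e : P'.θ x - P.θ (p * x * p) =
        -(P.φ (q * Y * q) - g * P.φ (q * Y * q) * g) - P.φ (Y - q * Y * q) := by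
      change star g * P.φ (q * Y * q) * g - P.φ Y = _
      rw [gsa, map_sub]; abel
    rw [e]
    refine (norm_sub_le _ _).trans ?_
    rw [norm_neg]
    have s3 := (P.norm_φ (Y - q * Y * q)).trans s1
    have r : ∀ c, 0 ≤ c → √(‖x‖ * (‖x‖ * c)) = ‖x‖ * √c := fun c hc => by
      rw [← mul_assoc, Real.sqrt_mul (by positivity), Real.sqrt_mul_self (norm_nonneg _)]
    rw [r _ hη.le] at s3
    rw [r _ (by positivity)] at s2
    linarith

end Compression

section Ideal

attribute [local instance] CStarAlgebra.spectralOrder CStarAlgebra.spectralOrderedRing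

variable {X : Type} [NonUnitalCStarAlgebra X]

lemma norm_cut_le {p : X} (hp : star p = p) (hpp : p * p = p) (x : X) : ‖cut p x‖ ≤ 4 * ‖x‖ := by
  have hpn : ‖p‖ ≤ 1 := norm_proj_le hp hpp
  rw [cut_apply, hp]
  have h1 : ‖x * p‖ ≤ ‖x‖ := (norm_mul_le _ _).trans (mul_le_of_le_one_right (norm_nonneg _) hpn)
  have h2 : ‖p * x‖ ≤ ‖x‖ := (norm_mul_le _ _).trans (mul_le_of_le_one_left (norm_nonneg _) hpn)
  have h3 := norm_conj_le hpn x
  have h4 := norm_add_le (x - x * p - p * x) (p * x * p)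
  have h5 := norm_sub_le (x - x * p) (p * x)
  have h6 := norm_sub_le x (x * p)
  linarith

theorem Decomposes.exists_compressed {κ : Type} [Fintype κ] (h : Decomposes κ X) {p : X}
    (hp : star p = p) (hpp : p * p = p) (S : Finset X) {ε : ℝ} (hε : 0 < ε) :
    ∃ (P : κ → Piece X) (k : κ → X), (∀ i, star (k i) = k i ∧ ‖k i‖ ≤ 1 ∧
      (∀ y, k i * (P i).φ y = (P i).φ y) ∧ ‖k i - k i * p‖ ≤ ε) ∧
      ∀ x ∈ S, ‖∑ i, (P i).θ x - p * x * p‖ ≤ ε := by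
  classical
  set M : ℝ := ∑ x ∈ S, ‖x‖ + 1 with hM
  have hM0 : 0 < M := by positivity
  have hxM : ∀ x ∈ S, ‖x‖ ≤ M := fun x hx => by
    have := Finset.single_le_sum (f := fun x : X => ‖x‖) (fun _ _ => norm_nonneg _) hx
    linarith
  set n : ℝ := (Fintype.card κ : ℝ) with hn
  have hn0 : 0 ≤ n := by positivity
  set r : ℝ := ε / (32 * M * (n + 1)) with hr
  have hr0 : 0 < r := by positivity
  have hrM : n * (16 * r * M) ≤ ε / 2 := by
    have : r * (32 * M * (n + 1)) = ε := by rw [hr]; field_simp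
    nlinarith [mul_pos hr0 hM0]
  have hη : 0 < r ^ 2 := by positivity
  have hγ : 0 < r ^ 2 / 2 := by positivity
  set δ : ℝ := ε ^ 2 * (r ^ 2 * (r ^ 2 / 2)) with hδ
  have hδ0 : 0 < δ := by positivity
  obtain ⟨P, hP⟩ := h (insert p (S.image fun x => p * x * p)) (min (δ / 4) (ε / 2)) (by positivity)
  have hp0 : 0 ≤ p := by simpa [hp, hpp] using star_mul_self_nonneg p
  have hcut : ∀ i, ‖cut p ((P i).θ p)‖ ≤ δ := by
    intro i
    have h1 : (P i).θ p ≤ ∑ j, (P j).θ p :=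
      Finset.single_le_sum (f := fun j => (P j).θ p) (fun j _ => (P j).cp_θ.map_nonneg hp0)
        (Finset.mem_univ i)
    have h2 : cut p (∑ j, (P j).θ p) = cut p (∑ j, (P j).θ p - p) := by
      rw [map_sub]; simp [hp, hpp]
    refine (CStarAlgebra.norm_le_norm_of_nonneg_of_le ((isCPMap_cut p).map_nonneg
      ((P i).cp_θ.map_nonneg hp0)) ((isCPMap_cut p).mono h1)).trans ?_
    rw [h2]
    refine (norm_cut_le hp hpp _).trans ?_
    have := (hP p (Finset.mem_insert_self _ _)).le.trans (min_le_left _ _)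
    linarith
  choose P' k h1 h2 h3 h4 h5 using fun i => (P i).exists_compressed hp hpp hη hγ (hcut i)
  refine ⟨P', k, fun i => ⟨h1 i, h2 i, h3 i, ?_⟩, fun x hx => ?_⟩
  · have : ‖k i - k i * p‖ ^ 2 ≤ ε ^ 2 := (h4 i).trans_eq (by rw [hδ]; field_simp)
    exact (abs_le_of_sq_le_sq' this hε.le).2
  · have e : ∑ i, (P' i).θ x - p * x * p =
        ∑ i, ((P' i).θ x - (P i).θ (p * x * p)) + (∑ i, (P i).θ (p * x * p) - p * x * p) := by
      rw [Finset.sum_sub_distrib]; abel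
    rw [e]
    refine (norm_add_le _ _).trans ?_
    have g1 := (hP (p * x * p) (Finset.mem_insert_of_mem (Finset.mem_image_of_mem _ hx))).le.trans
      (min_le_right _ _)
    have g2 : ‖∑ i, ((P' i).θ x - (P i).θ (p * x * p))‖ ≤ n * (16 * r * M) := by
      refine (norm_sum_le _ _).trans ?_
      calc _ ≤ ∑ i : κ, 16 * r * M := Finset.sum_le_sum fun i _ => by
            refine (h5 i x).trans ?_
            have e2 : (2 : ℝ) * (r ^ 2 / 2) = r ^ 2 := by ring
            rw [e2, Real.sqrt_sq hr0.le]
            have := hxM x hx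
            nlinarith [mul_le_mul_of_nonneg_left this hr0.le]
        _ = _ := by simp [hn]
    linarith

variable {J Q : Type} [NonUnitalCStarAlgebra J] [NonUnitalCStarAlgebra Q]

theorem Decomposes.ideal {κ : Type} [Fintype κ] (h : Decomposes κ X)
    (ι : J →⋆ₙₐ[ℂ] X) (hiso : ∀ x, ‖ι x‖ = ‖x‖) (π : X →⋆ₙₐ[ℂ] Q)
    (hexact : Set.range ι = {a : X | π a = 0}) (p : ℕ → X) (hsa : ∀ n, star (p n) = p n)
    (hidem : ∀ n, p n * p n = p n) (hmem : ∀ n, π (p n) = 0)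
    (happid : ∀ x : X, π x = 0 →
      Filter.Tendsto (fun n => ‖p n * x - x‖) Filter.atTop (nhds 0)) : Decomposes κ J := by
  classical
  have hinj : Function.Injective ι := fun x y hxy => by
    have := hiso (x - y)
    rw [map_sub, hxy, sub_self, norm_zero] at this
    exact sub_eq_zero.1 (norm_eq_zero.1 this.symm)
  have hπι : ∀ x, π (ι x) = 0 := fun x => by
    have : ι x ∈ Set.range ι := ⟨x, rfl⟩
    rwa [hexact] at this
  intro S ε hε
  have hev : ∀ x : J, ∀ᶠ n in Filter.atTop, ‖p n * ι x - ι x‖ < ε / 4 := fun x =>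
    (happid _ (hπι x)).eventually (gt_mem_nhds (by positivity))
  obtain ⟨n, hn⟩ := (((Finset.eventually_all S).2 fun x _ => hev x).and
    ((Finset.eventually_all S).2 fun x _ => hev (star x))).exists
  obtain ⟨P, k, hk, hP⟩ := h.exists_compressed (hsa n) (hidem n) (S.image ι)
    (ε := min (ε / 4) (1 / 2)) (by positivity)
  have hmem' : ∀ i (y : (P i).F.X), ∃ x, ι x = (P i).φ y := by
    intro i y
    have : (P i).φ y ∈ Set.range ι := by
      rw [hexact]
      obtain ⟨k1, k2, k3, k4⟩ := hk i
      have e1 : π (k i) = π (k i - k i * p n) := by rw [map_sub, map_mul, hmem, mul_zero, sub_zero]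
      have e2 : ‖π (k i)‖ ≤ 1 / 2 := by
        rw [e1]
        exact (NonUnitalStarAlgHom.norm_apply_le π _).trans (k4.trans (min_le_right _ _))
      have e3 : ‖π ((P i).φ y)‖ ≤ 1 / 2 * ‖π ((P i).φ y)‖ := by
        conv_lhs => rw [← k3 y, map_mul]
        exact (norm_mul_le _ _).trans (mul_le_mul_of_nonneg_right e2 (norm_nonneg _))
      exact norm_eq_zero.1 (by linarith [norm_nonneg (π ((P i).φ y))])
    exact this
  choose f hf using hmem'
  let P' : κ → Piece J := fun i =>
    have hcomp : (ι : J →ₗ[ℂ] X) ∘ₗ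
      ({ toFun := f i
         map_add' := fun x y => hinj (by simp [hf])
         map_smul' := fun c x => hinj (by simp [hf]) } : (P i).F.X →ₗ[ℂ] J) = (P i).φ :=
      LinearMap.ext fun y => hf i y
    { F := (P i).F
      fd := (P i).fd
      ψ := (P i).ψ ∘ₗ (ι : J →ₗ[ℂ] X)
      φ := { toFun := f i
             map_add' := fun x y => hinj (by simp [hf])
             map_smul' := fun c x => hinj (by simp [hf]) }
      cp_ψ := (P i).cp_ψ.comp (isCPMap_starAlgHom ι)
      norm_ψ := fun a => ((P i).norm_ψ _).trans_eq (hiso a)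
      cp_φ := isCPMap_of_injective_comp ι hinj (by rw [hcomp]; exact (P i).cp_φ)
      zero_φ := fun a b ha hb hab => hinj (by
        change ι (f i a * f i b) = _
        rw [map_mul, hf, hf, (P i).zero_φ a b ha hb hab, map_zero])
      norm_φ := fun y => by
        change ‖f i y‖ ≤ _
        rw [← hiso, hf]; exact (P i).norm_φ y }
  have hθ : ∀ i x, ι ((P' i).θ x) = (P i).θ (ι x) := fun i x => hf i _
  refine ⟨P', fun x hx => ?_⟩
  rw [← hiso, map_sub, map_sum]
  simp only [hθ]
  have h1 := hn.1 x hx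
  have h2 := hn.2 x hx
  rw [map_star, ← norm_star, star_sub, star_mul, star_star, hsa] at h2
  have h3 := (hP (ι x) (Finset.mem_image_of_mem _ hx)).trans (min_le_left _ _)
  have h4 : ‖p n * (ι x * p n - ι x)‖ ≤ ‖ι x * p n - ι x‖ :=
    (norm_mul_le _ _).trans (mul_le_of_le_one_left (norm_nonneg _) (norm_proj_le (hsa n) (hidem n)))
  have e : ∑ i, (P i).θ (ι x) - ι x = (∑ i, (P i).θ (ι x) - p n * ι x * p n) +
      (p n * (ι x * p n - ι x) + (p n * ι x - ι x)) := by rw [mul_sub, mul_assoc]; abel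
  rw [e]
  refine (norm_add_le _ _).trans_lt ?_
  have := norm_add_le (p n * (ι x * p n - ι x)) (p n * ι x - ι x)
  linarith

end Ideal

section MatrixUnits

attribute [local instance] CStarAlgebra.spectralOrder CStarAlgebra.spectralOrderedRing

variable {F : Type} [NonUnitalCStarAlgebra F] (M : MatUnits F)

namespace MatUnits

lemma v_mul_b (s : Fin M.N) : M.v s * M.v (M.b s) = M.v s := by
  have h : star (M.v s * M.v (M.b s) - M.v s) * (M.v s * M.v (M.b s) - M.v s) = 0 := by
    have h1 := M.same s
    have h2 := M.idem s
    have h3 : M.v (M.b s) * star (M.v s) * (M.v s * M.v (M.b s)) = M.v (M.b s) := by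
      rw [mul_assoc, ← mul_assoc (star _), h1, h2, h2]
    have h4 : M.v (M.b s) * star (M.v s) * M.v s = M.v (M.b s) := by rw [mul_assoc, h1, h2]
    have h5 : star (M.v s) * (M.v s * M.v (M.b s)) = M.v (M.b s) := by rw [← mul_assoc, h1, h2]
    rw [star_sub, star_mul, M.star_v_b, sub_mul, mul_sub, mul_sub, h3, h4, h5, h1]
    abel
  exact sub_eq_zero.1 (CStarRing.star_mul_self_eq_zero_iff _ |>.1 h)

lemma b_mul_star (s : Fin M.N) : M.v (M.b s) * star (M.v s) = star (M.v s) := by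
  simpa [M.star_v_b] using congrArg star (M.v_mul_b s)

lemma mul_unit (x : F) : x * (∑ s, M.v s * star (M.v s)) = x := by
  have := congrArg star (M.unit_mul (star x))
  simpa [star_sum] using this

lemma expand (x : F) :
    x = ∑ s, ∑ t, if M.b s = M.b t then M.c s t x • (M.v s * star (M.v t)) else 0 := by
  conv_lhs => rw [← M.unit_mul x, ← M.mul_unit ((∑ s, M.v s * star (M.v s)) * x),
    Finset.sum_mul, Finset.sum_mul]
  refine Finset.sum_congr rfl fun s _ => ?_
  rw [Finset.mul_sum]
  refine Finset.sum_congr rfl fun t _ => ?_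
  have e : M.v s * star (M.v s) * x * (M.v t * star (M.v t)) =
      M.v s * (star (M.v s) * x * M.v t) * star (M.v t) := by simp only [mul_assoc]
  rw [e]
  split_ifs with h
  · rw [M.coef s t x h, mul_smul_comm, M.v_mul_b, smul_mul_assoc]
  · rw [M.coef_zero s t x h, mul_zero, zero_mul]

/-- The scalar by which an element of a minimal corner is a multiple of the unit. -/
noncomputable def scalar (s : Fin M.N) (x : F) : ℂ := M.c (M.b s) (M.b s) x

lemma corner_eq (s : Fin M.N) {x : F} (h1 : M.v (M.b s) * x = x) (h2 : x * M.v (M.b s) = x) :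
    x = M.scalar s x • M.v (M.b s) := by
  have := M.coef (M.b s) (M.b s) x rfl
  rw [M.star_v_b, h1, h2, M.b_b] at this
  exact this

lemma norm_v_b (s : Fin M.N) : ‖M.v (M.b s)‖ = 1 := by
  have := CStarRing.norm_star_mul_self (x := M.v (M.b s))
  rw [M.star_v_b, M.idem] at this
  have h : ‖M.v (M.b s)‖ ≠ 0 := norm_ne_zero_iff.2 (M.ne_zero s)
  exact mul_right_cancel₀ h (by rw [one_mul]; exact this.symm)

lemma norm_v (s : Fin M.N) : ‖M.v s‖ = 1 := by
  have := CStarRing.norm_star_mul_self (x := M.v s)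
  rw [M.same, norm_v_b] at this
  nlinarith [norm_nonneg (M.v s)]

lemma norm_le [FiniteDimensional ℂ F] {x : F} {C : ℝ} (hC : 0 ≤ C)
    (h : ∀ s y z, y * M.v (M.b s) = y → z * M.v (M.b s) = z →
      ‖star y * x * z‖ ≤ C * ‖y‖ * ‖z‖) : ‖x‖ ≤ C := by
  by_cases hx : x = 0
  · simpa [hx] using hC
  obtain ⟨g, h1, h2, h3, h4, -⟩ := exists_norm_projection (star_mul_self_nonneg x)
    (fun h => hx (CStarRing.star_mul_self_eq_zero_iff _ |>.1 h))
  obtain ⟨s, hs⟩ : ∃ s, star (M.v s) * g ≠ 0 := by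
    by_contra! hc
    refine h3 ?_
    rw [← M.unit_mul g, Finset.sum_mul]
    exact Finset.sum_eq_zero fun s _ => by rw [mul_assoc, hc, mul_zero]
  have hz : g * M.v s ≠ 0 := fun h0 => hs (by simpa [h1] using congrArg star h0)
  have key := h s (x * (g * M.v s)) (g * M.v s) (by simp only [mul_assoc, M.v_mul_b])
    (by simp only [mul_assoc, M.v_mul_b])
  have e : star (x * (g * M.v s)) * x * (g * M.v s) =
      ((‖star x * x‖ : ℝ) : ℂ) • (star (g * M.v s) * (g * M.v s)) := by
    calc _ = star (g * M.v s) * ((star x * x) * g) * M.v s := by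
          simp only [star_mul, mul_assoc]
      _ = _ := by rw [h4, mul_smul_comm, smul_mul_assoc]; simp only [star_mul, mul_assoc]
  rw [e, norm_smul, CStarRing.norm_star_mul_self, CStarRing.norm_star_mul_self, Complex.norm_real,
    Real.norm_of_nonneg (by positivity)] at key
  have h5 : 0 < ‖g * M.v s‖ := norm_pos_iff.2 hz
  have h6 : 0 < ‖x‖ := norm_pos_iff.2 hx
  have h7 := norm_mul_le x (g * M.v s)
  have h8 : ‖x‖ * (‖x‖ * (‖g * M.v s‖ * ‖g * M.v s‖)) ≤
      C * (‖x‖ * (‖g * M.v s‖ * ‖g * M.v s‖)) := by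
    have : C * ‖x * (g * M.v s)‖ ≤ C * (‖x‖ * ‖g * M.v s‖) := by gcongr
    nlinarith [mul_le_mul_of_nonneg_right this h5.le]
  exact le_of_mul_le_mul_right h8 (by positivity)

end MatUnits

/-- Commutation with a positive contraction passes to its square root. -/
lemma norm_commutator_sqrt_le [FiniteDimensional ℂ F] {T S : F} (hT : IsSelfAdjoint T) (hS : 0 ≤ S)
    (hS1 : ‖S‖ ≤ 1) :
    ‖T * S - S * T‖ ^ 3 ≤ 4 * ‖T‖ ^ 2 * ‖T * (S * S) - S * S * T‖ := by
  set C := T * S - S * T with hC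
  set K := T * (S * S) - S * S * T with hK
  have hSs : star S = S := hS.isSelfAdjoint.star_eq
  have hTs : star T = T := hT.star_eq
  have hCs : star C = -C := by rw [hC, star_sub, star_mul, star_mul, hSs, hTs]; abel
  have hKC : K = C * S + S * C := by
    rw [hK, hC, sub_mul, mul_sub]; simp only [mul_assoc]; abel
  by_cases hC0 : C = 0
  · rw [hC0, norm_zero, zero_pow three_ne_zero]; positivity
  obtain ⟨g, h1, h2, h3, h4, h5⟩ := exists_norm_projection (star_mul_self_nonneg C)
    (fun h => hC0 (CStarRing.star_mul_self_eq_zero_iff _ |>.1 h))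
  have hg1 : ‖g‖ ≤ 1 := norm_proj_le h1 h2
  have hc : 0 < ‖C‖ := norm_pos_iff.2 hC0
  rw [CStarRing.norm_star_mul_self] at h4 h5
  have h4' : C * (C * g) = -(((‖C‖ * ‖C‖ : ℝ) : ℂ) • g) := by
    rw [← h4, hCs, neg_mul, neg_mul, neg_neg, mul_assoc]
  have h5' : g * (C * C) = -(((‖C‖ * ‖C‖ : ℝ) : ℂ) • g) := by
    rw [← h5, hCs, neg_mul, mul_neg, neg_neg]
  set u := star (C * g) * S * (C * g) with hu
  set w := star g * S * g with hw
  have hu0 : 0 ≤ u := star_left_conjugate_nonneg hS _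
  have hw0 : 0 ≤ w := star_left_conjugate_nonneg hS _
  have e1 : u + u + (((2 * ‖C‖ ^ 2 : ℝ)) • w) = -(g * (C * K + K * C) * g) := by
    have : g * (C * K + K * C) * g = g * (C * C) * (S * g) + (g * S) * (C * (C * g)) +
        (g * (C * S * C) * g + g * (C * S * C) * g) := by
      rw [hKC]; simp only [mul_add, add_mul, mul_assoc]; abel
    rw [this, h4', h5', hu, hw, star_mul, h1, hCs, ← Complex.coe_smul]
    simp only [mul_assoc, neg_mul, mul_neg, smul_mul_assoc, mul_smul_comm]
    push_cast
    match_scalars <;> ring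
  have e2 : ‖g * (C * K + K * C) * g‖ ≤ 2 * (‖C‖ * ‖K‖) := by
    refine (norm_conj_le hg1 _).trans ((norm_add_le _ _).trans ?_)
    have := norm_mul_le C K
    have := norm_mul_le K C
    nlinarith
  have hw0' : 0 ≤ (2 * ‖C‖ ^ 2 : ℝ) • w := smul_nonneg (by positivity) hw0
  have e3 : ‖u‖ ≤ ‖C‖ * ‖K‖ := by
    have : ‖u + u‖ ≤ 2 * (‖C‖ * ‖K‖) := by
      refine (CStarAlgebra.norm_le_norm_of_nonneg_of_le (add_nonneg hu0 hu0)
        (le_add_of_nonneg_right hw0')).trans ?_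
      rw [e1, norm_neg]; exact e2
    rw [← two_smul ℝ, norm_smul, Real.norm_ofNat] at this
    linarith
  have e4 : ‖C‖ * ‖w‖ ≤ ‖K‖ := by
    have : ‖(2 * ‖C‖ ^ 2 : ℝ) • w‖ ≤ 2 * (‖C‖ * ‖K‖) := by
      refine (CStarAlgebra.norm_le_norm_of_nonneg_of_le hw0'
        (le_add_of_nonneg_left (add_nonneg hu0 hu0))).trans ?_
      rw [e1, norm_neg]; exact e2
    rw [norm_smul, Real.norm_of_nonneg (by positivity)] at this
    have : ‖C‖ * (‖C‖ * ‖w‖) ≤ ‖C‖ * ‖K‖ := by linarith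
    exact le_of_mul_le_mul_left this hc
  have sq : ∀ z : F, ‖S * z‖ ^ 2 ≤ ‖star z * S * z‖ := fun z => by
    rw [sq, ← CStarRing.norm_star_mul_self]
    refine CStarAlgebra.norm_le_norm_of_nonneg_of_le (star_mul_self_nonneg _) ?_
    have hSS : S * S ≤ S := by
      have h := le_norm_smul_fdUnit hS
      have h' : S ≤ fdUnit F := h.trans (by
        have := smul_le_smul_of_nonneg_right hS1 (fdUnit_nonneg (F := F))
        rwa [one_smul] at this)
      obtain ⟨R, hR, hRs⟩ : ∃ R : F, R * R = S ∧ star R = R :=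
        ⟨CFC.sqrt S, CFC.sqrt_mul_sqrt_self S hS, (CFC.sqrt_nonneg S).isSelfAdjoint.star_eq⟩
      have h0 := star_left_conjugate_le_conjugate h' R
      have h9 : star R * S * R = S * S := by rw [hRs, ← hR]; simp only [mul_assoc]
      rwa [h9, mul_fdUnit, hRs, hR] at h0
    have := star_left_conjugate_le_conjugate hSS z
    have e : star (S * z) * (S * z) = star z * (S * S) * z := by
      rw [star_mul, hSs]; simp only [mul_assoc]
    rwa [e]
  have f1 := sq (C * g)
  have f2 := sq g
  have e5 : ‖C‖ ^ 2 * ‖g‖ ≤ ‖C‖ * ‖T‖ * ‖S * g‖ + ‖S * (C * g)‖ * ‖T‖ := by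
    have : ((‖C‖ * ‖C‖ : ℝ) : ℂ) • g = star (C * g) * (T * (S * g)) -
        star (S * (C * g)) * (T * g) := by
      have h6 : ((‖C‖ * ‖C‖ : ℝ) : ℂ) • g = star (C * g) * (C * g) := by
        have : star (C * g) * (C * g) = g * (star C * C * g) := by
          rw [star_mul, h1]; simp only [mul_assoc]
        rw [this, h4, mul_smul_comm, h2]
      rw [h6]
      have hCg : C * g = T * (S * g) - S * (T * g) := by
        rw [hC, sub_mul]; simp only [mul_assoc]
      refine (congrArg (fun z => star (C * g) * z) hCg).trans ?_
      simp only [mul_sub]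
      rw [star_mul S, hSs]; simp only [mul_assoc]
    have h7 := congrArg norm this
    rw [norm_smul, Complex.norm_real, Real.norm_of_nonneg (by positivity)] at h7
    rw [pow_two, h7]
    refine (norm_sub_le _ _).trans (add_le_add ?_ ?_)
    · refine (norm_mul_le _ _).trans ?_
      rw [norm_star, mul_assoc]
      have a1 : ‖C * g‖ ≤ ‖C‖ := (norm_mul_le _ _).trans (mul_le_of_le_one_right hc.le hg1)
      have a2 := norm_mul_le T (S * g)
      gcongr
    · refine (norm_mul_le _ _).trans ?_
      rw [norm_star]
      have a2 : ‖T * g‖ ≤ ‖T‖ :=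
        (norm_mul_le _ _).trans (mul_le_of_le_one_right (norm_nonneg _) hg1)
      gcongr
  have hgn : ‖g‖ = 1 := by
    have := CStarRing.norm_star_mul_self (x := g)
    rw [h1, h2] at this
    have h0 : ‖g‖ ≠ 0 := norm_ne_zero_iff.2 h3
    exact mul_right_cancel₀ h0 (by rw [one_mul]; exact this.symm)
  rw [hgn, mul_one] at e5
  set A := ‖C‖ * ‖S * g‖ with hA
  set B := ‖S * (C * g)‖ with hB
  have b1 : A ^ 2 ≤ ‖C‖ * ‖K‖ := by
    rw [hA, mul_pow]
    have : ‖S * g‖ ^ 2 ≤ ‖w‖ := f2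
    nlinarith [mul_le_mul_of_nonneg_left this (sq_nonneg ‖C‖),
      mul_le_mul_of_nonneg_left e4 hc.le]
  have b2 : B ^ 2 ≤ ‖C‖ * ‖K‖ := f1.trans e3
  have b3 : ‖C‖ ^ 2 ≤ ‖T‖ * (A + B) := by rw [hA]; linarith
  have b4 : (‖C‖ ^ 2) ^ 2 ≤ ‖T‖ ^ 2 * (4 * (‖C‖ * ‖K‖)) := by
    calc (‖C‖ ^ 2) ^ 2 ≤ (‖T‖ * (A + B)) ^ 2 := by gcongr
      _ = ‖T‖ ^ 2 * (A + B) ^ 2 := by ring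
      _ ≤ _ := by gcongr; nlinarith [sq_nonneg (A - B)]
  have b5 : ‖C‖ * ‖C‖ ^ 3 ≤ ‖C‖ * (4 * ‖T‖ ^ 2 * ‖K‖) := by nlinarith
  exact le_of_mul_le_mul_left b5 hc

end MatrixUnits

section States

attribute [local instance] CStarAlgebra.spectralOrder CStarAlgebra.spectralOrderedRing

open scoped ComplexOrder

lemma isCPMap_of_nonneg {X : Type} [NonUnitalCStarAlgebra X] (ω : X →ₗ[ℂ] ℂ)
    (h : ∀ a, 0 ≤ ω (star a * a)) : IsCPMap ω := by
  refine isCPMap_of_gram ω fun n w => ?_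
  set M : Matrix (Fin n) (Fin n) ℂ := Matrix.of fun i j => ω (star (w i) * w j) with hM
  have hq : ∀ x : Fin n → ℂ, star x ⬝ᵥ (M.mulVec x) = ω (star (∑ j, x j • w j) * ∑ j, x j • w j) :=
      fun x => by
    simp only [dotProduct, Matrix.mulVec, hM, Matrix.of_apply, star_sum, star_smul, Finset.sum_mul,
      Finset.mul_sum, map_sum, Pi.star_apply, smul_mul_assoc, mul_smul_comm, map_smul, smul_eq_mul]
    rw [Finset.sum_comm]
    refine Finset.sum_congr rfl fun i _ => Finset.sum_congr rfl fun j _ => by ring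
  have hps : M.PosSemidef := by
    refine Matrix.PosSemidef.of_dotProduct_mulVec_nonneg ?_ fun x => by rw [hq]; exact h _
    ext i j
    have hre : ∀ a, (ω (star a * a)).im = 0 := fun a => (Complex.nonneg_iff.1 (h a)).2.symm
    have h1 := hre (w i + w j)
    have h2 := hre (w i + Complex.I • w j)
    simp only [star_add, star_smul, add_mul, mul_add, map_add, smul_mul_assoc, mul_smul_comm,
      map_smul, smul_eq_mul, Complex.add_im, Complex.mul_im, Complex.mul_re, hre, Complex.star_def,
      Complex.conj_I, Complex.neg_re, Complex.neg_im, Complex.I_re, Complex.I_im] at h1 h2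
    simp only [hM, Matrix.conjTranspose_apply, Matrix.of_apply]
    apply Complex.ext
    · simp only [Complex.star_def, Complex.conj_re]; linarith
    · simp only [Complex.star_def, Complex.conj_im]; linarith
  obtain ⟨m, v, hv⟩ := Matrix.posSemidef_iff_eq_sum_vecMulVec.1 hps
  refine isPositiveElem_of_sum_gram (fun k i => star (v k i)) fun i j => ?_
  rw [hv]
  simp [Matrix.sum_apply, Matrix.vecMulVec_apply]

variable {U : Type} [CStarAlgebra U]

lemma norm_algebraMap_sub_le {a : U} (ha : 0 ≤ a) : ‖algebraMap ℝ U ‖a‖ - a‖ ≤ ‖a‖ := by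
  nontriviality U
  have h := CStarAlgebra.norm_le_norm_of_nonneg_of_le
    (sub_nonneg.2 (IsSelfAdjoint.le_algebraMap_norm_self (a := a) ha.isSelfAdjoint))
    (sub_le_self (algebraMap ℝ U ‖a‖) ha)
  simpa [norm_algebraMap'] using h

lemma norm_two_smul_sub_le {a : U} (ha : 0 ≤ a) : ‖2 * a - algebraMap ℝ U ‖a‖‖ ≤ ‖a‖ := by
  nontriviality U
  set c := algebraMap ℝ U ‖a‖ with hc
  have hcs : star c = c := by rw [hc, ← algebraMap_star_comm]; simp
  have hca : c * a = a * c := Algebra.commutes _ _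
  obtain ⟨r, hr, hrs⟩ : ∃ R : U, R * R = a ∧ star R = R :=
    ⟨CFC.sqrt a, CFC.sqrt_mul_sqrt_self a ha, (CFC.sqrt_nonneg a).isSelfAdjoint.star_eq⟩
  have hcr : c * r = r * c := Algebra.commutes _ _
  have hle : star (2 * a - c) * (2 * a - c) ≤ c * c := by
    rw [← sub_nonneg]
    have h1 : 0 ≤ c - a := sub_nonneg.2 (IsSelfAdjoint.le_algebraMap_norm_self (a := a)
        ha.isSelfAdjoint)
    have h2 := star_left_conjugate_nonneg h1 (2 * r)
    have e : star (2 * r) * (c - a) * (2 * r) = c * c - star (2 * a - c) * (2 * a - c) := by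
      have h3 : r * c * r = a * c := by rw [mul_assoc, hcr, ← mul_assoc, hr]
      have h4 : r * a * r = a * a := by rw [← hr]; simp only [mul_assoc]
      have h5 : star (2 * r) = r * 2 := by rw [star_mul, hrs]; simp
      have h6 : star (2 * a - c) = 2 * a - c := by
        rw [star_sub, star_mul, hcs, ha.isSelfAdjoint.star_eq]
        simp [two_mul, mul_two]
      rw [h5, h6]
      have : r * 2 * (c - a) * (2 * r) = 4 * (r * c * r - r * a * r) := by noncomm_ring
      rw [this, h3, h4]
      simp only [mul_sub, sub_mul, two_mul, add_mul, mul_add, hca]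
      noncomm_ring
    rwa [e] at h2
  have h := CStarAlgebra.norm_le_norm_of_nonneg_of_le (star_mul_self_nonneg _) hle
  rw [CStarRing.norm_star_mul_self] at h
  have h7 := norm_mul_le c c
  have h8 : ‖c‖ = ‖a‖ := by simp [hc, norm_algebraMap']
  rw [h8] at h7
  nlinarith [norm_nonneg a, norm_nonneg (2 * a - c)]

lemma exists_state_unital {x : U} (hx : 0 ≤ x) :
    ∃ ω : U →L[ℂ] ℂ, ‖ω‖ ≤ 1 ∧ ω x = ‖x‖ ∧ ∀ a, 0 ≤ a → 0 ≤ ω a := by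
  by_cases hx0 : x = 0
  · exact ⟨0, by simp, by simp [hx0], by simp⟩
  obtain ⟨ω, h1, h2⟩ := exists_dual_vector'' ℂ x
  replace h2 : ω x = ((‖x‖ : ℝ) : ℂ) := h2
  have hle : ∀ a, ‖ω a‖ ≤ ‖a‖ := fun a => (ω.le_opNorm a).trans (mul_le_of_le_one_left
    (norm_nonneg _) h1)
  have hc : 0 < ‖x‖ := norm_pos_iff.2 hx0
  have hal : ∀ r : ℝ, ω (algebraMap ℝ U r) = r * ω 1 := fun r => by
    rw [Algebra.algebraMap_eq_smul_one, ← Complex.coe_smul, map_smul, smul_eq_mul]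
  have hu : ω 1 = 1 := by
    have h3 := (hle _).trans (norm_two_smul_sub_le hx)
    rw [map_sub, hal, two_mul, map_add, h2] at h3
    have h4 : ‖(2 : ℂ) - ω 1‖ ≤ 1 := by
      have : ((‖x‖ : ℂ) + ‖x‖ - ‖x‖ * ω 1) = (‖x‖ : ℂ) * (2 - ω 1) := by ring
      rw [this, norm_mul, Complex.norm_real, norm_norm] at h3
      exact le_of_mul_le_mul_left (by linarith) hc
    have h5 : ‖ω 1‖ ≤ 1 := by
      refine (hle 1).trans ?_
      nontriviality U
      simp
    have h6 : 1 ≤ (ω 1).re := by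
      have := (Complex.re_le_norm (2 - ω 1)).trans h4
      simp at this; linarith
    have h7 := Complex.sq_norm (ω 1)
    rw [Complex.normSq_apply] at h7
    have h8 : (ω 1).re ≤ 1 := (Complex.re_le_norm _).trans h5
    have h9 : (ω 1).im * (ω 1).im ≤ 0 := by nlinarith [norm_nonneg (ω 1)]
    apply Complex.ext
    · simp; linarith
    · simpa using le_antisymm h9 (mul_self_nonneg _)
  refine ⟨ω, h1, h2, fun a ha => ?_⟩
  rw [Complex.nonneg_iff]
  constructor
  · have h3 := (Complex.re_le_norm _).trans ((hle _).trans (norm_algebraMap_sub_le ha))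
    rw [map_sub, hal, hu] at h3
    simp at h3
    exact h3
  · have key : ∀ t : ℝ, ((ω a).im + t) ^ 2 ≤ ‖a‖ ^ 2 + t ^ 2 := fun t => by
      have e : star (a + algebraMap ℂ U (t * Complex.I)) * (a + algebraMap ℂ U (t * Complex.I)) =
          a * a + algebraMap ℂ U ((t ^ 2 : ℝ) : ℂ) := by
        rw [star_add, ha.isSelfAdjoint.star_eq, ← algebraMap_star_comm]
        have : star (t * Complex.I : ℂ) = -(t * Complex.I) := by simp
        rw [this, map_neg, add_mul, mul_add, mul_add, neg_mul, neg_mul,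
          Algebra.commutes (t * Complex.I : ℂ) a, ← map_mul]
        have : (t * Complex.I * (t * Complex.I) : ℂ) = -((t ^ 2 : ℝ) : ℂ) := by
          push_cast; linear_combination (t : ℂ) ^ 2 * Complex.I_mul_I
        rw [this, map_neg]; abel
      have h3 := hle (a + algebraMap ℂ U (t * Complex.I))
      have h4 := CStarRing.norm_star_mul_self (x := a + algebraMap ℂ U (t * Complex.I))
      rw [e] at h4
      have h5 : ‖a * a + algebraMap ℂ U ((t ^ 2 : ℝ) : ℂ)‖ ≤ ‖a‖ ^ 2 + t ^ 2 := by
        refine (norm_add_le _ _).trans (add_le_add ?_ ?_)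
        · rw [sq]; exact norm_mul_le _ _
        · nontriviality U
          rw [norm_algebraMap', Complex.norm_real, Real.norm_of_nonneg (by positivity)]
      have h6 : ω (a + algebraMap ℂ U (t * Complex.I)) = ω a + t * Complex.I := by
        rw [map_add, Algebra.algebraMap_eq_smul_one, map_smul, hu, smul_eq_mul, mul_one]
      have h7 := (Complex.abs_im_le_norm _).trans h3
      rw [h6] at h7
      simp at h7
      calc ((ω a).im + t) ^ 2 = |(ω a).im + t| ^ 2 := (sq_abs _).symm
        _ ≤ ‖a + algebraMap ℂ U (t * Complex.I)‖ ^ 2 := by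
          simp only [map_mul]
          gcongr
        _ ≤ _ := by rw [sq, ← h4]; exact h5
    by_contra hne
    have hne' : (ω a).im ≠ 0 := fun h => hne h.symm
    have h3 := key ((‖a‖ ^ 2 + 1) / (2 * (ω a).im))
    have h4 : (ω a).im * ((‖a‖ ^ 2 + 1) / (2 * (ω a).im)) = (‖a‖ ^ 2 + 1) / 2 := by field_simp
    nlinarith [sq_nonneg (ω a).im]

lemma exists_state {X : Type} [NonUnitalCStarAlgebra X] {x : X} (hx : 0 ≤ x) :
    ∃ ω : X →ₗ[ℂ] ℂ, IsCPMap ω ∧ (∀ a, ‖ω a‖ ≤ ‖a‖) ∧ ω x = ‖x‖ := by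
  obtain ⟨ω, h1, h2, h3⟩ := exists_state_unital (U := Unitization ℂ X)
    (Unitization.inr_nonneg_iff.2 hx)
  refine ⟨ω.toLinearMap ∘ₗ (Unitization.inrNonUnitalAlgHom ℂ X : X →ₗ[ℂ] Unitization ℂ X),
    isCPMap_of_nonneg _ fun a => ?_, fun a => ?_, ?_⟩
  · exact h3 _ (Unitization.inr_nonneg_iff.2 (star_mul_self_nonneg a))
  · have := (ω.le_opNorm (a : Unitization ℂ X)).trans (mul_le_of_le_one_left (norm_nonneg _) h1)
    rwa [Unitization.norm_inr] at this
  · rw [Unitization.norm_inr] at h2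
    exact h2

end States

section Kernel

attribute [local instance] CStarAlgebra.spectralOrder CStarAlgebra.spectralOrderedRing

variable {X : Type} [NonUnitalCStarAlgebra X]

/-- Cauchy-Schwarz inequality for finite sums in a C*-algebra. -/
lemma norm_sum_star_mul_sq_le {κ : Type} [Fintype κ] (η ξ : κ → X) :
    ‖∑ k, star (η k) * ξ k‖ ^ 2 ≤ ‖∑ k, star (η k) * η k‖ * ‖∑ k, star (ξ k) * ξ k‖ := by
  let x : WithCStarModule X (κ → X) := (WithCStarModule.equiv X (κ → X)).symm fun k => star (ξ k)
  let y : WithCStarModule X (κ → X) := (WithCStarModule.equiv X (κ → X)).symm fun k => star (η k)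
  have h := CStarModule.norm_inner_le (A := X) (WithCStarModule X (κ → X)) (x := x) (y := y)
  have hx := WithCStarModule.pi_norm_sq x
  have hy := WithCStarModule.pi_norm_sq y
  simp only [WithCStarModule.pi_inner, WithCStarModule.inner_def, x, y,
    WithCStarModule.equiv_symm_pi_apply, star_star] at h hx hy
  calc _ ≤ _ := pow_le_pow_left₀ (norm_nonneg _) h 2
    _ = _ := by rw [mul_pow, hx, hy, mul_comm]

lemma Piece.exists_kernel (P : Piece X) {n : ℕ} (w : Fin n → X) (y : Fin n → P.F.X) :
    ∃ C : Fin n × Fin n → Fin n → X, ∀ i j,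
      P.φ (star (y i) * P.ψ (star (w i) * w j) * y j) = ∑ k, star (C k i) * C k j := by
  obtain ⟨B, hB⟩ := P.cp_ψ.gram w
  choose C hC using fun k => P.cp_φ.gram fun i => B k i * y i
  refine ⟨fun k => C k.1 k.2, fun i j => ?_⟩
  rw [hB, Finset.mul_sum, Finset.sum_mul, map_sum, Fintype.sum_prod_type]
  refine Finset.sum_congr rfl fun k _ => ?_
  rw [← hC, star_mul]
  simp only [mul_assoc]

/-- The defect of a piece from being a module map at `a`, relative to a local unit `u`. -/
def Piece.defect (P : Piece X) (u a : X) : X :=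
  P.θ (star a * a) - P.θ (star a * u) * a - star a * P.θ (u * a) + star a * P.θ (u * u) * a

lemma Piece.defect_nonneg_and_norm_le (P : Piece X) {u : X} (hu : star u = u) (hu1 : ‖u‖ ≤ 1)
    (a : X) : 0 ≤ P.defect u a ∧
    ∀ y, ‖P.φ (star y * P.ψ (u * a)) - P.φ (star y * P.ψ (u * u)) * a‖ ^ 2
      ≤ ‖y‖ ^ 2 * ‖P.defect u a‖ := by
  have main : ∀ y, ∃ η ξ : Fin 3 × Fin 3 → X, P.defect u a = ∑ k, star (ξ k) * ξ k ∧
      P.φ (star y * P.ψ (u * a)) - P.φ (star y * P.ψ (u * u)) * a = ∑ k, star (η k) * ξ k ∧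
      ‖∑ k, star (η k) * η k‖ ≤ ‖y‖ ^ 2 := fun y => by
    obtain ⟨C, hC⟩ := P.exists_kernel ![a, u, u] ![fdUnit P.F.X, fdUnit P.F.X, y]
    refine ⟨fun k => C k 2, fun k => C k 0 - C k 1 * a, ?_, ?_, ?_⟩
    · have h00 := hC 0 0
      have h01 := hC 0 1
      have h10 := hC 1 0
      have h11 := hC 1 1
      simp [hu] at h00 h01 h10 h11
      simp only [Piece.defect, Piece.θ_apply, h00, h01, h10, h11, Finset.sum_mul, Finset.mul_sum,
        ← Finset.sum_sub_distrib, ← Finset.sum_add_distrib]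
      refine Finset.sum_congr rfl fun k _ => ?_
      simp only [star_sub, star_mul, sub_mul, mul_sub, mul_assoc]
      abel
    · have h20 := hC 2 0
      have h21 := hC 2 1
      simp [hu] at h20 h21
      simp only [h20, h21, Finset.sum_mul, ← Finset.sum_sub_distrib, mul_sub, mul_assoc]
    · have h22 := hC 2 2
      simp [hu] at h22
      rw [← h22]
      refine (P.norm_φ _).trans ?_
      have h1 : ‖P.ψ (u * u)‖ ≤ 1 := (P.norm_ψ _).trans ((norm_mul_le _ _).trans
        (mul_le_one₀ hu1 (norm_nonneg _) hu1))
      calc _ ≤ ‖star y * P.ψ (u * u)‖ * ‖y‖ := norm_mul_le _ _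
        _ ≤ (‖star y‖ * ‖P.ψ (u * u)‖) * ‖y‖ := by gcongr; exact norm_mul_le _ _
        _ ≤ (‖star y‖ * 1) * ‖y‖ := by gcongr
        _ = _ := by rw [norm_star]; ring
  constructor
  · obtain ⟨η, ξ, h, -, -⟩ := main 0
    rw [h]
    exact Finset.sum_nonneg fun k _ => star_mul_self_nonneg _
  · intro y
    obtain ⟨η, ξ, h1, h2, h3⟩ := main y
    rw [h1, h2]
    refine (norm_sum_star_mul_sq_le η ξ).trans ?_
    gcongr

end Kernel

section Section

attribute [local instance] CStarAlgebra.spectralOrder CStarAlgebra.spectralOrderedRing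

variable {Q F : Type} [NonUnitalCStarAlgebra Q] [NonUnitalCStarAlgebra F]

lemma norm_sum_orth_le {κ : Type} (s : Finset κ) (q : κ → Q) {γ : ℝ} (hγ : 0 ≤ γ)
    (h1 : ∀ i ∈ s, star (q i) = q i) (h2 : ∀ i ∈ s, ∀ j ∈ s, i ≠ j → q i * q j = 0)
    (h3 : ∀ i ∈ s, ‖q i‖ ≤ γ) : ‖∑ i ∈ s, q i‖ ≤ γ := by
  classical
  induction s using Finset.induction_on with
  | empty => simpa using hγ
  | insert a s ha ih =>
    have hn : ∀ j ∈ s, a ≠ j := fun j hj h => ha (h ▸ hj)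
    have e1 : q a * ∑ i ∈ s, q i = 0 := by
      rw [Finset.mul_sum]
      exact Finset.sum_eq_zero fun j hj => h2 a (by simp) j (by simp [hj]) (hn j hj)
    have e2 : (∑ i ∈ s, q i) * q a = 0 := by
      rw [Finset.sum_mul]
      exact Finset.sum_eq_zero fun j hj => h2 j (by simp [hj]) a (by simp) (hn j hj).symm
    have s1 : IsSelfAdjoint (q a) := h1 a (by simp)
    have s2 : IsSelfAdjoint (∑ i ∈ s, q i) := by
      rw [IsSelfAdjoint, star_sum]
      exact Finset.sum_congr rfl fun i hi => h1 i (by simp [hi])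
    rw [Finset.sum_insert ha, IsStarNormal.norm_add_eq_max s1.isStarNormal s2.isStarNormal
      (by rw [Commute, SemiconjBy, e1, e2]) e1]
    exact max_le (h3 a (by simp)) (ih (fun i hi => h1 i (by simp [hi]))
      (fun i hi j hj => h2 i (by simp [hi]) j (by simp [hj])) fun i hi => h3 i (by simp [hi]))

/-- The map `β ↦ ∑ ω (star (c s) * β * c t) • (u s * star (u t))`. -/
noncomputable def functionalMap {N : ℕ} (ω : Q →ₗ[ℂ] ℂ) (c : Fin N → Q) (u : Fin N → F) :
    Q →ₗ[ℂ] F :=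
  ∑ s, ∑ t, (ω ∘ₗ LinearMap.mulLeft ℂ (star (c s)) ∘ₗ LinearMap.mulRight ℂ (c t)).smulRight
    (u s * star (u t))

lemma functionalMap_apply {N : ℕ} (ω : Q →ₗ[ℂ] ℂ) (c : Fin N → Q) (u : Fin N → F) (β : Q) :
    functionalMap ω c u β = ∑ s, ∑ t, ω (star (c s) * (β * c t)) • (u s * star (u t)) := by
  simp [functionalMap]

lemma isCPMap_functionalMap {N : ℕ} {ω : Q →ₗ[ℂ] ℂ} (hω : IsCPMap ω) (c : Fin N → Q)
    (u : Fin N → F) : IsCPMap (functionalMap ω c u) := by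
  refine isCPMap_of_gram _ fun n w => ?_
  obtain ⟨B, hB⟩ := hω.gram fun k : Fin (n * N) =>
    w (finProdFinEquiv.symm k).1 * c (finProdFinEquiv.symm k).2
  have hB' : ∀ i j s t, ω (star (c s) * (star (w i) * w j * c t)) =
      ∑ k, star (B k (finProdFinEquiv (i, s))) * B k (finProdFinEquiv (j, t)) := fun i j s t => by
    rw [← hB]; simp [mul_assoc]
  refine isPositiveElem_of_sum_gram
    (fun k j => ∑ t, B k (finProdFinEquiv (j, t)) • star (u t)) fun i j => ?_
  simp only [Matrix.of_apply, functionalMap_apply, hB', Finset.sum_smul, star_sum, star_smul,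
    star_star, Finset.sum_mul, Finset.mul_sum]
  rw [Finset.sum_comm' (t' := Finset.univ) (s' := fun _ => Finset.univ) (by simp)]
  simp only [smul_mul_smul_comm]
  rw [Finset.sum_congr rfl fun s _ => Finset.sum_comm, Finset.sum_comm]

lemma MatUnits.corner_expand (M : MatUnits F) (s : Fin M.N) {y : F} (hy : y * M.v (M.b s) = y) :
    ∃ υ : Fin M.N → ℂ, (∀ t, M.b t ≠ M.b s → υ t = 0) ∧ y = ∑ t, υ t • M.v t ∧
      ∀ t, star (M.v t) * y = υ t • M.v (M.b s) := by
  have h1 : ∀ t, star (M.v t) * y = (if M.b t = M.b s then M.c t (M.b s) y else 0) •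
      M.v (M.b s) := fun t => by
    have e : star (M.v t) * y = star (M.v t) * y * M.v (M.b s) := by rw [mul_assoc, hy]
    rw [e]
    split_ifs with h
    · rw [M.coef t (M.b s) y (by rw [M.b_b, h]), h]
    · rw [M.coef_zero t (M.b s) y (by rw [M.b_b]; exact h), zero_smul]
  refine ⟨fun t => if M.b t = M.b s then M.c t (M.b s) y else 0, fun t h => by simp [h], ?_, h1⟩
  conv_lhs => rw [← M.unit_mul y, Finset.sum_mul]
  refine Finset.sum_congr rfl fun t _ => ?_
  rw [mul_assoc, h1, mul_smul_comm]
  split_ifs with h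
  · rw [← h, M.v_mul_b]; simp
  · simp [h]

variable [FiniteDimensional ℂ F] {φ : F →ₗ[ℂ] Q}

lemma IsOrderZero.norm_central_le (hz : IsOrderZero φ) (hc : IsCPMap φ) {e : F}
    (he : star e = e) (hee : e * e = e) (x : F) (hex : e * x = x * e) :
    ‖φ (e * x)‖ ≤ ‖φ e‖ * ‖x‖ := by
  have hw : star (e * x) * (e * x) = star e * (star x * x) * e := by
    rw [star_mul, he]
    calc star x * e * (e * x) = star x * (e * e) * x := by simp only [mul_assoc]
      _ = star x * (e * x) := by rw [hee, mul_assoc]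
      _ = star (e * x) * (e * x) := by rw [star_mul, he, mul_assoc, ← mul_assoc e e, hee]
      _ = star (x * e) * (x * e) := by rw [hex]
      _ = _ := by rw [star_mul, he]; simp only [mul_assoc]
  have hle : star (e * x) * (e * x) ≤ (‖x‖ * ‖x‖) • e := by
    have := CStarAlgebra.star_left_conjugate_le_norm_smul (a := e) (b := star x * x)
      (IsSelfAdjoint.star_mul_self x)
    rw [CStarRing.norm_star_mul_self, he, hee] at this
    rwa [hw, he]
  have h1 : ‖φ (star (e * x) * (e * x))‖ ≤ ‖x‖ * ‖x‖ * ‖φ e‖ := by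
    have := hc.mono hle
    rw [← Complex.coe_smul, map_smul, Complex.coe_smul] at this
    refine (CStarAlgebra.norm_le_norm_of_nonneg_of_le
      (hc.map_nonneg (star_mul_self_nonneg _)) this).trans ?_
    rw [norm_smul, Real.norm_of_nonneg (by positivity)]
  have h2 : star (φ (e * x)) * φ (e * x) = φ e * φ (star (e * x) * (e * x)) := by
    rw [← hc.map_star, hz.mul_eq hc (star (e * x)), hz.mul_eq hc e, hw, he,
      show e * (e * (star x * x) * e) = e * (star x * x) * e by simp only [← mul_assoc, hee]]
  have h3 := CStarRing.norm_star_mul_self (x := φ (e * x))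
  rw [h2] at h3
  have h4 : ‖φ (e * x)‖ ^ 2 ≤ (‖φ e‖ * ‖x‖) ^ 2 := by
    rw [sq, ← h3]
    refine (norm_mul_le _ _).trans ?_
    nlinarith [mul_le_mul_of_nonneg_left h1 (norm_nonneg (φ e))]
  exact (sq_le_sq₀ (norm_nonneg _) (by positivity)).1 h4

end Section

section Section

attribute [local instance] CStarAlgebra.spectralOrder CStarAlgebra.spectralOrderedRing

variable {Q F : Type} [NonUnitalCStarAlgebra Q] [NonUnitalCStarAlgebra F] (M : MatUnits F)

/-- The projection onto the span of the matrix units whose index satisfies `P`. -/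
noncomputable def MatUnits.block (P : Fin M.N → Prop) [DecidablePred P] : F :=
  ∑ s, if P s then M.v s * star (M.v s) else 0

namespace MatUnits

variable (P : Fin M.N → Prop) [DecidablePred P]

lemma star_block : star (M.block P) = M.block P := by
  simp only [block, star_sum]
  exact Finset.sum_congr rfl fun s _ => by split_ifs <;> simp

lemma block_mul_v (t : Fin M.N) : M.block P * M.v t = if P t then M.v t else 0 := by
  rw [block, Finset.sum_mul, Finset.sum_eq_single t]
  · split_ifs
    · rw [mul_assoc, M.same, M.v_mul_b]
    · simp
  · intro s _ h
    split_ifs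
    · rw [mul_assoc, M.orth s t h, mul_zero]
    · simp
  · simp

lemma star_v_mul_block (t : Fin M.N) :
    star (M.v t) * M.block P = if P t then star (M.v t) else 0 := by
  have := congrArg star (M.block_mul_v P t)
  rw [star_mul, star_block] at this
  rw [this]
  split_ifs <;> simp

lemma block_mul_block : M.block P * M.block P = M.block P := by
  conv_lhs => rw [block, Finset.sum_mul]
  rw [block]
  refine Finset.sum_congr rfl fun s _ => ?_
  split_ifs with h
  · rw [← block, mul_assoc, star_v_mul_block, if_pos h]
  · simp

lemma block_comm (hP : ∀ s t, M.b s = M.b t → P s → P t) (x : F) :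
    M.block P * x = x * M.block P := by
  rw [M.expand x, Finset.sum_mul, Finset.mul_sum]
  refine Finset.sum_congr rfl fun s _ => ?_
  rw [Finset.sum_mul, Finset.mul_sum]
  refine Finset.sum_congr rfl fun t _ => ?_
  split_ifs with h
  · rw [mul_smul_comm, smul_mul_assoc, ← mul_assoc, block_mul_v, mul_assoc, star_v_mul_block]
    by_cases h1 : P s
    · rw [if_pos h1, if_pos (hP s t h h1)]
    · rw [if_neg h1, if_neg fun h2 => h1 (hP t s h.symm h2)]; simp
  · simp

lemma sub_block_mul (x : F) : x - M.block P * x = M.block (fun s => ¬ P s) * x := by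
  rw [sub_eq_iff_eq_add, ← add_mul]
  conv_lhs => rw [← M.unit_mul x]
  rw [block, block, ← Finset.sum_add_distrib]
  congr 1
  refine Finset.sum_congr rfl fun s _ => ?_
  by_cases h : P s <;> simp [h]

lemma block_mul_corner (hP : ∀ s t, M.b s = M.b t → P s → P t) (s : Fin M.N) {y : F}
    (hy : y * M.v (M.b s) = y) : M.block P * y = if P s then y else 0 := by
  rw [M.block_comm P hP]
  conv_lhs => rw [← hy]
  rw [mul_assoc, ← M.block_comm P hP, M.block_mul_v]
  have : P (M.b s) ↔ P s := ⟨hP _ _ (M.b_b s), hP _ _ (M.b_b s).symm⟩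
  by_cases h : P s
  · rw [if_pos (this.2 h), if_pos h, hy]
  · rw [if_neg fun h' => h (this.1 h'), if_neg h, mul_zero]

/-- The compression of a `functionalMap` to a corner. -/
lemma star_mul_functionalMap_mul (ω : Q →ₗ[ℂ] ℂ) (φ : F →ₗ[ℂ] Q) (r s : Fin M.N) (β : Q) {y z : F}
    (hy : y * M.v (M.b s) = y) (hz : z * M.v (M.b s) = z) :
    star y * functionalMap ω (fun s => φ (M.v s)) (fun s => if M.b s = r then M.v s else 0) β * z =
      if M.b s = r then ω (star (φ y) * (β * φ z)) • M.v (M.b s) else 0 := by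
  obtain ⟨υ, υ0, hυ, hυ'⟩ := M.corner_expand s hy
  obtain ⟨ζ, ζ0, hζ, hζ'⟩ := M.corner_expand s hz
  have e1 : ∀ t, star y * (if M.b t = r then M.v t else 0) =
      if M.b s = r then star (υ t) • M.v (M.b s) else 0 := fun t => by
    have : star y * M.v t = star (υ t) • M.v (M.b s) := by
      simpa [M.star_v_b] using congrArg star (hυ' t)
    by_cases h : M.b t = M.b s
    · rw [h]; split_ifs
      · rw [this]
      · simp
    · rw [υ0 t h] at *
      split_ifs <;> simp [this]
  have e2 : ∀ t, star (if M.b t = r then M.v t else 0) * z =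
      if M.b s = r then ζ t • M.v (M.b s) else 0 := fun t => by
    by_cases h : M.b t = M.b s
    · rw [h]; split_ifs
      · rw [hζ']
      · simp
    · have := hζ' t
      rw [ζ0 t h] at *
      split_ifs <;> simp [this]
  rw [functionalMap_apply, Finset.mul_sum, Finset.sum_mul]
  simp only [Finset.mul_sum, Finset.sum_mul, mul_smul_comm, smul_mul_assoc]
  have e3 : ∀ s' t', star y * ((if M.b s' = r then M.v s' else 0) *
      star (if M.b t' = r then M.v t' else 0)) * z =
      if M.b s = r then (star (υ s') * ζ t') • M.v (M.b s) else 0 := fun s' t' => by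
    rw [← mul_assoc, mul_assoc, e1, e2]
    split_ifs
    · rw [smul_mul_smul_comm, M.idem]
    · simp
  simp only [e3]
  split_ifs
  · rw [hυ, hζ]
    simp only [map_sum, star_sum, Finset.sum_mul, Finset.mul_sum, Finset.sum_smul, Finset.smul_sum,
      map_smul, star_smul, smul_mul_assoc, mul_smul_comm]
    rw [Finset.sum_comm]
    refine Finset.sum_congr rfl fun s' _ => Finset.sum_congr rfl fun t' _ => ?_
    simp only [smul_smul, smul_eq_mul]
    congr 1
    ring
  · simp

end MatUnits

namespace IsOrderZero

variable [FiniteDimensional ℂ F] {φ : F →ₗ[ℂ] Q} {M}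

lemma star_map_mul_map (hz : IsOrderZero φ) (hc : IsCPMap φ) (s : Fin M.N) {y z : F}
    (hy : y * M.v (M.b s) = y) (hz' : z * M.v (M.b s) = z) :
    star (φ y) * φ z = M.scalar s (star y * z) • (star (φ (M.v (M.b s))) * φ (M.v (M.b s))) := by
  have h1 : M.v (M.b s) * (star y * z) = star y * z := by
    conv_rhs => rw [← hy]
    rw [star_mul, M.star_v_b, mul_assoc]
  have h2 : star y * z * M.v (M.b s) = star y * z := by rw [mul_assoc, hz']
  rw [← hc.map_star, ← hc.map_star, hz.mul_eq hc (star y), hz.mul_eq hc (star (M.v (M.b s))),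
    M.star_v_b, M.idem]
  conv_lhs => rw [M.corner_eq s h1 h2]
  rw [map_smul, mul_smul_comm]

lemma norm_map_corner (hz : IsOrderZero φ) (hc : IsCPMap φ) (s : Fin M.N) {y : F}
    (hy : y * M.v (M.b s) = y) : ‖φ y‖ = ‖y‖ * ‖φ (M.v (M.b s))‖ := by
  have h1 : M.v (M.b s) * (star y * y) = star y * y := by
    rw [← mul_assoc]
    conv_rhs => rw [← hy]
    rw [star_mul, M.star_v_b, hy]
  have h2 : star y * y * M.v (M.b s) = star y * y := by rw [mul_assoc, hy]
  have e1 := CStarRing.norm_star_mul_self (x := φ y)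
  rw [hz.star_map_mul_map hc s hy hy, norm_smul, CStarRing.norm_star_mul_self] at e1
  have e2 := CStarRing.norm_star_mul_self (x := y)
  rw [M.corner_eq s h1 h2, norm_smul, M.norm_v_b, mul_one] at e2
  rw [e2] at e1
  have : ‖φ y‖ ^ 2 = (‖y‖ * ‖φ (M.v (M.b s))‖) ^ 2 := by rw [sq, ← e1]; ring
  exact (sq_eq_sq₀ (norm_nonneg _) (by positivity)).1 this

lemma norm_map_block_le (hz : IsOrderZero φ) (hc : IsCPMap φ) (P : Fin M.N → Prop)
    [DecidablePred P] {γ : ℝ} (hγ : 0 ≤ γ) (h : ∀ s, P s → ‖φ (M.v (M.b s))‖ ≤ γ) :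
    ‖φ (M.block P)‖ ≤ γ := by
  rw [MatUnits.block, ← Finset.sum_filter, map_sum]
  refine norm_sum_orth_le _ _ hγ (fun s _ => ?_) (fun s _ t _ hst => ?_) fun s hs => ?_
  · rw [← hc.map_star]; simp
  · rw [hz.mul_eq hc, mul_assoc, ← mul_assoc (star (M.v s)), M.orth s t hst]; simp
  · refine le_trans (le_of_eq ?_) (h s (Finset.mem_filter.1 hs).2)
    have e1 : star (φ (M.v s * star (M.v s))) * φ (M.v s * star (M.v s)) =
        star (φ (star (M.v s))) * φ (star (M.v s)) := by
      rw [← hc.map_star, ← hc.map_star, hz.mul_eq hc (star (M.v s * star (M.v s))),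
        hz.mul_eq hc (star (star (M.v s)))]
      congr 2
      rw [star_mul, star_star, mul_assoc, ← mul_assoc (star (M.v s)), M.same, M.b_mul_star]
    have e2 := CStarRing.norm_star_mul_self (x := φ (M.v s * star (M.v s)))
    rw [e1, CStarRing.norm_star_mul_self, hc.map_star, norm_star,
      hz.norm_map_corner hc s (M.v_mul_b s), M.norm_v, one_mul] at e2
    nlinarith [norm_nonneg (φ (M.v (M.b s))), norm_nonneg (φ (M.v s * star (M.v s)))]

end IsOrderZero

end Section

section Section

attribute [local instance] CStarAlgebra.spectralOrder CStarAlgebra.spectralOrderedRing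

variable {Q F : Type} [NonUnitalCStarAlgebra Q] [NonUnitalCStarAlgebra F]
  [FiniteDimensional ℂ F] {φ : F →ₗ[ℂ] Q}

lemma exists_cp_section_aux (hz : IsOrderZero φ) (hc : IsCPMap φ) (M : MatUnits F)
    (P : Fin M.N → Prop) [DecidablePred P] (hP : ∀ s t, M.b s = M.b t → P s → P t)
    {γ : ℝ} (hγ : 0 < γ) (hPγ : ∀ s, P s ↔ γ ≤ ‖φ (M.v (M.b s))‖) :
    ∃ T : Q →ₗ[ℂ] F, IsCPMap T ∧ (∀ β, ‖T β‖ ≤ ‖β‖) ∧ ∀ (β : Q) (x D : F) (δ : ℝ), star D = D →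
      0 ≤ δ → (∀ y, ‖φ (y * x) - φ (y * D) * β‖ ≤ δ * ‖y‖) →
      ‖D * T β - M.block P * x‖ ≤ δ / γ := by
  choose ω hω1 hω2 hω3 using fun r : Fin M.N =>
    exists_state (star_mul_self_nonneg (φ (M.v (M.b r))))
  set n : Fin M.N → ℝ := fun r => if P r then (‖φ (M.v (M.b r))‖ ^ 2)⁻¹ else 0 with hn
  have hn0 : ∀ r, 0 ≤ n r := fun r => by simp only [hn]; split_ifs <;> positivity
  set T : Q →ₗ[ℂ] F := ∑ r, functionalMap ((n r : ℂ) • ω r) (fun s => φ (M.v s))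
    (fun s => if M.b s = r then M.v s else 0) with hT
  have key : ∀ (s : Fin M.N) (β : Q) (y z : F), y * M.v (M.b s) = y → z * M.v (M.b s) = z →
      star y * T β * z = ((n (M.b s) : ℂ) * ω (M.b s) (star (φ y) * (β * φ z))) • M.v (M.b s) := by
    intro s β y z hy hz
    rw [hT, LinearMap.sum_apply, Finset.mul_sum, Finset.sum_mul]
    simp only [M.star_mul_functionalMap_mul _ _ _ _ _ hy hz]
    simp
  have hPb : ∀ s, P (M.b s) ↔ P s := fun s => ⟨hP _ _ (M.b_b s), hP _ _ (M.b_b s).symm⟩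
  refine ⟨T, IsCPMap.sum _ fun r _ =>
    isCPMap_functionalMap ((hω1 r).smul (hn0 r)) _ _, fun β => ?_, ?_⟩
  · refine M.norm_le (norm_nonneg _) fun s y z hy hz' => ?_
    rw [key s β y z hy hz', norm_smul, M.norm_v_b, mul_one, norm_mul, Complex.norm_real,
      Real.norm_of_nonneg (hn0 _)]
    have h1 : ‖ω (M.b s) (star (φ y) * (β * φ z))‖ ≤
        ‖φ (M.v (M.b s))‖ ^ 2 * (‖β‖ * ‖y‖ * ‖z‖) := by
      refine (hω2 _ _).trans ((norm_mul_le _ _).trans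
        ((mul_le_mul_of_nonneg_left (norm_mul_le _ _) (norm_nonneg _)).trans (le_of_eq ?_)))
      rw [norm_star, hz.norm_map_corner hc s hy, hz.norm_map_corner hc s hz']
      ring
    refine (mul_le_mul_of_nonneg_left h1 (hn0 _)).trans ?_
    simp only [hn, M.b_b]
    split_ifs with h
    · have : ‖φ (M.v (M.b s))‖ ≠ 0 := (hγ.trans_le ((hPγ s).1 ((hPb s).1 h))).ne'
      rw [← mul_assoc, inv_mul_cancel₀ (by positivity), one_mul]
    · rw [zero_mul]; positivity
  · intro β x D δ hD hδ h
    refine M.norm_le (by positivity) fun s y z hy hz' => ?_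
    have e0 : star y * (D * T β - M.block P * x) * z =
        star (D * y) * T β * z - star (M.block P * y) * x * z := by
      rw [star_mul, star_mul, hD, M.star_block]
      simp only [mul_sub, sub_mul, mul_assoc]
    rw [e0, key s β (D * y) z (by rw [mul_assoc, hy]) hz', M.block_mul_corner P hP s hy]
    by_cases hs : P s
    · have hns : n (M.b s) = (‖φ (M.v (M.b s))‖ ^ 2)⁻¹ := by
        simp only [hn, M.b_b]; rw [if_pos ((hPb s).2 hs)]
      have hg := (hPγ s).1 hs
      have hg0 : (‖φ (M.v (M.b s))‖ : ℂ) ≠ 0 := by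
        exact_mod_cast (hγ.trans_le hg).ne'
      rw [if_pos hs]
      have h1 : M.v (M.b s) * (star y * x * z) = star y * x * z := by
        rw [← mul_assoc, ← mul_assoc]
        conv_rhs => rw [← hy]
        rw [star_mul, M.star_v_b]
      have h2 : star y * x * z * M.v (M.b s) = star y * x * z := by rw [mul_assoc, hz']
      have h3 : star (star x * y) * z = star y * x * z := by rw [star_mul, star_star]
      have h4 : ω (M.b s) (star (φ (star x * y)) * φ z) =
          M.scalar s (star y * x * z) * (‖φ (M.v (M.b s))‖ : ℂ) ^ 2 := by
        have := hω3 (M.b s)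
        rw [M.b_b, CStarRing.norm_star_mul_self] at this
        rw [hz.star_map_mul_map hc s (by rw [mul_assoc, hy]) hz', map_smul, this, h3, smul_eq_mul]
        push_cast
        ring
      have h5 : star y * x * z = ((n (M.b s) : ℂ) *
          ω (M.b s) (star (φ (star x * y)) * φ z)) • M.v (M.b s) := by
        rw [h4, hns]
        conv_lhs => rw [M.corner_eq s h1 h2]
        congr 1
        push_cast
        field_simp
      rw [h5, ← sub_smul, ← mul_sub, ← map_sub, norm_smul, M.norm_v_b, mul_one, norm_mul,
        Complex.norm_real, Real.norm_of_nonneg (hn0 _), hns]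
      have h6 : ‖ω (M.b s) (star (φ (D * y)) * (β * φ z) - star (φ (star x * y)) * φ z)‖ ≤
          δ * ‖y‖ * (‖z‖ * ‖φ (M.v (M.b s))‖) := by
        refine (hω2 _ _).trans ?_
        rw [← mul_assoc, ← sub_mul, ← hz.norm_map_corner hc s hz', ← hc.map_star, ← hc.map_star,
          star_mul, star_mul, star_star, hD]
        refine (norm_mul_le _ _).trans (mul_le_mul_of_nonneg_right ?_ (norm_nonneg _))
        rw [norm_sub_rev]
        simpa using h (star y)
      refine (mul_le_mul_of_nonneg_left h6 (by positivity)).trans ?_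
      have hpos := hγ.trans_le hg
      have : (‖φ (M.v (M.b s))‖ ^ 2)⁻¹ * (δ * ‖y‖ * (‖z‖ * ‖φ (M.v (M.b s))‖)) =
          δ / ‖φ (M.v (M.b s))‖ * ‖y‖ * ‖z‖ := by field_simp
      rw [this]
      gcongr
    · have hns : n (M.b s) = 0 := by
        simp only [hn]; rw [if_neg fun h' => hs ((hPb s).1 h')]
      rw [if_neg hs, hns]
      simp only [Complex.ofReal_zero, zero_mul, zero_smul, star_zero, sub_zero, norm_zero]
      positivity

/-- An approximate completely positive inverse of an order zero map. -/
lemma exists_cp_section (hz : IsOrderZero φ) (hc : IsCPMap φ) (hφ : ∀ x, ‖φ x‖ ≤ ‖x‖)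
    {D : F} (hD : 0 ≤ D) (hD1 : ‖D‖ ≤ 1) {γ : ℝ} (hγ : 0 < γ) :
    ∃ T : Q →ₗ[ℂ] F, IsCPMap T ∧ (∀ β, ‖T β‖ ≤ ‖β‖) ∧ ∀ (β : Q) (x : F) (δ : ℝ), star β = β →
      star x = x → 0 ≤ δ → (∀ y, ‖φ (y * x) - φ (y * D) * β‖ ≤ δ * ‖y‖) →
      ∃ C, 0 ≤ C ∧ C ^ 3 ≤ 8 * ‖β‖ ^ 2 * (δ / γ) ∧ ‖φ (T β) - φ x‖ ≤ δ / γ + C + γ * ‖x‖ := by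
  classical
  obtain ⟨M⟩ := nonempty_matUnits (F := F)
  set P : Fin M.N → Prop := fun s => γ ≤ ‖φ (M.v (M.b s))‖ with hPdef
  have hP : ∀ s t, M.b s = M.b t → P s → P t := fun s t h hs => by
    simp only [hPdef] at *; rwa [← h]
  obtain ⟨T, hT1, hT2, hT3⟩ := exists_cp_section_aux hz hc M P hP hγ fun s => Iff.rfl
  have hDsa : star D = D := hD.isSelfAdjoint
  set S := CFC.sqrt D with hS
  have hS0 : 0 ≤ S := CFC.sqrt_nonneg D
  have hSsa : star S = S := hS0.isSelfAdjoint
  have hSS : S * S = D := CFC.sqrt_mul_sqrt_self D hD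
  have hS1 : ‖S‖ ≤ 1 := by
    have := CStarRing.norm_star_mul_self (x := S)
    rw [hSsa, hSS] at this
    nlinarith [norm_nonneg S]
  refine ⟨(compress S).comp T, (isCPMap_compress S).comp hT1, fun β => ?_, ?_⟩
  · rw [LinearMap.comp_apply, compress_apply, hSsa]
    exact (norm_conj_le hS1 _).trans (hT2 β)
  intro β x δ hβ hx hδ h
  have hTβ : star (T β) = T β := by rw [← hT1.map_star, hβ]
  have a1 := hT3 β x D δ hDsa hδ h
  have a2 : ‖T β * D - M.block P * x‖ ≤ δ / γ := by
    rw [← norm_star]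
    have : star (T β * D - M.block P * x) = D * T β - M.block P * x := by
      rw [star_sub, star_mul, star_mul, hDsa, hTβ, hx, M.star_block, M.block_comm P hP]
    rw [this]; exact a1
  have a3 := norm_commutator_sqrt_le (T := T β) (S := S) hTβ hS0 hS1
  rw [hSS] at a3
  refine ⟨‖T β * S - S * T β‖, norm_nonneg _, a3.trans ?_, ?_⟩
  · have b1 : ‖T β * D - D * T β‖ ≤ 2 * (δ / γ) := by
      have : T β * D - D * T β = (T β * D - M.block P * x) - (D * T β - M.block P * x) := by abel
      rw [this]
      refine (norm_sub_le _ _).trans ?_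
      linarith
    calc 4 * ‖T β‖ ^ 2 * ‖T β * D - D * T β‖ ≤ 4 * ‖β‖ ^ 2 * (2 * (δ / γ)) := by
          gcongr
          exact hT2 β
      _ = _ := by ring
  · rw [LinearMap.comp_apply, compress_apply, hSsa]
    have e1 : S * T β * S - x = S * (T β * S - S * T β) + (D * T β - M.block P * x) -
        M.block (fun s => ¬ P s) * x := by
      rw [← M.sub_block_mul P x, ← hSS]
      simp only [mul_sub, mul_assoc]
      abel
    have c1 : ‖φ (S * (T β * S - S * T β))‖ ≤ ‖T β * S - S * T β‖ :=
      (hφ _).trans ((norm_mul_le _ _).trans (mul_le_of_le_one_left (norm_nonneg _) hS1))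
    have c2 : ‖φ (M.block (fun s => ¬ P s) * x)‖ ≤ γ * ‖x‖ := by
      have hP' : ∀ s t, M.b s = M.b t → ¬ P s → ¬ P t := fun s t h h1 h2 => h1 (hP t s h.symm h2)
      refine (hz.norm_central_le hc (M.star_block _) (M.block_mul_block _) x
        (M.block_comm _ hP' x)).trans ?_
      gcongr
      exact hz.norm_map_block_le hc _ hγ.le fun s hs => (not_le.1 hs).le
    rw [← map_sub, e1, map_sub, map_add]
    refine (norm_sub_le _ _).trans (add_le_add ((norm_add_le _ _).trans ?_) c2)
    linarith [(hφ _).trans a1]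

end Section

section Section

attribute [local instance] CStarAlgebra.spectralOrder CStarAlgebra.spectralOrderedRing

variable {X Q : Type} [NonUnitalCStarAlgebra X] [NonUnitalCStarAlgebra Q] {κ : Type} [Fintype κ]

lemma exists_local_unit (S : Finset X) {ε : ℝ} (hε : 0 < ε) :
    ∃ u : X, star u = u ∧ ‖u‖ ≤ 1 ∧ ∀ a ∈ S, ‖u * a - a‖ ≤ ε := by
  have hl := CStarAlgebra.increasingApproximateUnit X
  have := hl.neBot
  have h1 : ∀ᶠ u in CStarAlgebra.approximateUnit X, ∀ a ∈ S, ‖u * a - a‖ ≤ ε := by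
    rw [Filter.eventually_all_finset]
    intro a _
    filter_upwards [(hl.tendsto_mul_right a).eventually (Metric.ball_mem_nhds a hε)] with u hu
    rw [← dist_eq_norm]
    exact le_of_lt hu
  obtain ⟨u, h2, h3, h4⟩ := (hl.eventually_isSelfAdjoint.and
    (hl.eventually_norm.and h1)).exists
  exact ⟨u, h2, h3, h4⟩

/-- Decompositions that are approximately bimodular, relative to a local unit. -/
lemma Decomposes.exists_module (h : Decomposes κ X) (S : Finset X) {δ : ℝ} (hδ : 0 < δ) :
    ∃ (P : κ → Piece X) (u : X), star u = u ∧ ‖u‖ ≤ 1 ∧ ∀ a ∈ S, ‖∑ i, (P i).θ a - a‖ ≤ δ ∧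
      ∀ i y, ‖(P i).φ (y * (P i).ψ a) - (P i).φ (y * (P i).ψ (u * u)) * a‖ ≤ δ * ‖y‖ := by
  classical
  obtain ⟨R, hR0, hR⟩ : ∃ R : ℝ, 0 ≤ R ∧ ∀ a ∈ S, ‖a‖ ≤ R :=
    ⟨∑ a ∈ S, ‖a‖, Finset.sum_nonneg fun a _ => norm_nonneg a,
      fun a ha => Finset.single_le_sum (f := fun a : X => ‖a‖) (fun a _ => norm_nonneg a) ha⟩
  obtain ⟨u, hu, hu1, hua⟩ := exists_local_unit S (ε := δ / 4) (by positivity)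
  obtain ⟨P, hP⟩ := h (S ∪ S.image (fun a => star a * a) ∪ S.image (fun a => star a * u) ∪
    S.image (fun a => u * a) ∪ {u * u}) (min δ (δ ^ 2 / (16 * (1 + R) ^ 2))) (by positivity)
  refine ⟨P, u, hu, hu1, fun a ha => ⟨((hP a (by simp [ha])).trans_le (min_le_left _ _)).le, ?_⟩⟩
  have hP' : ∀ x ∈ (S ∪ S.image (fun a => star a * a) ∪ S.image (fun a => star a * u) ∪
      S.image (fun a => u * a) ∪ {u * u}), ‖∑ i, (P i).θ x - x‖ ≤ δ ^ 2 / (16 * (1 + R) ^ 2) :=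
    fun x hx => ((hP x hx).trans_le (min_le_right _ _)).le
  have f1 := hP' (star a * a) (by
    simp only [Finset.mem_union, Finset.mem_image]; exact .inl (.inl (.inl (.inr ⟨a, ha, rfl⟩))))
  have f2 := hP' (star a * u) (by
    simp only [Finset.mem_union, Finset.mem_image]; exact .inl (.inl (.inr ⟨a, ha, rfl⟩)))
  have f3 := hP' (u * a) (by
    simp only [Finset.mem_union, Finset.mem_image]; exact .inl (.inr ⟨a, ha, rfl⟩))
  have f4 := hP' (u * u) (by simp)
  set τ := δ ^ 2 / (16 * (1 + R) ^ 2) with hτ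
  have hτR : τ * (1 + R) ^ 2 = δ ^ 2 / 16 := by rw [hτ]; field_simp
  have haR := hR a ha
  have g1 : ‖∑ i, (P i).defect u a‖ ≤ (δ / 2) ^ 2 := by
    have e : ∑ i, (P i).defect u a = star (u * a - a) * (u * a - a) +
        ((∑ i, (P i).θ (star a * a) - star a * a) - (∑ i, (P i).θ (star a * u) - star a * u) * a -
        star a * (∑ i, (P i).θ (u * a) - u * a) +
        star a * (∑ i, (P i).θ (u * u) - u * u) * a) := by
      simp only [Piece.defect, Finset.sum_add_distrib, Finset.sum_sub_distrib, ← Finset.sum_mul,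
        ← Finset.mul_sum, star_sub, star_mul, sub_mul, mul_sub, hu, mul_assoc]
      abel
    have n1 : ‖star (u * a - a) * (u * a - a)‖ ≤ δ ^ 2 / 16 := by
      rw [CStarRing.norm_star_mul_self]
      nlinarith [hua a ha, norm_nonneg (u * a - a)]
    have n2 := mul_le_mul f2 haR (norm_nonneg _) ((norm_nonneg _).trans f2)
    have n3 := mul_le_mul haR f3 (norm_nonneg _) hR0
    have n4 := mul_le_mul (mul_le_mul haR f4 (norm_nonneg _) hR0) haR (norm_nonneg _)
      (mul_nonneg hR0 ((norm_nonneg _).trans f2))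
    rw [e]
    refine (norm_add_le _ _).trans ((add_le_add n1 ((norm_add_le _ _).trans (add_le_add
      ((norm_sub_le _ _).trans (add_le_add ((norm_sub_le _ _).trans (add_le_add f1
      ((norm_mul_le _ _).trans n2))) ((norm_mul_le _ _).trans ?_)))
      ((norm_mul_le _ _).trans ((mul_le_mul_of_nonneg_right (norm_mul_le _ _)
        (norm_nonneg _)).trans ?_))))).trans (?_ : _ + (_ + (R * τ) + R * τ * R) ≤ _))
    · rwa [norm_star]
    · rwa [norm_star]
    · nlinarith
  intro i y
  have g2 : ‖(P i).defect u a‖ ≤ (δ / 2) ^ 2 := by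
    refine (CStarAlgebra.norm_le_norm_of_nonneg_of_le
      ((P i).defect_nonneg_and_norm_le hu hu1 a).1 ?_).trans g1
    exact Finset.single_le_sum (f := fun i => (P i).defect u a)
      (fun j _ => ((P j).defect_nonneg_and_norm_le hu hu1 a).1) (Finset.mem_univ i)
  have g3 := ((P i).defect_nonneg_and_norm_le hu hu1 a).2 (star y)
  rw [star_star, norm_star] at g3
  have g4 : ‖(P i).φ (y * (P i).ψ (u * a)) - (P i).φ (y * (P i).ψ (u * u)) * a‖ ≤ δ / 2 * ‖y‖ := by
    refine (sq_le_sq₀ (norm_nonneg _) (by positivity)).1 (g3.trans ?_)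
    rw [mul_pow, mul_comm]
    gcongr
  have g5 : ‖(P i).φ (y * (P i).ψ a) - (P i).φ (y * (P i).ψ (u * a))‖ ≤ δ / 4 * ‖y‖ := by
    rw [← map_sub, ← mul_sub, ← map_sub, mul_comm]
    refine ((P i).norm_φ _).trans ((norm_mul_le _ _).trans ?_)
    gcongr
    refine ((P i).norm_ψ _).trans ?_
    rw [norm_sub_rev]
    exact hua a ha
  have := norm_add_le ((P i).φ (y * (P i).ψ a) - (P i).φ (y * (P i).ψ (u * a)))
    ((P i).φ (y * (P i).ψ (u * a)) - (P i).φ (y * (P i).ψ (u * u)) * a)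
  rw [sub_add_sub_cancel] at this
  nlinarith [norm_nonneg y]

lemma decomposes_of_selfAdjoint (h : ∀ (S : Finset X) (ε : ℝ), 0 < ε → (∀ a ∈ S, star a = a) →
    ∃ P : κ → Piece X, ∀ a ∈ S, ‖∑ i, (P i).θ a - a‖ ≤ ε) : Decomposes κ X := by
  classical
  intro S ε hε
  obtain ⟨P, hP⟩ := h (S.image (fun a => (realPart a : X)) ∪ S.image fun a => (imaginaryPart a : X))
    (ε / 3) (by positivity) fun a ha => by
      simp only [Finset.mem_union, Finset.mem_image] at ha
      obtain ⟨b, -, rfl⟩ | ⟨b, -, rfl⟩ := ha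
      · exact (realPart b).2
      · exact (imaginaryPart b).2
  refine ⟨P, fun a ha => ?_⟩
  have h1 := hP (realPart a : X)
    (by simp only [Finset.mem_union, Finset.mem_image]; exact .inl ⟨a, ha, rfl⟩)
  have h2 := hP (imaginaryPart a : X)
    (by simp only [Finset.mem_union, Finset.mem_image]; exact .inr ⟨a, ha, rfl⟩)
  have e : ∑ i, (P i).θ a - a = (∑ i, (P i).θ (realPart a : X) - (realPart a : X)) +
      Complex.I • (∑ i, (P i).θ (imaginaryPart a : X) - (imaginaryPart a : X)) := by
    conv_lhs => rw [← realPart_add_I_smul_imaginaryPart a]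
    simp only [map_add, map_smul, Finset.sum_add_distrib, smul_sub, Finset.smul_sum]
    abel
  rw [e]
  refine (norm_add_le _ _).trans_lt ?_
  rw [norm_smul, Complex.norm_I, one_mul]
  linarith

/-- Decompositions pass to quotients. -/
lemma Decomposes.quotient (h : Decomposes κ X) (π : X →⋆ₙₐ[ℂ] Q) (hπ : Function.Surjective π) :
    Decomposes κ Q := by
  classical
  refine decomposes_of_selfAdjoint fun S ε hε hS => ?_
  have hlift : ∀ β : Q, ∃ a : X, star a = a ∧ (star β = β → π a = β) := fun β => by
    obtain ⟨x, hx⟩ := hπ β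
    refine ⟨(realPart x : X), (realPart x).2, fun hβ => ?_⟩
    rw [realPart_apply_coe, ← Complex.coe_smul, map_smul, map_add, map_star, hx, hβ,
      ← two_smul ℂ β, smul_smul]
    norm_num
  choose σ hσ1 hσ2 using hlift
  obtain ⟨R, hR0, hR⟩ : ∃ R : ℝ, 0 ≤ R ∧ ∀ β ∈ S, ‖σ β‖ ≤ R :=
    ⟨∑ β ∈ S, ‖σ β‖, Finset.sum_nonneg fun a _ => norm_nonneg _,
      fun a ha => Finset.single_le_sum (f := fun a : Q => ‖σ a‖) (fun a _ => norm_nonneg _) ha⟩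
  set η := ε / (4 * (Fintype.card κ + 1)) with hη
  have hη0 : 0 < η := by positivity
  set γ := η / (R + 1) with hγ
  have hγ0 : 0 < γ := by positivity
  set δ' := min η (η ^ 3 / (8 * R ^ 2 + 1)) with hδ'
  have hδ'0 : 0 < δ' := by positivity
  have hδ'1 : 8 * R ^ 2 * δ' ≤ η ^ 3 := by
    have : δ' * (8 * R ^ 2 + 1) ≤ η ^ 3 := (le_div_iff₀ (by positivity)).1 (min_le_right _ _)
    linarith
  obtain ⟨P, u, hu, hu1, hP⟩ := h.exists_module (S.image σ) (δ := min (γ * δ') (ε / 4))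
    (by positivity)
  have hπ1 : ∀ x, ‖π x‖ ≤ ‖x‖ := NonUnitalStarAlgHom.norm_apply_le π
  have hz : ∀ i, IsOrderZero ((π : X →ₗ[ℂ] Q) ∘ₗ (P i).φ) := fun i a b ha hb hab => by
    have := (P i).zero_φ a b ha hb hab
    simp only [LinearMap.comp_apply]
    change π _ * π _ = 0
    rw [← map_mul, this, map_zero]
  have hc : ∀ i, IsCPMap ((π : X →ₗ[ℂ] Q) ∘ₗ (P i).φ) := fun i =>
    (isCPMap_starAlgHom π).comp (P i).cp_φ
  have hφ : ∀ i x, ‖((π : X →ₗ[ℂ] Q) ∘ₗ (P i).φ) x‖ ≤ ‖x‖ := fun i x =>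
    (hπ1 _).trans ((P i).norm_φ x)
  have huu : 0 ≤ u * u := by
    have := star_mul_self_nonneg u
    rwa [hu] at this
  have hfd := fun i => (P i).fd
  choose T hT1 hT2 hT3 using fun i => exists_cp_section (hz i) (hc i) (hφ i)
    (D := (P i).ψ (u * u)) ((P i).cp_ψ.map_nonneg huu)
    (((P i).norm_ψ _).trans ((norm_mul_le _ _).trans (mul_le_one₀ hu1 (norm_nonneg _) hu1))) hγ0
  refine ⟨fun i => ⟨(P i).F, (P i).fd, T i, _, hT1 i, hT2 i, hc i, hz i, hφ i⟩, fun β hβ => ?_⟩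
  obtain ⟨p1, p2⟩ := hP (σ β) (Finset.mem_image_of_mem _ hβ)
  have hπβ : π (σ β) = β := hσ2 β (hS β hβ)
  have hβR : ‖β‖ ≤ R := by
    rw [← hπβ]; exact (hπ1 _).trans (hR β hβ)
  have main : ∀ i, ‖π ((P i).φ (T i β)) - π ((P i).θ (σ β))‖ ≤ 3 * η := fun i => by
    obtain ⟨C, hC0, hC1, hC2⟩ := hT3 i β ((P i).ψ (σ β)) (γ * δ') (hS β hβ)
      (by rw [← (P i).cp_ψ.map_star, hσ1]) (by positivity) fun y => by
        have e : ((π : X →ₗ[ℂ] Q) ∘ₗ (P i).φ) (y * (P i).ψ (σ β)) -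
            ((π : X →ₗ[ℂ] Q) ∘ₗ (P i).φ) (y * (P i).ψ (u * u)) * β =
            π ((P i).φ (y * (P i).ψ (σ β)) - (P i).φ (y * (P i).ψ (u * u)) * σ β) := by
          rw [map_sub, map_mul π, hπβ]; rfl
        rw [e]
        exact (hπ1 _).trans ((p2 i y).trans
          (mul_le_mul_of_nonneg_right (min_le_left _ _) (norm_nonneg _)))
    have hd : γ * δ' / γ = δ' := by field_simp
    rw [hd] at hC1 hC2
    have hCη : C ≤ η := by
      refine le_of_pow_le_pow_left₀ (n := 3) (by norm_num) hη0.le (hC1.trans (le_trans ?_ hδ'1))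
      gcongr
    have hx : γ * ‖(P i).ψ (σ β)‖ ≤ η := by
      have : ‖(P i).ψ (σ β)‖ ≤ R + 1 := ((P i).norm_ψ _).trans ((hR β hβ).trans (by linarith))
      refine (mul_le_mul_of_nonneg_left this hγ0.le).trans (le_of_eq ?_)
      rw [hγ]; field_simp
    refine le_trans hC2 ?_
    linarith [min_le_left η (η ^ 3 / (8 * R ^ 2 + 1))]
  have e : ∑ i, π ((P i).φ (T i β)) - β = ∑ i, (π ((P i).φ (T i β)) - π ((P i).θ (σ β))) +
      π (∑ i, (P i).θ (σ β) - σ β) := by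
    rw [Finset.sum_sub_distrib, map_sub, map_sum, hπβ]; abel
  change ‖∑ i, π ((P i).φ (T i β)) - β‖ ≤ ε
  rw [e]
  refine (norm_add_le _ _).trans ((add_le_add ((norm_sum_le _ _).trans
    (Finset.sum_le_card_nsmul _ _ (3 * η) fun i _ => main i)) ((hπ1 _).trans
      (p1.trans (min_le_right _ _)))).trans ?_)
  rw [nsmul_eq_mul, Finset.card_univ]
  have : (Fintype.card κ + 1) * η = ε / 4 := by rw [hη]; field_simp
  nlinarith

end Section

section Functions

/-- A continuous cutoff vanishing on `(-∞, η]` and equal to `1` on `[2 * η, ∞)`. -/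
noncomputable def cutoff (η t : ℝ) : ℝ := min 1 (max 0 (t / η - 1))

/-- A continuous function agreeing with `1 / √t` on `[η, ∞)`. -/
noncomputable def invSqrt (η t : ℝ) : ℝ := √t / max t η

variable {η : ℝ}

@[fun_prop]
lemma continuous_cutoff : Continuous (cutoff η) := by unfold cutoff; fun_prop

lemma continuous_invSqrt (hη : 0 < η) : Continuous (invSqrt η) := by
  unfold invSqrt
  exact Real.continuous_sqrt.div (by fun_prop) fun t => (lt_max_of_lt_right hη).ne'

lemma cutoff_nonneg (t : ℝ) : 0 ≤ cutoff η t := le_min zero_le_one (le_max_left _ _)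

lemma cutoff_le_one (t : ℝ) : cutoff η t ≤ 1 := min_le_left _ _

lemma cutoff_eq_zero (hη : 0 < η) {t : ℝ} (ht : t ≤ η) : cutoff η t = 0 := by
  rw [cutoff, max_eq_left, min_eq_right zero_le_one]
  rw [sub_nonpos, div_le_one hη]; exact ht

@[simp] lemma cutoff_zero : cutoff η 0 = 0 := by simp [cutoff]

@[simp] lemma invSqrt_zero : invSqrt η 0 = 0 := by simp [invSqrt]

lemma cutoff_eq_one (hη : 0 < η) {t : ℝ} (ht : 2 * η ≤ t) : cutoff η t = 1 := by
  rw [cutoff, min_eq_left]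
  refine le_max_of_le_right ?_
  rw [le_sub_iff_add_le, le_div_iff₀ hη]; linarith

lemma invSqrt_mul_sqrt_mul_cutoff (hη : 0 < η) (t : ℝ) :
    invSqrt η t * √t * cutoff η t = cutoff η t := by
  rcases le_total t η with h | h
  · simp [cutoff_eq_zero hη h]
  · have : 0 < t := hη.trans_le h
    rw [invSqrt, max_eq_left h, div_mul_eq_mul_div, Real.mul_self_sqrt this.le, div_self this.ne',
      one_mul]

lemma invSqrt_sq_mul_cutoff (hη : 0 < η) (t : ℝ) :
    invSqrt η t * t * invSqrt η t * cutoff η t = cutoff η t := by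
  rcases le_total t η with h | h
  · simp [cutoff_eq_zero hη h]
  · have : 0 < t := hη.trans_le h
    conv_lhs => rw [mul_assoc, mul_assoc, mul_left_comm]
    conv_rhs => rw [← invSqrt_mul_sqrt_mul_cutoff hη, ← invSqrt_mul_sqrt_mul_cutoff hη]
    nth_rw 1 [← Real.mul_self_sqrt this.le]
    ring

lemma mul_one_sub_cutoff_sq_le (hη : 0 < η) {t : ℝ} (ht : 0 ≤ t) :
    t * (1 - cutoff η t * cutoff η t) ^ 2 ≤ 2 * η := by
  rcases le_total (2 * η) t with h | h
  · rw [cutoff_eq_one hη h]; norm_num; exact hη.le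
  · have h1 := cutoff_nonneg (η := η) t
    have h2 := cutoff_le_one (η := η) t
    have h3 : cutoff η t * cutoff η t ≤ 1 := by nlinarith
    have h4 : (1 - cutoff η t * cutoff η t) ^ 2 ≤ 1 := by
      have : 0 ≤ cutoff η t * cutoff η t := by positivity
      nlinarith
    calc _ ≤ t * 1 := by gcongr
      _ ≤ _ := by linarith

lemma mul_one_sub_cutoff_le (hη : 0 < η) {t : ℝ} (ht : 0 ≤ t) :
    t * (1 - cutoff η t) ^ 2 ≤ 2 * η := by
  rcases le_total (2 * η) t with h | h
  · rw [cutoff_eq_one hη h]; norm_num; exact hη.le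
  · have h1 := cutoff_nonneg (η := η) t
    have h2 := cutoff_le_one (η := η) t
    calc _ ≤ t * 1 := by gcongr; nlinarith
      _ ≤ _ := by linarith

end Functions

section Relations

attribute [local instance] CStarAlgebra.spectralOrder CStarAlgebra.spectralOrderedRing

variable {X : Type} [NonUnitalCStarAlgebra X]

/-- Families behaving like the columns of matrix units in several blocks: `b` assigns blocks. -/
structure IsColumns {N : ℕ} (b : Fin N → Fin N) (y : Fin N → X) : Prop where
  orth : ∀ s t, s ≠ t → star (y s) * y t = 0
  same : ∀ s t, b s = b t → star (y s) * y s = star (y t) * y t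

lemma star_cfcₙ_real (g : ℝ → ℝ) (a : X) : star (cfcₙ g a) = cfcₙ g a :=
  (IsSelfAdjoint.cfcₙ (f := g) (a := a)).star_eq

lemma IsColumns.mul_cfcₙ {N : ℕ} {b : Fin N → Fin N} {y : Fin N → X} (h : IsColumns b y)
    (g : ℝ → ℝ) : IsColumns b fun s => y s * cfcₙ g (star (y s) * y s) where
  orth s t hst := by
    rw [star_mul, mul_assoc, ← mul_assoc (star (y s)), h.orth s t hst]; simp
  same s t hst := by
    rw [star_mul, star_mul, star_cfcₙ_real, star_cfcₙ_real, mul_assoc, mul_assoc,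
      ← mul_assoc (star (y s)), ← mul_assoc (star (y t)), h.same s t hst]

/-- Multiplying by a function close to `1` moves an element only a little. -/
lemma norm_mul_cfcₙ_sub_le (y : X) {g : ℝ → ℝ} (hg : Continuous g) (h0 : g 0 = 0) {ε : ℝ}
    (hε : 0 ≤ ε) (h : ∀ t, 0 ≤ t → t * (1 - g t) ^ 2 ≤ ε ^ 2) :
    ‖y * cfcₙ g (star y * y) - y‖ ≤ ε := by
  set c := star y * y with hc
  have hc0 : 0 ≤ c := star_mul_self_nonneg y
  have hcs : IsSelfAdjoint c := hc0.isSelfAdjoint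
  have e1 : star (y * cfcₙ g c - y) * (y * cfcₙ g c - y) = cfcₙ (fun t => t * (1 - g t) ^ 2) c := by
    have e2 : cfcₙ (fun t => t * (1 - g t) ^ 2) c =
        cfcₙ g c * c * cfcₙ g c - cfcₙ g c * c - c * cfcₙ g c + c := by
      have e : (fun t => t * (1 - g t) ^ 2) =
          fun t => g t * t * g t - g t * t - t * g t + t := by ext t; ring
      rw [e, cfcₙ_add (fun t => g t * t * g t - g t * t - t * g t) (fun t => t) c,
        cfcₙ_sub (fun t => g t * t * g t - g t * t) (fun t => t * g t) c,
        cfcₙ_sub (fun t => g t * t * g t) (fun t => g t * t) c,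
        cfcₙ_mul (fun t => g t * t) g c, cfcₙ_mul g (fun t => t) c, cfcₙ_mul (fun t => t) g c,
        cfcₙ_id' ℝ c hcs]
    rw [e2, star_sub, star_mul, star_cfcₙ_real]
    simp only [sub_mul, mul_sub, mul_assoc, hc]
    abel
  have e3 := CStarRing.norm_star_mul_self (x := y * cfcₙ g c - y)
  rw [e1] at e3
  have e4 : ‖cfcₙ (fun t => t * (1 - g t) ^ 2) c‖ ≤ ε ^ 2 := by
    refine norm_cfcₙ_le fun t ht => ?_
    have ht0 := quasispectrum_nonneg_of_nonneg c hc0 t ht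
    rw [Real.norm_of_nonneg (by positivity)]
    exact h t ht0
  exact (sq_le_sq₀ (norm_nonneg _) hε).1 (by rw [sq, ← e3]; exact e4)

end Relations

section Lifting

attribute [local instance] CStarAlgebra.spectralOrder CStarAlgebra.spectralOrderedRing

variable {B Q : Type} [NonUnitalCStarAlgebra B] [NonUnitalCStarAlgebra Q]

section Calculus

variable {η : ℝ} {c : B}

lemma invSqrt_conj_mul_cutoff (hη : 0 < η) (hc : IsSelfAdjoint c) :
    cfcₙ (invSqrt η) c * c * cfcₙ (invSqrt η) c * cfcₙ (cutoff η) c = cfcₙ (cutoff η) c := by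
  have h1 : Continuous (invSqrt η) := continuous_invSqrt hη
  have h2 : Continuous (cutoff η) := continuous_cutoff
  have e : cutoff η = fun t => invSqrt η t * t * invSqrt η t * cutoff η t :=
    funext fun t => (invSqrt_sq_mul_cutoff hη t).symm
  conv_rhs => rw [e]
  rw [cfcₙ_mul (fun t => invSqrt η t * t * invSqrt η t) (cutoff η) c
      (by fun_prop) (by simp) (by fun_prop) (by simp),
    cfcₙ_mul (fun t => invSqrt η t * t) (invSqrt η) c
      (by fun_prop) (by simp) (by fun_prop) (by simp),
    cfcₙ_mul (invSqrt η) (fun t => t) c (by fun_prop) (by simp) (by fun_prop) (by simp),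
    cfcₙ_id' ℝ c hc]

lemma cfcₙ_real_comm (f g : ℝ → ℝ) (a : B) : cfcₙ f a * cfcₙ g a = cfcₙ g a * cfcₙ f a :=
  cfcₙ_commute_cfcₙ f g a

lemma cfcₙ_real_comm_self (f : ℝ → ℝ) (hc : IsSelfAdjoint c) : cfcₙ f c * c = c * cfcₙ f c := by
  have := cfcₙ_real_comm f (fun t => t) c
  rwa [cfcₙ_id' ℝ c hc] at this

end Calculus

variable (π : B →⋆ₙₐ[ℂ] Q) {N : ℕ} {η : ℝ}

lemma exists_orth_lift (hπ : Function.Surjective π) (hη : 0 < η) {y : Fin N → Q}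
    (hy : ∀ s t, s ≠ t → star (y s) * y t = 0) (T : Finset (Fin N)) :
    ∃ z : Fin N → B, (∀ i ∈ T, ∀ s, s ≠ i → star (z i) * z s = 0) ∧
      ∀ s, π (z s) = if s ∈ T then y s * cfcₙ (cutoff η) (star (y s) * y s) else y s := by
  classical
  induction T using Finset.induction_on with
  | empty =>
    choose z hz using fun s => hπ (y s)
    exact ⟨z, by simp, by simpa using hz⟩
  | insert j T hj ih =>
    obtain ⟨z, h1, h2⟩ := ih
    set D := star (z j) * z j with hD
    have hDs : IsSelfAdjoint D := IsSelfAdjoint.star_mul_self _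
    set r := cfcₙ (invSqrt η) D with hr
    set f := cfcₙ (cutoff η) D with hf
    have hrs : star r = r := star_cfcₙ_real _ _
    have hfs : star f = f := star_cfcₙ_real _ _
    set E := z j * (r * r) * star (z j) with hE
    have hEs : star E = E := by simp [hE, hrs, mul_assoc]
    have hrf : r * r * D * f = f := by
      have h := invSqrt_conj_mul_cutoff hη hDs
      have hc : r * D = D * r := cfcₙ_real_comm_self _ hDs
      rw [mul_assoc r r D, hc, ← mul_assoc]
      exact h
    have hEf : E * (z j * f) = z j * f := by
      conv_rhs => rw [← hrf]
      rw [hE, hD]; simp only [mul_assoc]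
    have hEz : ∀ i ∈ T, E * z i = 0 := fun i hi => by
      have := congrArg star (h1 i hi j fun h => hj (h ▸ hi))
      rw [star_mul, star_star, star_zero] at this
      rw [hE, mul_assoc, this, mul_zero]
    have hzE : ∀ i ∈ T, star (z i) * E = 0 := fun i hi => by
      simpa [hEs] using congrArg star (hEz i hi)
    refine ⟨fun s => if s = j then z j * f else z s - E * z s, fun i hi s hsi => ?_, fun s => ?_⟩
    · rcases Finset.mem_insert.1 hi with rfl | hi
      · beta_reduce
        rw [if_pos rfl, if_neg hsi, mul_sub, ← mul_assoc (star (z i * f))]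
        have := congrArg star hEf
        rw [star_mul, hEs] at this
        rw [this, sub_self]
      · have hij : i ≠ j := fun h => hj (h ▸ hi)
        beta_reduce
        rw [if_neg hij, hEz i hi, sub_zero]
        split_ifs with hs
        · rw [← mul_assoc, h1 i hi j (Ne.symm hij), zero_mul]
        · rw [mul_sub, ← mul_assoc, hzE i hi, zero_mul, sub_zero, h1 i hi s hsi]
    · have hπj : π (z j) = y j := by rw [h2, if_neg hj]
      have hπD : π D = star (y j) * y j := by rw [hD, map_mul, map_star, hπj]
      beta_reduce
      split_ifs with h h' h'
      · rw [map_mul, hπj, hf, map_cfcₙ_real π _ hDs continuous_cutoff cutoff_zero, hπD, h]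
      · exact absurd (by simp [h]) h'
      · rw [map_sub, map_mul, hE, map_mul, map_star, hπj, mul_assoc, h2]
        have hsT : s ∈ T := (Finset.mem_insert.1 h').resolve_left h
        rw [if_pos hsT, ← mul_assoc (star (y j)), hy j s (Ne.symm h)]
        simp
      · rw [map_sub, map_mul, hE, map_mul, map_star, hπj, mul_assoc, h2]
        have hsT : s ∉ T := fun hs => h' (by simp [hs])
        rw [if_neg hsT, hy j s (Ne.symm h)]
        simp

lemma exists_columns_lift_aux {b : Fin N → Fin N} (T : Finset (Fin N)) {y : Fin N → Q}
    (hy : IsColumns b y) {z : Fin N → B} (hz : ∀ s t, s ≠ t → star (z s) * z t = 0)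
    (hπz : ∀ s, π (z s) = y s) {ε : ℝ} (hε : 0 < ε) :
    ∃ (z' : Fin N → B) (y' : Fin N → Q), (∀ s t, s ≠ t → star (z' s) * z' t = 0) ∧
      IsColumns b y' ∧ (∀ s, π (z' s) = y' s) ∧ (∀ s, ‖y' s - y s‖ ≤ ε) ∧
      ∀ i ∈ T, ∀ j ∈ T, b i = b j → star (z' i) * z' i = star (z' j) * z' j := by
  classical
  induction T using Finset.induction_on generalizing ε with
  | empty => exact ⟨z, y, hz, hy, hπz, by simp [hε.le], by simp⟩
  | insert j T hj ih =>
    obtain ⟨z₁, y₁, hz₁, hy₁, hπ₁, hn₁, hT⟩ := ih (half_pos hε)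
    by_cases hex : ∃ i ∈ T, b i = b j
    swap
    · refine ⟨z₁, y₁, hz₁, hy₁, hπ₁, fun s => (hn₁ s).trans (half_le_self hε.le), ?_⟩
      intro i hi k hk hik
      rcases Finset.mem_insert.1 hi with hi | hi <;> rcases Finset.mem_insert.1 hk with hk | hk
      · rw [hi, hk]
      · exact absurd ⟨k, hk, hi ▸ hik.symm⟩ hex
      · exact absurd ⟨i, hi, hk ▸ hik⟩ hex
      · exact hT i hi k hk hik
    obtain ⟨i₀, hi₀, hb₀⟩ := hex
    set η : ℝ := ε ^ 2 / 8 with hη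
    have hη0 : 0 < η := by positivity
    set C := star (z₁ i₀) * z₁ i₀ with hC
    set D := star (z₁ j) * z₁ j with hD
    have hCs : IsSelfAdjoint C := IsSelfAdjoint.star_mul_self _
    have hDs : IsSelfAdjoint D := IsSelfAdjoint.star_mul_self _
    have cr : Continuous (invSqrt η) := continuous_invSqrt hη0
    have cf : Continuous (cutoff η) := continuous_cutoff
    set ell : ℝ → ℝ := fun t => cutoff η t * √t with hell
    have cl : Continuous ell := by fun_prop
    have l0 : ell 0 = 0 := by simp [hell]
    set l := cfcₙ ell C with hl
    have hls : star l = l := star_cfcₙ_real _ _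
    set f := cfcₙ (cutoff η) D with hf
    have hfs : star f = f := star_cfcₙ_real _ _
    set rC := cfcₙ (invSqrt η) C with hrC
    set rD := cfcₙ (invSqrt η) D with hrD
    have hrCs : star rC = rC := star_cfcₙ_real _ _
    have hrDs : star rD = rD := star_cfcₙ_real _ _
    set x := l * (f * f) * l with hx
    have hx0 : 0 ≤ x := by
      have e : x = star (f * l) * (f * l) := by
        rw [hx, star_mul, hfs, hls]; simp only [mul_assoc]
      rw [e]
      exact star_mul_self_nonneg _
    have hxs : IsSelfAdjoint x := hx0.isSelfAdjoint
    set R := cfcₙ Real.sqrt x with hR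
    have hRs : star R = R := star_cfcₙ_real _ _
    have hRR : R * R = x := by
      rw [hR, ← CFC.sqrt_eq_real_sqrt x hx0, CFC.sqrt_mul_sqrt_self x hx0]
    have hel : rC * C * rC * l = l := by
      rw [hl, hell, cfcₙ_mul (cutoff η) (fun t => √t) C (by fun_prop) (by simp) (by fun_prop)
        (by simp), ← mul_assoc, invSqrt_conj_mul_cutoff hη0 hCs]
    have heR : rC * C * rC * R = R := by
      rw [← sub_eq_zero, ← CStarRing.mul_star_self_eq_zero_iff]
      have hes : star (rC * C * rC) = rC * C * rC := by
        rw [star_mul, star_mul, hrCs, hCs.star_eq]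
        exact (mul_assoc _ _ _).symm
      have hex : rC * C * rC * x = x := by rw [hx, ← mul_assoc, ← mul_assoc, hel]
      have hxe : x * (rC * C * rC) = x := by simpa [hes, hxs.star_eq] using congrArg star hex
      have e : ∀ e : B, star e = e → (e * R - R) * star (e * R - R) =
          e * (R * R * e) - e * (R * R) - R * R * e + R * R := fun e he => by
        simp only [star_sub, star_mul, he, hRs, sub_mul, mul_sub, mul_assoc]; abel
      rw [e _ hes, hRR, hxe, hex]
      abel
    have hcomm : rD * f = f * rD := cfcₙ_real_comm _ _ _
    have hff : f * (rD * D * rD) * f = f * f := by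
      rw [mul_assoc f, invSqrt_conj_mul_cutoff hη0 hDs]
    refine ⟨fun s => z₁ s * (if s = j then rD * f * l else if s ∈ T ∧ b s = b j then rC * R else
        cfcₙ (fun t => cutoff η t * cutoff η t) (star (z₁ s) * z₁ s)),
      fun s => y₁ s * cfcₙ (fun t => cutoff η t * cutoff η t) (star (y₁ s) * y₁ s),
      fun s t hst => ?_, hy₁.mul_cfcₙ _, fun s => ?_, fun s => ?_, ?_⟩
    · rw [star_mul, mul_assoc, ← mul_assoc (star (z₁ s)), hz₁ s t hst]; simp
    · have hπs : ∀ s, π (star (z₁ s) * z₁ s) = star (y₁ s) * y₁ s := fun s => by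
        rw [map_mul, map_star, hπ₁]
      have hcs : IsSelfAdjoint (star (y₁ s) * y₁ s) := IsSelfAdjoint.star_mul_self _
      have hcn : 0 ≤ star (y₁ s) * y₁ s := star_mul_self_nonneg _
      rw [map_mul, hπ₁]
      congr 1
      split_ifs with h h'
      · have hπC : π C = star (y₁ s) * y₁ s := by rw [hC, hπs, h, hy₁.same i₀ j hb₀]
        have hπD : π D = star (y₁ s) * y₁ s := by rw [hD, hπs, h]
        rw [map_mul, map_mul, hrD, hf, hl, map_cfcₙ_real π _ hDs cr invSqrt_zero,
          map_cfcₙ_real π _ hDs cf cutoff_zero, map_cfcₙ_real π _ hCs cl l0, hπC, hπD,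
          ← cfcₙ_mul (invSqrt η) (cutoff η) _ (by fun_prop) (by simp) (by fun_prop) (by simp),
          ← cfcₙ_mul (fun t => invSqrt η t * cutoff η t) ell _ (by fun_prop) (by simp)
            (by fun_prop) (by simp [l0])]
        congr 1
        funext t
        calc invSqrt η t * cutoff η t * (cutoff η t * √t)
            = (invSqrt η t * √t * cutoff η t) * cutoff η t := by ring
          _ = _ := by rw [invSqrt_mul_sqrt_mul_cutoff hη0]
      · have hπC : π C = star (y₁ s) * y₁ s := by
          rw [hC, hπs, hy₁.same i₀ s (hb₀.trans h'.2.symm)]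
        have hπD : π D = star (y₁ s) * y₁ s := by rw [hD, hπs, hy₁.same j s h'.2.symm]
        have hπx : π x = cfcₙ (fun t => ell t * (cutoff η t * cutoff η t) * ell t)
            (star (y₁ s) * y₁ s) := by
          rw [hx, map_mul, map_mul, map_mul, hl, hf, map_cfcₙ_real π _ hDs cf cutoff_zero,
            map_cfcₙ_real π _ hCs cl l0, hπC, hπD,
            cfcₙ_mul (fun t => ell t * (cutoff η t * cutoff η t)) ell _ (by fun_prop) (by simp)
              (by fun_prop) (by simp [l0]),
            cfcₙ_mul ell (fun t => cutoff η t * cutoff η t) _ (by fun_prop) (by simp [l0])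
              (by fun_prop) (by simp),
            cfcₙ_mul (cutoff η) (cutoff η) _ (by fun_prop) (by simp) (by fun_prop) (by simp)]
        rw [map_mul, hrC, hR, map_cfcₙ_real π _ hCs cr invSqrt_zero,
          map_cfcₙ_real π _ hxs Real.continuous_sqrt Real.sqrt_zero, hπx, hπC,
          ← cfcₙ_comp Real.sqrt (fun t => ell t * (cutoff η t * cutoff η t) * ell t) _
            (by fun_prop) (by simp) (by fun_prop) (by simp) hcs,
          ← cfcₙ_mul (invSqrt η) _ _ (by fun_prop) (by simp) (by fun_prop) (by simp)]
        refine cfcₙ_congr fun t ht => ?_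
        have ht0 := quasispectrum_nonneg_of_nonneg _ hcn t ht
        have e : ell t * (cutoff η t * cutoff η t) * ell t =
            (cutoff η t * cutoff η t * √t) * (cutoff η t * cutoff η t * √t) := by
          simp only [hell]; ring
        have e0 : 0 ≤ cutoff η t * cutoff η t * √t :=
          mul_nonneg (mul_nonneg (cutoff_nonneg t) (cutoff_nonneg t)) (Real.sqrt_nonneg t)
        simp only [Function.comp]
        rw [e, Real.sqrt_mul_self e0]
        nth_rw 3 [← invSqrt_mul_sqrt_mul_cutoff hη0 t]
        ring
      · rw [map_cfcₙ_real π _ (IsSelfAdjoint.star_mul_self _) (by fun_prop) (by simp), hπs]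
    · have h1 := norm_mul_cfcₙ_sub_le (y₁ s) (g := fun t => cutoff η t * cutoff η t)
        (by fun_prop) (by simp) (half_pos hε).le fun t ht =>
          (mul_one_sub_cutoff_sq_le hη0 ht).trans (by rw [hη]; linarith [sq_nonneg ε])
      have h2 := norm_add_le (y₁ s * cfcₙ (fun t => cutoff η t * cutoff η t)
        (star (y₁ s) * y₁ s) - y₁ s) (y₁ s - y s)
      rw [sub_add_sub_cancel] at h2
      linarith [hn₁ s]
    · have hj' : star (z₁ j * (rD * f * l)) * (z₁ j * (rD * f * l)) = x := by
        have : star (z₁ j * (rD * f * l)) * (z₁ j * (rD * f * l)) =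
            l * (f * (rD * D * rD) * f) * l := by
          simp only [star_mul, hrDs, hfs, hls, hD, mul_assoc]
        rw [this, hff, hx]
      have hi' : ∀ i ∈ T, b i = b j → star (z₁ i * (rC * R)) * (z₁ i * (rC * R)) = x := by
        intro i hi hij
        have : star (z₁ i * (rC * R)) * (z₁ i * (rC * R)) = R * (rC * C * rC * R) := by
          rw [hC, ← hT i hi i₀ hi₀ (hij.trans hb₀.symm)]
          simp only [star_mul, hrCs, hRs, mul_assoc]
        rw [this, heR, hRR]
      have hj'' : ∀ i ∈ insert j T, b i = b j → (star (z₁ i * (if i = j then rD * f * l else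
          if i ∈ T ∧ b i = b j then rC * R else
            cfcₙ (fun t => cutoff η t * cutoff η t) (star (z₁ i) * z₁ i))) *
          (z₁ i * (if i = j then rD * f * l else if i ∈ T ∧ b i = b j then rC * R else
            cfcₙ (fun t => cutoff η t * cutoff η t) (star (z₁ i) * z₁ i)))) = x := by
        intro i hi hij
        by_cases h : i = j
        · simp only [h, if_true]; exact hj'
        · have hiT := (Finset.mem_insert.1 hi).resolve_left h
          simp only [h, if_false, hiT, hij, and_self, if_true]
          exact hi' i hiT hij
      intro i hi k hk hik
      by_cases h : b i = b j
      · rw [hj'' i hi h, hj'' k hk (hik ▸ h)]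
      · have h3 : b k ≠ b j := hik ▸ h
        have h4 : i ≠ j := fun e => h (e ▸ rfl)
        have h5 : k ≠ j := fun e => h3 (e ▸ rfl)
        have h6 := hT i ((Finset.mem_insert.1 hi).resolve_left h4) k
          ((Finset.mem_insert.1 hk).resolve_left h5) hik
        simp only [h, h3, h4, h5, and_false, if_false, star_mul, star_cfcₙ_real]
        rw [mul_assoc, mul_assoc, ← mul_assoc (star (z₁ i)), ← mul_assoc (star (z₁ k)), h6]

end Lifting

section OrderZeroLift

attribute [local instance] CStarAlgebra.spectralOrder CStarAlgebra.spectralOrderedRing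

variable {B Q F : Type} [NonUnitalCStarAlgebra B] [NonUnitalCStarAlgebra Q]
  [NonUnitalCStarAlgebra F]

namespace MatUnits

variable (M : MatUnits F)

/-- The matrix coefficients, extended by zero to pairs in different blocks. -/
noncomputable def coeff (s t : Fin M.N) : F →ₗ[ℂ] ℂ := if M.b s = M.b t then M.c s t else 0

lemma coeff_eq_zero {s t : Fin M.N} (h : M.b s ≠ M.b t) (x : F) : M.coeff s t x = 0 := by
  simp [coeff, h]

lemma star_mul_mul (s t : Fin M.N) (x : F) :
    star (M.v s) * x * M.v t = M.coeff s t x • M.v (M.b s) := by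
  by_cases h : M.b s = M.b t
  · rw [M.coef s t x h, coeff, if_pos h]
  · rw [M.coef_zero s t x h, coeff_eq_zero M h, zero_smul]

lemma coeff_unique {s t : Fin M.N} {x : F} {a : ℂ}
    (h : star (M.v s) * x * M.v t = a • M.v (M.b s)) : M.coeff s t x = a := by
  rw [star_mul_mul] at h
  exact smul_left_injective ℂ (M.ne_zero s) h

lemma coeff_mul (s t : Fin M.N) (x y : F) :
    M.coeff s t (x * y) = ∑ r, M.coeff s r x * M.coeff r t y := by
  refine M.coeff_unique ?_
  calc star (M.v s) * (x * y) * M.v t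
      = star (M.v s) * (x * ((∑ r, M.v r * star (M.v r)) * y)) * M.v t := by rw [M.unit_mul]
    _ = ∑ r, (star (M.v s) * x * M.v r) * (star (M.v r) * y * M.v t) := by
      simp only [Finset.sum_mul, Finset.mul_sum, mul_assoc]
    _ = _ := by
      rw [Finset.sum_smul]
      refine Finset.sum_congr rfl fun r _ => ?_
      rw [star_mul_mul, star_mul_mul]
      by_cases h : M.b s = M.b r
      · rw [← h, smul_mul_smul_comm, M.idem]
      · rw [M.coeff_eq_zero h]; simp

lemma coeff_star (s t : Fin M.N) (x : F) : M.coeff s t (star x) = star (M.coeff t s x) := by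
  by_cases h : M.b s = M.b t
  · refine M.coeff_unique ?_
    have := congrArg star (M.star_mul_mul t s x)
    rw [star_mul, star_mul, star_star, star_smul, M.star_v_b, ← h, ← mul_assoc] at this
    exact this
  · rw [M.coeff_eq_zero h, M.coeff_eq_zero (Ne.symm h), star_zero]

lemma norm_coeff_le (s t : Fin M.N) (x : F) : ‖M.coeff s t x‖ ≤ ‖x‖ := by
  have h := congrArg norm (M.star_mul_mul s t x)
  rw [norm_smul, M.norm_v_b, mul_one] at h
  rw [← h]
  calc _ ≤ ‖star (M.v s)‖ * ‖x‖ * ‖M.v t‖ :=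
        (norm_mul_le _ _).trans (mul_le_mul_of_nonneg_right (norm_mul_le _ _) (norm_nonneg _))
    _ = _ := by rw [norm_star, M.norm_v, M.norm_v]; ring

lemma expand_coeff (x : F) : x = ∑ s, ∑ t, M.coeff s t x • (M.v s * star (M.v t)) := by
  conv_lhs => rw [M.expand x]
  refine Finset.sum_congr rfl fun s _ => Finset.sum_congr rfl fun t _ => ?_
  split_ifs with h
  · rw [coeff, if_pos h]
  · rw [M.coeff_eq_zero h, zero_smul]

/-- The linear map sending the matrix unit `v s * star (v t)` to `z s * star (z t)`. -/
noncomputable def columnsMap (z : Fin M.N → B) : F →ₗ[ℂ] B :=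
  ∑ s, ∑ t, (M.coeff s t).smulRight (z s * star (z t))

lemma columnsMap_apply (z : Fin M.N → B) (x : F) :
    M.columnsMap z x = ∑ s, ∑ t, M.coeff s t x • (z s * star (z t)) := by
  simp [columnsMap]

lemma isCPMap_columnsMap (z : Fin M.N → B) : IsCPMap (M.columnsMap z) := by
  refine isCPMap_of_sum_gram _ (fun r x => ∑ s, M.coeff r s x • star (z s)) fun x y => ?_
  simp only [columnsMap_apply, coeff_mul, coeff_star, star_sum, star_smul, star_star,
    Finset.sum_smul, Finset.sum_mul, Finset.mul_sum, smul_mul_smul_comm]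
  rw [Finset.sum_congr rfl fun s _ => Finset.sum_comm, Finset.sum_comm]
  refine Finset.sum_congr rfl fun r _ => ?_
  rw [Finset.sum_comm]

lemma columnsMap_mul {z : Fin M.N → B} (hz : IsColumns M.b z) (x y : F) :
    M.columnsMap z x * M.columnsMap z y =
      ∑ s, ∑ t, M.coeff s t (x * y) • (z s * (star (z s) * z s) * star (z t)) := by
  have key : ∀ s t, M.coeff s t x • (z s * star (z t)) * M.columnsMap z y =
      ∑ w, (M.coeff s t x * M.coeff t w y) • (z s * (star (z s) * z s) * star (z w)) := by
    intro s t
    rw [columnsMap_apply, Finset.mul_sum, Finset.sum_eq_single t]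
    · rw [Finset.mul_sum]
      refine Finset.sum_congr rfl fun w _ => ?_
      rw [smul_mul_smul_comm]
      by_cases h : M.b s = M.b t
      · rw [hz.same s t h]; simp only [mul_assoc]
      · rw [M.coeff_eq_zero h]; simp
    · intro u _ hu
      rw [Finset.mul_sum]
      refine Finset.sum_eq_zero fun w _ => ?_
      rw [smul_mul_smul_comm, mul_assoc (z s), ← mul_assoc (star (z t)), hz.orth t u (Ne.symm hu)]
      simp
    · simp
  rw [columnsMap_apply M z x, Finset.sum_mul]
  refine Finset.sum_congr rfl fun s _ => ?_
  simp only [Finset.sum_mul, key, coeff_mul, Finset.sum_smul]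
  exact Finset.sum_comm

lemma isOrderZero_columnsMap {z : Fin M.N → B} (hz : IsColumns M.b z) :
    IsOrderZero (M.columnsMap z) := fun x y _ _ h => by
  rw [M.columnsMap_mul hz, h]; simp

end MatUnits

lemma one_sub_invSqrt_sq_le {η : ℝ} (hη : 0 < η) {t : ℝ} (ht : 0 ≤ t) :
    t * (1 - invSqrt η t * t * invSqrt η t) ^ 2 ≤ η ∧
      0 ≤ invSqrt η t * t * invSqrt η t ∧ invSqrt η t * t * invSqrt η t ≤ 1 := by
  have e : invSqrt η t * t * invSqrt η t = t ^ 2 / max t η ^ 2 := by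
    rw [invSqrt, div_mul_eq_mul_div, div_mul_div_comm, mul_right_comm, Real.mul_self_sqrt ht]
    ring
  have hm : 0 < max t η := lt_max_of_lt_right hη
  have h1 : t ^ 2 / max t η ^ 2 ≤ 1 := by
    rw [div_le_one (by positivity)]
    exact pow_le_pow_left₀ ht (le_max_left _ _) 2
  have h0 : 0 ≤ t ^ 2 / max t η ^ 2 := by positivity
  rw [e]
  refine ⟨?_, h0, h1⟩
  rcases le_total t η with h | h
  · calc _ ≤ t * 1 := by gcongr; nlinarith
      _ ≤ η := by linarith
  · rw [max_eq_left h, div_self (pow_pos (hη.trans_le h) 2).ne']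
    simpa using hη.le

/-- The polar decomposition of an order zero map, up to a small error. -/
lemma IsOrderZero.exists_columns [FiniteDimensional ℂ F] {φ : F →ₗ[ℂ] Q} (hc : IsCPMap φ)
    (hz : IsOrderZero φ) (hn : ∀ x, ‖φ x‖ ≤ ‖x‖) (M : MatUnits F) {δ : ℝ} (hδ : 0 < δ) :
    ∃ y : Fin M.N → Q, IsColumns M.b y ∧ (∀ s, ‖y s‖ ≤ 1) ∧
      ∀ s t, ‖y s * star (y t) - φ (M.v s * star (M.v t))‖ ≤ δ := by
  set h := φ (fdUnit F) with hh
  have h0 : 0 ≤ h := hc.map_nonneg fdUnit_nonneg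
  have hs : IsSelfAdjoint h := h0.isSelfAdjoint
  have hη : 0 < δ ^ 2 := by positivity
  set k := cfcₙ (invSqrt (δ ^ 2)) h with hk
  have ck : Continuous (invSqrt (δ ^ 2)) := continuous_invSqrt hη
  have hks : star k = k := star_cfcₙ_real _ _
  have hcomm : ∀ x, k * φ x = φ x * k := fun x =>
    (Commute.cfcₙ_real (hz.comm_unit x : Commute h (φ x)) (invSqrt (δ ^ 2)))
  have hkh : k * h = h * k := cfcₙ_real_comm_self _ hs
  set g : ℝ → ℝ := fun t => invSqrt (δ ^ 2) t * t * invSqrt (δ ^ 2) t with hg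
  have cg : Continuous g := by fun_prop
  have g0 : g 0 = 0 := by simp [hg]
  set G := cfcₙ g h with hG
  have hGk : G = k * h * k := by
    rw [hG, hg, cfcₙ_mul (fun t => invSqrt (δ ^ 2) t * t) (invSqrt (δ ^ 2)) h
      (by fun_prop) (by simp) (by fun_prop) (by simp),
      cfcₙ_mul (invSqrt (δ ^ 2)) (fun t => t) h (by fun_prop) (by simp) (by fun_prop) (by simp),
      cfcₙ_id' ℝ h hs]
  have hGs : star G = G := star_cfcₙ_real _ _
  have hGcomm : ∀ x, G * φ x = φ x * G := fun x =>
    (Commute.cfcₙ_real (hz.comm_unit x : Commute h (φ x)) g)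
  have hprod : ∀ x y, k * φ x * (k * φ y) = G * φ (x * y) := fun x y => by
    rw [hGk, mul_assoc k h k, ← hkh, mul_assoc, ← mul_assoc (φ x), ← hcomm, mul_assoc, hz.mul_eq hc,
      ← hh]
    simp only [mul_assoc]
  have hG1 : ‖G‖ ≤ 1 := norm_cfcₙ_le fun t ht => by
    obtain ⟨-, a, b⟩ := one_sub_invSqrt_sq_le hη (quasispectrum_nonneg_of_nonneg h h0 t ht)
    rw [Real.norm_of_nonneg a]; exact b
  have hst : ∀ s, star (k * φ (M.v s)) = k * φ (star (M.v s)) := fun s => by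
    rw [star_mul, hks, ← hc.map_star, hcomm]
  refine ⟨fun s => k * φ (M.v s), ⟨fun s t hst' => ?_, fun s t hb => ?_⟩, fun s => ?_,
    fun s t => ?_⟩
  · rw [hst, hprod, M.orth s t hst', map_zero, mul_zero]
  · rw [hst, hst, hprod, hprod, M.same, M.same, hb]
  · have h1 := CStarRing.norm_star_mul_self (x := k * φ (M.v s))
    rw [hst, hprod, M.same] at h1
    have h2 : ‖G * φ (M.v (M.b s))‖ ≤ 1 * 1 :=
      (norm_mul_le _ _).trans (mul_le_mul hG1 ((hn _).trans (M.norm_v_b s).le) (norm_nonneg _)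
        zero_le_one)
    beta_reduce
    nlinarith [norm_nonneg (k * φ (M.v s))]
  · rw [hst, hprod]
    set w := M.v s * star (M.v t) with hw
    have hw1 : ‖w‖ ≤ 1 := (norm_mul_le _ _).trans (by rw [norm_star, M.norm_v, M.norm_v, mul_one])
    have e1 : star (G * φ w - φ w) * (G * φ w - φ w) =
        cfcₙ (fun t => t * (1 - g t) ^ 2) h * φ (star w * w) := by
      have e2 : cfcₙ (fun t => t * (1 - g t) ^ 2) h = G * G * h - G * h - G * h + h := by
        have : (fun t => t * (1 - g t) ^ 2) = fun t => g t * g t * t - g t * t - g t * t + t := by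
          funext t; ring
        rw [this, cfcₙ_add (fun t => g t * g t * t - g t * t - g t * t) (fun t => t) h
            (by fun_prop) (by simp) (by fun_prop) (by simp),
          cfcₙ_sub (fun t => g t * g t * t - g t * t) (fun t => g t * t) h
            (by fun_prop) (by simp) (by fun_prop) (by simp),
          cfcₙ_sub (fun t => g t * g t * t) (fun t => g t * t) h
            (by fun_prop) (by simp) (by fun_prop) (by simp),
          cfcₙ_mul (fun t => g t * g t) (fun t => t) h
            (by fun_prop) (by simp [g0]) (by fun_prop) (by simp),
          cfcₙ_mul g g h (by fun_prop) (by simp [g0]) (by fun_prop) (by simp [g0]),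
          cfcₙ_mul g (fun t => t) h (by fun_prop) (by simp [g0]) (by fun_prop) (by simp),
          cfcₙ_id' ℝ h hs]
      have e3 : star (G * φ w) = G * φ (star w) := by rw [star_mul, hGs, ← hc.map_star, hGcomm]
      have e4 : φ (star w) * φ w = h * φ (star w * w) := hz.mul_eq hc _ _
      have e5 : φ (star w) * (G * φ w) = G * (h * φ (star w * w)) := by
        rw [← mul_assoc, ← hGcomm, mul_assoc, e4]
      rw [star_sub, e3, ← hc.map_star, e2]
      simp only [sub_mul, mul_sub, add_mul, mul_assoc, e4, e5]
      abel
    have e6 : ‖cfcₙ (fun t => t * (1 - g t) ^ 2) h‖ ≤ δ ^ 2 :=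
      norm_cfcₙ_le fun t ht => by
        have ht0 := quasispectrum_nonneg_of_nonneg h h0 t ht
        rw [Real.norm_of_nonneg (by positivity)]
        exact (one_sub_invSqrt_sq_le hη ht0).1
    have e7 := CStarRing.norm_star_mul_self (x := G * φ w - φ w)
    have e8 : ‖φ (star w * w)‖ ≤ 1 := by
      refine (hn _).trans ?_
      rw [CStarRing.norm_star_mul_self]
      nlinarith [norm_nonneg w]
    rw [e1] at e7
    have e9 := (norm_mul_le (cfcₙ (fun t => t * (1 - g t) ^ 2) h) (φ (star w * w))).trans
      (mul_le_mul e6 e8 (norm_nonneg _) hη.le)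
    rw [e7, mul_one] at e9
    exact abs_le_of_sq_le_sq' (by nlinarith) hδ.le |>.2

theorem exists_orderZero_lift [FiniteDimensional ℂ F] (π : B →⋆ₙₐ[ℂ] Q)
    (hπ : Function.Surjective π) {φ : F →ₗ[ℂ] Q} (hc : IsCPMap φ) (hz : IsOrderZero φ)
    (hn : ∀ x, ‖φ x‖ ≤ ‖x‖) {ε : ℝ} (hε : 0 < ε) :
    ∃ Φ : F →ₗ[ℂ] B, IsCPMap Φ ∧ IsOrderZero Φ ∧ ∀ x, ‖π (Φ x) - φ x‖ ≤ ε * ‖x‖ := by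
  obtain ⟨M⟩ := nonempty_matUnits (F := F)
  set δ : ℝ := min 1 (ε / (4 * ((M.N : ℝ) * M.N + 1))) with hδ
  have hδ0 : 0 < δ := by positivity
  have hδ1 : δ ≤ 1 := min_le_left _ _
  have hδN : (M.N : ℝ) * M.N * (4 * δ) ≤ ε := by
    have : δ ≤ ε / (4 * ((M.N : ℝ) * M.N + 1)) := min_le_right _ _
    rw [le_div_iff₀ (by positivity)] at this
    nlinarith
  obtain ⟨y, hy, hy1, hyφ⟩ := hz.exists_columns hc hn M hδ0
  have hη : 0 < δ ^ 2 / 8 := by positivity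
  obtain ⟨z₁, hz₁, hπ₁⟩ := exists_orth_lift π hπ hη hy.orth Finset.univ
  obtain ⟨z, y', hz', hy', hπz, hyy, hT⟩ := exists_columns_lift_aux π Finset.univ
    (hy.mul_cfcₙ (cutoff (δ ^ 2 / 8))) (fun s t h => hz₁ s (Finset.mem_univ _) t (Ne.symm h))
    (fun s => by simpa using hπ₁ s) (half_pos hδ0)
  have hd : ∀ s, ‖y' s - y s‖ ≤ δ := fun s => by
    have h1 := norm_mul_cfcₙ_sub_le (y s) (g := cutoff (δ ^ 2 / 8)) continuous_cutoff cutoff_zero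
      (half_pos hδ0).le fun t ht =>
        (mul_one_sub_cutoff_le hη ht).trans (by linarith [sq_nonneg δ])
    have h2 := norm_sub_le_norm_sub_add_norm_sub (y' s)
      (y s * cfcₙ (cutoff (δ ^ 2 / 8)) (star (y s) * y s)) (y s)
    linarith [hyy s]
  have hzc : IsColumns M.b z :=
    ⟨hz', fun s t h => hT s (Finset.mem_univ _) t (Finset.mem_univ _) h⟩
  refine ⟨M.columnsMap z, M.isCPMap_columnsMap z, M.isOrderZero_columnsMap hzc, fun x => ?_⟩
  have hst : ∀ s t, ‖y' s * star (y' t) - φ (M.v s * star (M.v t))‖ ≤ 4 * δ := fun s t => by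
    have e : y' s * star (y' t) - φ (M.v s * star (M.v t)) =
        (y' s - y s) * star (y' t) + y s * star (y' t - y t) +
          (y s * star (y t) - φ (M.v s * star (M.v t))) := by
      rw [star_sub]; noncomm_ring
    have hyt : ‖y' t‖ ≤ 2 := by
      have := norm_add_le (y' t - y t) (y t)
      rw [sub_add_cancel] at this
      linarith [hd t, hy1 t]
    have h1 : ‖(y' s - y s) * star (y' t)‖ ≤ δ * 2 := (norm_mul_le _ _).trans (by
      rw [norm_star]; exact mul_le_mul (hd s) hyt (norm_nonneg _) hδ0.le)
    have h2 : ‖y s * star (y' t - y t)‖ ≤ 1 * δ := (norm_mul_le _ _).trans (by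
      rw [norm_star]; exact mul_le_mul (hy1 s) (hd t) (norm_nonneg _) zero_le_one)
    rw [e]
    refine (norm_add₃_le).trans ?_
    linarith [hyφ s t]
  have e : π (M.columnsMap z x) - φ x =
      ∑ s, ∑ t, M.coeff s t x • (y' s * star (y' t) - φ (M.v s * star (M.v t))) := by
    conv_lhs => rw [M.columnsMap_apply]; arg 2; rw [M.expand_coeff x]
    simp only [map_sum, map_smul, map_mul, map_star, hπz, smul_sub, Finset.sum_sub_distrib]
  rw [e]
  calc _ ≤ ∑ s : Fin M.N, ∑ t : Fin M.N, ‖x‖ * (4 * δ) := by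
        refine (norm_sum_le _ _).trans (Finset.sum_le_sum fun s _ => (norm_sum_le _ _).trans
          (Finset.sum_le_sum fun t _ => ?_))
        rw [norm_smul]
        exact mul_le_mul (M.norm_coeff_le s t x) (hst s t) (norm_nonneg _) (norm_nonneg _)
    _ = (M.N : ℝ) * M.N * (4 * δ) * ‖x‖ := by simp; ring
    _ ≤ _ := mul_le_mul_of_nonneg_right hδN (norm_nonneg _)

end OrderZeroLift

section Tails

attribute [local instance] CStarAlgebra.spectralOrder CStarAlgebra.spectralOrderedRing

open Filter Topology BoundedContinuousFunction

variable {X Q : Type} [NonUnitalCStarAlgebra X] [NonUnitalCStarAlgebra Q]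

lemma norm_sub_mul_proj_le {q : X} (h1 : star q = q) (h2 : q * q = q) (a : X) :
    ‖a - a * q‖ ≤ ‖a‖ := by
  have e : (a - a * q) * star (a - a * q) = a * star a - a * q * star a := by
    have : a * q * (q * star a) = a * q * star a := by
      rw [mul_assoc, ← mul_assoc q, h2, mul_assoc]
    simp only [star_sub, star_mul, h1, sub_mul, mul_sub, this]
    simp only [mul_assoc]; abel
  have hle : (a - a * q) * star (a - a * q) ≤ a * star a := by
    rw [e]
    refine sub_le_self _ ?_
    have := mul_star_self_nonneg (a * q)
    rwa [star_mul, h1, mul_assoc, ← mul_assoc q, h2, ← mul_assoc] at this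
  have := CStarAlgebra.norm_le_norm_of_nonneg_of_le (mul_star_self_nonneg _) hle
  rw [CStarRing.norm_self_mul_star, CStarRing.norm_self_mul_star] at this
  nlinarith [norm_nonneg (a - a * q), norm_nonneg a]

lemma quasispectrum_le_norm {c : X} (hc : IsSelfAdjoint c) {t : ℝ} (ht : t ∈ quasispectrum ℝ c) :
    t ≤ ‖c‖ := by
  have := norm_apply_le_norm_cfcₙ (fun t : ℝ => t) c ht
  rw [cfcₙ_id' ℝ c hc] at this
  exact (le_abs_self t).trans this

lemma norm_mul_cfcₙ_le (y : X) {g : ℝ → ℝ} (hg : Continuous g) (h0 : g 0 = 0) {r : ℝ} (hr : 0 ≤ r)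
    (h : ∀ t, 0 ≤ t → t * (1 - g t) ^ 2 ≤ r ^ 2) : ‖y - y * cfcₙ g (star y * y)‖ ≤ r := by
  rw [norm_sub_rev]
  exact norm_mul_cfcₙ_sub_le y hg h0 hr h

/-- Elements lift through surjective star homomorphisms almost without increasing the norm. -/
lemma exists_norm_le_lift (π : X →⋆ₙₐ[ℂ] Q) (a : X) {ε : ℝ} (hε : 0 < ε) :
    ∃ a', π a' = π a ∧ ‖a'‖ ≤ ‖π a‖ + ε := by
  set r := ‖π a‖ + ε with hr
  have hr0 : 0 < r := by positivity
  set k : ℝ → ℝ := fun t => max 0 (√t - r) / max (√t) r with hk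
  have hm : ∀ t : ℝ, 0 < max (√t) r := fun t => lt_max_of_lt_right hr0
  have ck : Continuous k :=
    Continuous.div (by fun_prop) (by fun_prop) fun t => (hm t).ne'
  have k0 : k 0 = 0 := by simp [hk, hr0.le]
  have hsa : IsSelfAdjoint (star a * a) := IsSelfAdjoint.star_mul_self a
  refine ⟨a - a * cfcₙ k (star a * a), ?_, norm_mul_cfcₙ_le a ck k0 hr0.le fun t ht => ?_⟩
  · rw [map_sub, map_mul, map_cfcₙ_real π k hsa ck k0, map_mul, map_star]
    have : cfcₙ k (star (π a) * π a) = cfcₙ (fun _ : ℝ => (0 : ℝ)) (star (π a) * π a) := by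
      refine cfcₙ_congr fun t ht => ?_
      have h1 := quasispectrum_le_norm (IsSelfAdjoint.star_mul_self (π a)) ht
      rw [CStarRing.norm_star_mul_self] at h1
      have h2 : √t ≤ r := by
        rw [Real.sqrt_le_left hr0.le]
        nlinarith [norm_nonneg (π a)]
      simp only [hk]
      rw [max_eq_left (by linarith), zero_div]
    rw [this, cfcₙ_const_zero, mul_zero, sub_zero]
  · simp only [hk]
    have hs := Real.sq_sqrt ht
    rcases le_total (√t) r with h | h
    · rw [max_eq_left (by linarith : √t - r ≤ 0), zero_div, sub_zero, one_pow, mul_one, ← hs]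
      exact pow_le_pow_left₀ (Real.sqrt_nonneg _) h 2
    · rw [max_eq_right (by linarith : 0 ≤ √t - r), max_eq_left h]
      have : 0 < √t := hr0.trans_le h
      rw [one_sub_div this.ne', sub_sub_cancel, div_pow, ← mul_div_assoc,
        div_le_iff₀ (by positivity), hs, mul_comm]

/-- A sequence of projections in the kernel of `π` that is an approximate unit for the kernel and
asymptotically central. -/
structure IsQuasicentral (π : X →⋆ₙₐ[ℂ] Q) (p : ℕ → X) : Prop where
  sa : ∀ n, star (p n) = p n
  idem : ∀ n, p n * p n = p n
  map : ∀ n, π (p n) = 0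
  unit : ∀ x, π x = 0 → Tendsto (fun n => p n * x - x) atTop (𝓝 0)
  comm : ∀ a, Tendsto (fun n => p n * a - a * p n) atTop (𝓝 0)

namespace IsQuasicentral

variable {π : X →⋆ₙₐ[ℂ] Q} {p : ℕ → X}

lemma norm_le (hp : IsQuasicentral π p) (n : ℕ) : ‖p n‖ ≤ 1 := norm_proj_le (hp.sa n) (hp.idem n)

lemma eventually_norm_le (hp : IsQuasicentral π p) (a : X) {ε : ℝ} (hε : 0 < ε) :
    ∀ᶠ n in atTop, ‖a - a * p n‖ ≤ ‖π a‖ + ε := by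
  obtain ⟨a', h1, h2⟩ := exists_norm_le_lift π a (half_pos hε)
  have h3 : π (star (a - a')) = 0 := by rw [map_star, map_sub, h1, sub_self, star_zero]
  have h4 := (hp.unit _ h3).norm
  rw [norm_zero] at h4
  filter_upwards [h4.eventually (gt_mem_nhds (half_pos hε))] with n hn
  have e : a - a * p n = (a' - a' * p n) - star (p n * star (a - a') - star (a - a')) := by
    rw [star_sub, star_mul, star_star, hp.sa, sub_mul]; abel
  rw [e]
  refine (norm_sub_le _ _).trans ?_
  rw [norm_star]
  linarith [norm_sub_mul_proj_le (hp.sa n) (hp.idem n) a']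

end IsQuasicentral

end Tails

section TailAlgebra

attribute [local instance] CStarAlgebra.spectralOrder CStarAlgebra.spectralOrderedRing

open Filter Topology BoundedContinuousFunction

variable {X Q F : Type} [NonUnitalCStarAlgebra X] [NonUnitalCStarAlgebra Q]
  [NonUnitalCStarAlgebra F]

/-- Two elements annihilate each other on both sides. -/
def Annih (x r : X) : Prop := x * r = 0 ∧ r * x = 0

variable {π : X →⋆ₙₐ[ℂ] Q} {p : ℕ → X}

/-- The algebra of pairs of an element `a` and a bounded sequence asymptotic to `a (1 - p n)` that
annihilates the given sets. -/
def tailAlgebra (hp : IsQuasicentral π p) (R : ℕ → Set X) (hR : ∀ n, ∀ r ∈ R n, star r ∈ R n) :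
    NonUnitalStarSubalgebra ℂ (X × (ℕ →ᵇ X)) where
  carrier := {w | Tendsto (fun n => w.2 n - (w.1 - w.1 * p n)) atTop (𝓝 0) ∧
    ∀ n, ∀ r ∈ R n, Annih (w.2 n) r}
  add_mem' := by
    rintro v w ⟨h1, h2⟩ ⟨h3, h4⟩
    refine ⟨?_, fun n r hr => ⟨?_, ?_⟩⟩
    · have := h1.add h3
      rw [add_zero] at this
      refine this.congr fun n => ?_
      simp [add_mul]; abel
    · simp [add_mul, (h2 n r hr).1, (h4 n r hr).1]
    · simp [mul_add, (h2 n r hr).2, (h4 n r hr).2]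
  zero_mem' := ⟨by simp, fun n r _ => ⟨by simp, by simp⟩⟩
  smul_mem' := by
    rintro c w ⟨h1, h2⟩
    refine ⟨?_, fun n r hr => ⟨?_, ?_⟩⟩
    · have := h1.const_smul c
      rw [smul_zero] at this
      refine this.congr fun n => ?_
      simp [smul_sub, smul_mul_assoc]
    · simp [smul_mul_assoc, (h2 n r hr).1]
    · simp [mul_smul_comm, (h2 n r hr).2]
  mul_mem' := by
    rintro v w ⟨h1, h2⟩ ⟨h3, h4⟩
    refine ⟨?_, fun n r hr => ⟨?_, ?_⟩⟩
    · have b1 : ∀ n, ‖v.2 n‖ ≤ ‖v.2‖ := fun n => v.2.norm_coe_le_norm n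
      have b2 : ∀ n, ‖w.1 - w.1 * p n‖ ≤ ‖w.1‖ := fun n =>
        norm_sub_mul_proj_le (hp.sa n) (hp.idem n) _
      have t1 := Filter.Tendsto.zero_mul_isBoundedUnder_le h1
        (isBoundedUnder_of ⟨‖w.1‖, b2⟩ : IsBoundedUnder (· ≤ ·) atTop
          ((fun x => ‖x‖) ∘ fun n => w.1 - w.1 * p n))
      have t2 := Filter.isBoundedUnder_le_mul_tendsto_zero
        (isBoundedUnder_of ⟨‖v.2‖, b1⟩ : IsBoundedUnder (· ≤ ·) atTop
          ((fun x => ‖x‖) ∘ fun n => v.2 n)) h3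
      have t3 := Filter.isBoundedUnder_le_mul_tendsto_zero
        (isBoundedUnder_of ⟨1, hp.norm_le⟩ : IsBoundedUnder (· ≤ ·) atTop
          ((fun x => ‖x‖) ∘ p)) (hp.comm w.1)
      have t4 := (t1.add t2).sub (t3.const_mul v.1)
      simp only [mul_zero, add_zero, sub_zero] at t4
      refine t4.congr fun n => ?_
      have e : p n * (w.1 * p n) = p n * w.1 * p n := (mul_assoc _ _ _).symm
      have e2 : p n * (p n * w.1 - w.1 * p n) = p n * w.1 - p n * w.1 * p n := by
        rw [mul_sub, ← mul_assoc, hp.idem, e]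
      rw [e2]
      simp only [Prod.fst_mul, Prod.snd_mul, BoundedContinuousFunction.mul_apply]
      simp only [sub_mul, mul_sub, mul_assoc]; abel
    · simp [mul_assoc, (h4 n r hr).1]
    · simp [← mul_assoc, (h2 n r hr).2]
  star_mem' := by
    rintro w ⟨h1, h2⟩
    refine ⟨?_, fun n r hr => ⟨?_, ?_⟩⟩
    · have := h1.star.sub (hp.comm (star w.1))
      rw [star_zero, sub_zero] at this
      refine this.congr fun n => ?_
      simp only [star_sub, star_mul, hp.sa, Prod.fst_star, Prod.snd_star,
        BoundedContinuousFunction.star_apply]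
      abel
    · simpa using congrArg star (h2 n _ (hR n r hr)).2
    · simpa using congrArg star (h2 n _ (hR n r hr)).1

variable (hp : IsQuasicentral π p) (R : ℕ → Set X) (hR : ∀ n, ∀ r ∈ R n, star r ∈ R n)

lemma isClosed_tailAlgebra : IsClosed (tailAlgebra hp R hR : Set (X × (ℕ →ᵇ X))) := by
  have hset : (tailAlgebra hp R hR : Set (X × (ℕ →ᵇ X))) =
      {w | Tendsto (fun n => w.2 n - (w.1 - w.1 * p n)) atTop (𝓝 0)} ∩
      ⋂ n, ⋂ r ∈ R n, {w : X × (ℕ →ᵇ X) | Annih (w.2 n) r} := by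
    ext w; simp only [Set.mem_inter_iff, Set.mem_iInter]; rfl
  rw [hset]
  refine IsClosed.inter ?_ (isClosed_iInter fun n => isClosed_biInter fun r _ => ?_)
  · refine isClosed_of_closure_subset fun w hw => ?_
    rw [Set.mem_ofPred_eq, Metric.tendsto_atTop]
    intro ε hε
    obtain ⟨v, hv, hvw⟩ := Metric.mem_closure_iff.1 hw (ε / 3) (by positivity)
    rw [Set.mem_ofPred_eq, Metric.tendsto_atTop] at hv
    obtain ⟨N, hN⟩ := hv (ε / 3) (by positivity)
    refine ⟨N, fun n hn => ?_⟩
    have h1 := hN n hn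
    rw [dist_zero_right] at h1 ⊢
    rw [dist_eq_norm, Prod.norm_def] at hvw
    have h2 : ‖w.1 - v.1‖ < ε / 3 := (le_max_left _ _).trans_lt hvw
    have h3 : ‖w.2 n - v.2 n‖ < ε / 3 :=
      ((w.2 - v.2).norm_coe_le_norm n).trans_lt ((le_max_right _ _).trans_lt hvw)
    have h4 := norm_sub_mul_proj_le (hp.sa n) (hp.idem n) (w.1 - v.1)
    have e : w.2 n - (w.1 - w.1 * p n) = (w.2 n - v.2 n) -
        ((w.1 - v.1) - (w.1 - v.1) * p n) + (v.2 n - (v.1 - v.1 * p n)) := by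
      rw [sub_mul]; abel
    rw [e]
    have h5 := norm_add_le ((w.2 n - v.2 n) - ((w.1 - v.1) - (w.1 - v.1) * p n))
      (v.2 n - (v.1 - v.1 * p n))
    have h6 := norm_sub_le (w.2 n - v.2 n) ((w.1 - v.1) - (w.1 - v.1) * p n)
    linarith
  · have hc : Continuous fun w : X × (ℕ →ᵇ X) => w.2 n :=
      (continuous_eval_const n).comp continuous_snd
    exact (isClosed_eq (hc.mul continuous_const) continuous_const).inter
      (isClosed_eq (continuous_const.mul hc) continuous_const)

/-- The quotient map on the first coordinate. -/
def tailMap : tailAlgebra hp R hR →⋆ₙₐ[ℂ] Q where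
  toFun w := π w.1.1
  map_smul' c w := map_smul π c w.1.1
  map_zero' := map_zero π
  map_add' v w := map_add π v.1.1 w.1.1
  map_mul' v w := map_mul π v.1.1 w.1.1
  map_star' w := map_star π w.1.1

/-- Evaluation of the sequence coordinate. -/
def tailEval (n : ℕ) : tailAlgebra hp R hR →⋆ₙₐ[ℂ] X where
  toFun w := w.1.2 n
  map_smul' _ _ := rfl
  map_zero' := rfl
  map_add' _ _ := rfl
  map_mul' _ _ := rfl
  map_star' _ := rfl

lemma tailMap_surjective (hπ : Function.Surjective π) {k : ℕ → X} (hks : ∀ n, star (k n) = k n)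
    (hk1 : ∀ n, ‖k n‖ ≤ 1) (hkR : ∀ n, ∀ r ∈ R n, k n * r = r)
    (hkp : Tendsto (fun n => k n - k n * p n) atTop (𝓝 0)) :
    Function.Surjective (tailMap hp R hR) := by
  intro q
  obtain ⟨a, rfl⟩ := hπ q
  have hrk : ∀ n, ∀ r ∈ R n, r * k n = r := fun n r hr => by
    simpa [hks] using congrArg star (hkR n _ (hR n r hr))
  have bk : ∀ n y, ‖cut (k n) y‖ ≤ 4 * ‖y‖ := fun n y => by
    have h1 : ‖y * k n‖ ≤ ‖y‖ :=
      (norm_mul_le _ _).trans (mul_le_of_le_one_right (norm_nonneg _) (hk1 n))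
    have h2 : ‖k n * y‖ ≤ ‖y‖ :=
      (norm_mul_le _ _).trans (mul_le_of_le_one_left (norm_nonneg _) (hk1 n))
    have h3 := norm_conj_le (hk1 n) y
    rw [cut_apply, hks]
    have h4 := norm_add_le (y - y * k n - k n * y) (k n * y * k n)
    have h5 := norm_sub_le (y - y * k n) (k n * y)
    have h6 := norm_sub_le y (y * k n)
    linarith
  have bx : ∀ n, ‖cut (k n) (cut (p n) a)‖ ≤ 16 * ‖a‖ := fun n => by
    have := bk n (cut (p n) a)
    have := norm_cut_le (hp.sa n) (hp.idem n) a
    linarith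
  refine ⟨⟨(a, ofNormedAddCommGroupDiscrete (fun n => cut (k n) (cut (p n) a)) _ bx), ?_,
    fun n r hr => ⟨?_, ?_⟩⟩, rfl⟩
  · have bp : IsBoundedUnder (· ≤ ·) atTop ((fun x => ‖x‖) ∘ p) := isBoundedUnder_of ⟨1, hp.norm_le⟩
    have bkk : IsBoundedUnder (· ≤ ·) atTop ((fun x => ‖x‖) ∘ k) := isBoundedUnder_of ⟨1, hk1⟩
    have ba : IsBoundedUnder (· ≤ ·) atTop ((fun x => ‖x‖) ∘ fun n => a - a * p n) :=
      isBoundedUnder_of ⟨‖a‖, fun n => norm_sub_mul_proj_le (hp.sa n) (hp.idem n) a⟩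
    have bc : IsBoundedUnder (· ≤ ·) atTop ((fun x => ‖x‖) ∘ fun n => cut (p n) a) :=
      isBoundedUnder_of ⟨4 * ‖a‖, fun n => norm_cut_le (hp.sa n) (hp.idem n) a⟩
    have hkp' : Tendsto (fun n => k n - p n * k n) atTop (𝓝 0) := by
      simpa [hks, hp.sa] using hkp.star
    have t1 := Filter.isBoundedUnder_le_mul_tendsto_zero bp (hp.comm a)
    have t2 := Filter.isBoundedUnder_le_mul_tendsto_zero bc hkp'
    have t3 := hkp.zero_mul_isBoundedUnder_le ba
    have t4 := t3.zero_mul_isBoundedUnder_le bkk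
    have t5 := ((t4.sub t3).sub t2).sub t1
    simp only [sub_zero] at t5
    refine t5.congr fun n => ?_
    have e1 : k n * cut (p n) a = (k n - k n * p n) * (a - a * p n) := by
      rw [cut_apply, hp.sa]; noncomm_ring
    have e2 : cut (p n) a * (k n - p n * k n) = cut (p n) a * k n := by
      rw [mul_sub, cut_apply, hp.sa, ← mul_assoc _ (p n)]
      have : (a - a * p n - p n * a + p n * a * p n) * p n = 0 := by
        simp only [add_mul, sub_mul, mul_assoc, hp.idem]; abel
      rw [this, zero_mul, sub_zero]
    have e3 : p n * (p n * a - a * p n) = p n * a - p n * a * p n := by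
      rw [mul_sub, ← mul_assoc, hp.idem, ← mul_assoc]
    have e4 : cut (k n) (cut (p n) a) = cut (p n) a - cut (p n) a * k n - k n * cut (p n) a +
        k n * cut (p n) a * k n := by rw [cut_apply (k n), hks]
    change _ = cut (k n) (cut (p n) a) - (a - a * p n)
    rw [e4, ← e1, e2, e3]
    conv_rhs => arg 1; arg 1; arg 1; arg 1; rw [cut_apply, hp.sa]
    abel
  · change cut (k n) (cut (p n) a) * r = 0
    rw [cut_apply (k n), hks]
    simp only [add_mul, sub_mul, mul_assoc, hkR n r hr]; abel
  · change r * cut (k n) (cut (p n) a) = 0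
    rw [cut_apply (k n), hks]
    simp only [mul_add, mul_sub, ← mul_assoc, hrk n r hr]; abel

/-- An order zero map into the quotient lifts to a sequence of order zero maps that are asymptotic
to a linear lift multiplied by `1 - p n` and annihilate given sets. -/
theorem exists_asymptotic_lift (hp : IsQuasicentral π p) (R : ℕ → Set X)
    (hR : ∀ n, ∀ r ∈ R n, star r ∈ R n) [FiniteDimensional ℂ F] (hπ : Function.Surjective π)
    {k : ℕ → X}
    (hks : ∀ n, star (k n) = k n) (hk1 : ∀ n, ‖k n‖ ≤ 1) (hkR : ∀ n, ∀ r ∈ R n, k n * r = r)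
    (hkp : Tendsto (fun n => k n - k n * p n) atTop (𝓝 0)) {φ : F →ₗ[ℂ] Q} (hc : IsCPMap φ)
    (hz : IsOrderZero φ) (hn : ∀ x, ‖φ x‖ ≤ ‖x‖) {ε : ℝ} (hε : 0 < ε) :
    ∃ (L : F →ₗ[ℂ] X) (Φ : ℕ → F →ₗ[ℂ] X), (∀ y, ‖π (L y) - φ y‖ ≤ ε * ‖y‖) ∧
      (∀ n, IsCPMap (Φ n)) ∧ (∀ n, IsOrderZero (Φ n)) ∧
      (∀ n y, ∀ r ∈ R n, Annih (Φ n y) r) ∧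
      (∀ y, Tendsto (fun n => Φ n y - (L y - L y * p n)) atTop (𝓝 0)) ∧
      ∀ᶠ n in atTop, ∀ y, ‖Φ n y‖ ≤ (1 + 3 * ε) * ‖y‖ := by
  have : IsClosed (tailAlgebra hp R hR : Set (X × (ℕ →ᵇ X))) := isClosed_tailAlgebra hp R hR
  obtain ⟨Ψ, h1, h2, h3⟩ := exists_orderZero_lift (tailMap hp R hR)
    (tailMap_surjective hp R hR hπ hks hk1 hkR hkp) hc hz hn hε
  set L : F →ₗ[ℂ] X := LinearMap.fst ℂ X (ℕ →ᵇ X) ∘ₗ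
    (tailAlgebra hp R hR).toSubmodule.subtype ∘ₗ Ψ with hL
  have hcp : ∀ n, IsCPMap ((tailEval hp R hR n : _ →ₗ[ℂ] X) ∘ₗ Ψ) := fun n =>
    (isCPMap_starAlgHom _).comp h1
  have hoz : ∀ n, IsOrderZero ((tailEval hp R hR n : _ →ₗ[ℂ] X) ∘ₗ Ψ) := fun n a b ha hb hab => by
    change tailEval hp R hR n (Ψ a) * tailEval hp R hR n (Ψ b) = 0
    rw [← map_mul, h2 a b ha hb hab, map_zero]
  have ht : ∀ y, Tendsto (fun n => tailEval hp R hR n (Ψ y) - (L y - L y * p n)) atTop (𝓝 0) :=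
    fun y => (Ψ y).2.1
  refine ⟨L, fun n => (tailEval hp R hR n : _ →ₗ[ℂ] X) ∘ₗ Ψ, h3, hcp, hoz,
    fun n y r hr => (Ψ y).2.2 n r hr, ht, ?_⟩
  have t1 := (ht (fdUnit F)).norm
  rw [norm_zero] at t1
  filter_upwards [t1.eventually (gt_mem_nhds hε), hp.eventually_norm_le (L (fdUnit F)) hε]
    with n a1 a2 y
  refine ((hoz n).norm_le (hcp n) y).trans (mul_le_mul_of_nonneg_right ?_ (norm_nonneg _))
  change ‖tailEval hp R hR n (Ψ (fdUnit F))‖ ≤ _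
  have a3 := norm_add_le (tailEval hp R hR n (Ψ (fdUnit F)) -
    (L (fdUnit F) - L (fdUnit F) * p n)) (L (fdUnit F) - L (fdUnit F) * p n)
  rw [sub_add_cancel] at a3
  have a4 : ‖π (L (fdUnit F))‖ ≤ 1 + ε := by
    have b1 := h3 (fdUnit F)
    have b2 := norm_add_le (π (L (fdUnit F)) - φ (fdUnit F)) (φ (fdUnit F))
    rw [sub_add_cancel] at b2
    have b3 := (hn (fdUnit F)).trans norm_fdUnit_le
    have b4 : ε * ‖fdUnit F‖ ≤ ε * 1 := mul_le_mul_of_nonneg_left norm_fdUnit_le hε.le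
    have b5 : ‖π (L (fdUnit F)) - φ (fdUnit F)‖ ≤ ε * ‖fdUnit F‖ := b1
    linarith
  linarith

end TailAlgebra

section Extension

open Filter Topology

variable {X Y F G : Type} [NonUnitalCStarAlgebra X] [NonUnitalCStarAlgebra Y]
  [NonUnitalCStarAlgebra F] [NonUnitalCStarAlgebra G]

lemma isCPMap_fst : IsCPMap (LinearMap.fst ℂ F G) := isCPMap_of_starHom _ fun _ _ => rfl

lemma isCPMap_snd : IsCPMap (LinearMap.snd ℂ F G) := isCPMap_of_starHom _ fun _ _ => rfl

lemma IsCPMap.prod {f : X →ₗ[ℂ] F} {g : X →ₗ[ℂ] G} (hf : IsCPMap f) (hg : IsCPMap g) :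
    IsCPMap (f.prod g) := fun n M hM => by
  obtain ⟨B, hB⟩ := hf n M hM
  obtain ⟨C, hC⟩ := hg n M hM
  refine ⟨Matrix.of fun j k => (B j k, C j k), ?_⟩
  ext j k
  · have := congrFun (congrFun hB j) k
    simp only [Matrix.map_apply, Matrix.mul_apply, Matrix.star_apply] at this
    simp [Matrix.mul_apply, Matrix.star_apply, this, Prod.fst_sum]
  · have := congrFun (congrFun hC j) k
    simp only [Matrix.map_apply, Matrix.mul_apply, Matrix.star_apply] at this
    simp [Matrix.mul_apply, Matrix.star_apply, this, Prod.snd_sum]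

lemma norm_add_le_max {u w : X} (h1 : star u * w = 0) (h2 : u * star w = 0) :
    ‖u + w‖ ≤ max ‖u‖ ‖w‖ := by
  have h1' : star w * u = 0 := by simpa using congrArg star h1
  have h2' : w * star u = 0 := by simpa using congrArg star h2
  have e : star (u + w) * (u + w) = star u * u + star w * w := by
    rw [star_add, add_mul, mul_add, mul_add, h1, h1', add_zero, zero_add]
  have ab : star u * u * (star w * w) = 0 := by
    rw [mul_assoc, ← mul_assoc u, h2, zero_mul, mul_zero]
  have ba : star w * w * (star u * u) = 0 := by
    rw [mul_assoc, ← mul_assoc w, h2', zero_mul, mul_zero]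
  have hn : ‖star u * u + star w * w‖ = max ‖star u * u‖ ‖star w * w‖ :=
    IsStarNormal.norm_add_eq_max (IsSelfAdjoint.star_mul_self u).isStarNormal
      (IsSelfAdjoint.star_mul_self w).isStarNormal (ab.trans ba.symm) ab
  have := CStarRing.norm_star_mul_self (x := u + w)
  rw [e, hn, CStarRing.norm_star_mul_self, CStarRing.norm_star_mul_self] at this
  have m0 : 0 ≤ max ‖u‖ ‖w‖ := (norm_nonneg u).trans (le_max_left _ _)
  have m1 : max (‖u‖ * ‖u‖) (‖w‖ * ‖w‖) ≤ max ‖u‖ ‖w‖ * max ‖u‖ ‖w‖ :=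
    max_le (mul_self_le_mul_self (norm_nonneg _) (le_max_left _ _))
      (mul_self_le_mul_self (norm_nonneg _) (le_max_right _ _))
  exact abs_le_of_sq_le_sq' (by rw [sq, sq, ← this]; exact m1) m0 |>.2

section Combine

variable {φ₁ : F →ₗ[ℂ] X} {φ₂ : G →ₗ[ℂ] X}

lemma IsCPMap.coprod (hc₁ : IsCPMap φ₁) (hc₂ : IsCPMap φ₂) : IsCPMap (φ₁.coprod φ₂) := by
  have e : φ₁.coprod φ₂ = φ₁ ∘ₗ LinearMap.fst ℂ F G + φ₂ ∘ₗ LinearMap.snd ℂ F G := rfl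
  have h₁ : IsCPMap (φ₁ ∘ₗ LinearMap.fst ℂ F G) := IsCPMap.comp (Y := F) hc₁ isCPMap_fst
  have h₂ : IsCPMap (φ₂ ∘ₗ LinearMap.snd ℂ F G) := IsCPMap.comp (Y := G) hc₂ isCPMap_snd
  rw [e]
  exact IsCPMap.add (X := F × G) h₁ h₂

lemma IsOrderZero.coprod (hz₁ : IsOrderZero φ₁) (hz₂ : IsOrderZero φ₂)
    (h : ∀ x y, Annih (φ₂ y) (φ₁ x)) : IsOrderZero (φ₁.coprod φ₂) := fun a b ha hb hab => by
  obtain ⟨c, rfl⟩ := ha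
  obtain ⟨d, rfl⟩ := hb
  have e1 := hz₁ _ _ ⟨c.1, rfl⟩ ⟨d.1, rfl⟩ (congrArg Prod.fst hab)
  have e2 := hz₂ _ _ ⟨c.2, rfl⟩ ⟨d.2, rfl⟩ (congrArg Prod.snd hab)
  simp only [LinearMap.coprod_apply, Prod.fst_mul, Prod.snd_mul, Prod.fst_star, Prod.snd_star]
  rw [add_mul, mul_add, mul_add, e1, e2, (h _ _).1, (h _ _).2]
  simp

lemma norm_coprod_le (hc₁ : IsCPMap φ₁) (hc₂ : IsCPMap φ₂) (h : ∀ x y, Annih (φ₂ y) (φ₁ x))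
    (hn₁ : ∀ x, ‖φ₁ x‖ ≤ ‖x‖) (hn₂ : ∀ x, ‖φ₂ x‖ ≤ ‖x‖) (z : F × G) :
    ‖φ₁.coprod φ₂ z‖ ≤ ‖z‖ := by
  rw [LinearMap.coprod_apply]
  refine (norm_add_le_max ?_ ?_).trans (max_le_max (hn₁ _) (hn₂ _))
  · rw [← hc₁.map_star]; exact (h _ _).2
  · rw [← hc₂.map_star]; exact (h _ _).2

end Combine

/-- Two pieces with orthogonal ranges combine to one. -/
noncomputable def Piece.combine (F G : CStarBundle) [FiniteDimensional ℂ F.X]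
    [FiniteDimensional ℂ G.X] {ψ₁ : X →ₗ[ℂ] F.X} {ψ₂ : X →ₗ[ℂ] G.X} {φ₁ : F.X →ₗ[ℂ] X}
    {φ₂ : G.X →ₗ[ℂ] X} (cψ₁ : IsCPMap ψ₁) (cψ₂ : IsCPMap ψ₂) (nψ₁ : ∀ a, ‖ψ₁ a‖ ≤ ‖a‖)
    (nψ₂ : ∀ a, ‖ψ₂ a‖ ≤ ‖a‖) (c₁ : IsCPMap φ₁) (c₂ : IsCPMap φ₂) (z₁ : IsOrderZero φ₁)
    (z₂ : IsOrderZero φ₂) (n₁ : ∀ x, ‖φ₁ x‖ ≤ ‖x‖) (n₂ : ∀ x, ‖φ₂ x‖ ≤ ‖x‖)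
    (h : ∀ x y, Annih (φ₂ y) (φ₁ x)) : Piece X where
  F := ⟨F.X × G.X⟩
  fd := inferInstanceAs (FiniteDimensional ℂ (F.X × G.X))
  ψ := ψ₁.prod ψ₂
  φ := φ₁.coprod φ₂
  cp_ψ := IsCPMap.prod (F := F.X) (G := G.X) cψ₁ cψ₂
  norm_ψ a := max_le (nψ₁ a) (nψ₂ a)
  cp_φ := c₁.coprod c₂
  zero_φ := z₁.coprod z₂ h
  norm_φ := norm_coprod_le c₁ c₂ h n₁ n₂

variable {J Q : Type} [NonUnitalCStarAlgebra J] [NonUnitalCStarAlgebra Q]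

/-- Compression by a projection in an ideal, as a map into the ideal. -/
lemma exists_compress_to_ideal (ι : J →⋆ₙₐ[ℂ] X) (hiso : ∀ x, ‖ι x‖ = ‖x‖) {π : X →⋆ₙₐ[ℂ] Q}
    (hexact : Set.range ι = {a : X | π a = 0}) {q : X} (h1 : star q = q) (h2 : q * q = q)
    (h3 : π q = 0) : ∃ (e : J) (s : X →ₗ[ℂ] J), ι e = q ∧ star e = e ∧ e * e = e ∧
      (∀ a, ι (s a) = q * a * q) ∧ IsCPMap s ∧ (∀ a, ‖s a‖ ≤ ‖a‖) ∧ ∀ a, e * s a * e = s a := by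
  have hinj : Function.Injective ι := fun x y hxy => by
    have := hiso (x - y)
    rw [map_sub, hxy, sub_self, norm_zero] at this
    exact sub_eq_zero.1 (norm_eq_zero.1 this.symm)
  have hr : ∀ a, π a = 0 → ∃ x, ι x = a := fun a ha => by
    have : a ∈ Set.range ι := by rw [hexact]; exact ha
    exact this
  obtain ⟨e, he⟩ := hr q h3
  choose f hf using fun a => hr (q * a * q) (by rw [map_mul, h3, mul_zero])
  have hcomp : (ι : J →ₗ[ℂ] X) ∘ₗ
      ({ toFun := f
         map_add' := fun x y => hinj (by simp [hf, mul_add, add_mul])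
         map_smul' := fun c x => hinj (by simp [hf, mul_smul_comm, smul_mul_assoc]) }
           : X →ₗ[ℂ] J) = compress q :=
    LinearMap.ext fun y => by rw [compress_apply, h1]; exact hf y
  refine ⟨e, { toFun := f
               map_add' := fun x y => hinj (by simp [hf, mul_add, add_mul])
               map_smul' := fun c x => hinj (by simp [hf, mul_smul_comm, smul_mul_assoc]) }, he,
                 hinj (by rw [map_star, he, h1]),
    hinj (by rw [map_mul, he, h2]), hf, isCPMap_of_injective_comp ι hinj ?_, fun a => ?_,
    fun a => hinj ?_⟩
  · rw [hcomp]; exact isCPMap_compress q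
  · change ‖f a‖ ≤ _
    rw [← hiso, hf]
    exact norm_conj_le (norm_proj_le h1 h2) a
  · change ι (e * f a * e) = ι (f a)
    rw [map_mul, map_mul, he, hf]
    simp only [mul_assoc, h2]
    simp only [← mul_assoc, h2]

/-- The norm estimate behind the extension theorem. -/
lemma norm_extension_error_le {a b t u w q : X} {c ε K N δ : ℝ} (hc : |1 - c| ≤ δ)
    (hc1 : |c| ≤ 1) (hK : ‖a‖ ≤ K) (h1 : star q = q) (h2 : q * q = q) (hu : ‖u - q * a * q‖ ≤ ε)
    (hw : ‖w - (b - b * q)‖ ≤ ε) (hb : ‖(b - a) - (b - a) * q‖ ≤ N) (ht : ‖q * a - a * q‖ ≤ ε)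
    (htt : t = u + (c : ℂ) • w) : ‖t - a‖ ≤ 3 * ε + N + δ * K := by
  have e : t - a = (u - q * a * q) + ((c : ℂ) • ((w - (b - b * q)) + ((b - a) - (b - a) * q)) +
      (((c - 1 : ℝ) : ℂ) • (a - a * q) + (q * a - a * q) * q)) := by
    have e1 : (q * a - a * q) * q = q * a * q - a * q := by rw [sub_mul, mul_assoc a, h2]
    have e2 : (w - (b - b * q)) + ((b - a) - (b - a) * q) = w - (a - a * q) := by
      rw [sub_mul]; abel
    rw [htt, e1, e2, Complex.ofReal_sub, sub_smul, smul_sub, Complex.ofReal_one, one_smul]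
    abel
  rw [e]
  have g1 : ‖(c : ℂ) • ((w - (b - b * q)) + ((b - a) - (b - a) * q))‖ ≤ ε + N := by
    rw [norm_smul, Complex.norm_real, Real.norm_eq_abs]
    exact (mul_le_of_le_one_left (norm_nonneg _) hc1).trans
      ((norm_add_le _ _).trans (add_le_add hw hb))
  have g2 : ‖((c - 1 : ℝ) : ℂ) • (a - a * q)‖ ≤ δ * K := by
    rw [norm_smul, Complex.norm_real, Real.norm_eq_abs, abs_sub_comm]
    exact mul_le_mul hc ((norm_sub_mul_proj_le h1 h2 a).trans hK) (norm_nonneg _)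
      ((abs_nonneg _).trans hc)
  have g3 : ‖(q * a - a * q) * q‖ ≤ ε :=
    (norm_mul_le _ _).trans ((mul_le_of_le_one_right (norm_nonneg _) (norm_proj_le h1 h2)).trans ht)
  refine (norm_add_le _ _).trans ?_
  have g4 := norm_add_le ((c : ℂ) • ((w - (b - b * q)) + ((b - a) - (b - a) * q)))
    (((c - 1 : ℝ) : ℂ) • (a - a * q) + (q * a - a * q) * q)
  have g5 := norm_add_le (((c - 1 : ℝ) : ℂ) • (a - a * q)) ((q * a - a * q) * q)
  linarith

theorem Decomposes.extension {κ : Type} [Fintype κ] (hJ : Decomposes κ J) (hQ : Decomposes κ Q)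
    (ι : J →⋆ₙₐ[ℂ] X) (hiso : ∀ x, ‖ι x‖ = ‖x‖) {π : X →⋆ₙₐ[ℂ] Q} (hπ : Function.Surjective π)
    (hexact : Set.range ι = {a : X | π a = 0}) {p : ℕ → X} (hp : IsQuasicentral π p) :
    Decomposes κ X := by
  classical
  intro S ε₀ hε₀
  set K : ℝ := ∑ x ∈ S, ‖x‖ with hK
  have hK0 : 0 ≤ K := Finset.sum_nonneg fun _ _ => norm_nonneg _
  have hxK : ∀ x ∈ S, ‖x‖ ≤ K := fun x hx =>
    Finset.single_le_sum (f := fun x : X => ‖x‖) (fun _ _ => norm_nonneg _) hx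
  set n : ℝ := (Fintype.card κ : ℝ) with hn
  have hn0 : 0 ≤ n := by positivity
  set ε : ℝ := ε₀ / (6 + n * K + 3 * K) with hε
  have hε0 : 0 < ε := by positivity
  have hεε : ε * (6 + n * K + 3 * K) = ε₀ := by rw [hε]; field_simp
  set c : ℝ := 1 / (1 + 3 * ε) with hc
  have hc0 : 0 ≤ c := by positivity
  have hcm : c * (1 + 3 * ε) = 1 := by rw [hc]; field_simp
  have hc1 : c ≤ 1 := by nlinarith
  have hcabs : |c| ≤ 1 := by rwa [abs_of_nonneg hc0]
  have h1c : |1 - c| ≤ 3 * ε := by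
    rw [abs_of_nonneg (by linarith)]; nlinarith
  obtain ⟨PQ, hPQ⟩ := hQ (S.image π) ε hε0
  choose e s he hes hee hs cps ns hese using fun m =>
    exists_compress_to_ideal ι hiso hexact (hp.sa m) (hp.idem m) (hp.map m)
  choose P k hk hP using fun m => hJ.exists_compressed (hes m) (hee m) (S.image (s m))
    (ε := 1 / ((m : ℝ) + 1)) (by positivity)
  have hlim : ∀ i, Tendsto (fun m => ι (k m i) - ι (k m i) * p m) atTop (𝓝 0) := fun i => by
    refine squeeze_zero_norm (fun m => ?_) tendsto_one_div_add_atTop_nhds_zero_nat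
    rw [← he m, ← map_mul, ← map_sub, hiso]
    exact (hk m i).2.2.2
  choose L Φ hL cΦ zΦ aΦ tΦ nΦ using fun i => exists_asymptotic_lift hp
    (fun m => Set.range fun y => ι ((P m i).φ y))
    (fun m r hr => by
      obtain ⟨y, rfl⟩ := hr
      exact ⟨star y, by simp only [(P m i).cp_φ.map_star, map_star]⟩) hπ (k := fun m => ι (k m i))
    (fun m => by rw [← map_star, (hk m i).1]) (fun m => by rw [hiso]; exact (hk m i).2.1)
    (fun m r hr => by
      obtain ⟨y, rfl⟩ := hr
      simp only [← map_mul, (hk m i).2.2.1]) (hlim i) (PQ i).cp_φ (PQ i).zero_φ (PQ i).norm_φ hε0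
  set b : X → X := fun a => ∑ i, L i ((PQ i).ψ (π a)) with hb
  have hπn : ∀ a, ‖π a‖ ≤ ‖a‖ := fun a => NonUnitalStarAlgHom.norm_apply_le π a
  have hπb : ∀ a ∈ S, ‖π (b a - a)‖ ≤ n * (ε * K) + ε := fun a ha => by
    have e1 : π (b a - a) = ∑ i, (π (L i ((PQ i).ψ (π a))) - (PQ i).θ (π a)) +
        (∑ i, (PQ i).θ (π a) - π a) := by
      rw [Finset.sum_sub_distrib, map_sub, hb, map_sum]; abel
    rw [e1]
    refine (norm_add_le _ _).trans (add_le_add ?_ (hPQ _ (Finset.mem_image_of_mem _ ha)).le)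
    refine (norm_sum_le _ _).trans ?_
    calc _ ≤ ∑ i : κ, ε * K := Finset.sum_le_sum fun i _ => (hL i _).trans
          (mul_le_mul_of_nonneg_left (((PQ i).norm_ψ _).trans ((hπn a).trans (hxK a ha))) hε0.le)
      _ = _ := by simp [hn]
  have ev1 : ∀ a ∈ S, ∀ᶠ m in atTop,
      ‖∑ i, Φ i m ((PQ i).ψ (π a)) - (b a - b a * p m)‖ < ε := fun a _ => by
    have t := tendsto_finsetSum (Finset.univ : Finset κ) fun i _ => tΦ i ((PQ i).ψ (π a))
    rw [Finset.sum_const_zero] at t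
    have t' := t.norm
    rw [norm_zero] at t'
    refine (t'.eventually (gt_mem_nhds hε0)).mono fun m hm => ?_
    rwa [Finset.sum_sub_distrib, Finset.sum_sub_distrib, ← Finset.sum_mul] at hm
  have ev2 : ∀ a ∈ S, ∀ᶠ m in atTop, ‖p m * a - a * p m‖ < ε := fun a _ => by
    have t := (hp.comm a).norm
    rw [norm_zero] at t
    exact t.eventually (gt_mem_nhds hε0)
  obtain ⟨m, ⟨⟨⟨m1, m2⟩, m3⟩, m4⟩, m5⟩ := (((((Finset.eventually_all S).2 ev1).and
    ((Finset.eventually_all S).2 ev2)).and ((Finset.eventually_all S).2 fun a _ =>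
      hp.eventually_norm_le (b a - a) hε0)).and (Filter.eventually_all.2 nΦ)).and
    ((tendsto_one_div_add_atTop_nhds_zero_nat (𝕜 := ℝ)).eventually (gt_mem_nhds hε0)) |>.exists
  refine ⟨fun i => Piece.combine (P m i).F (PQ i).F (ψ₁ := (P m i).ψ ∘ₗ s m)
    (ψ₂ := (PQ i).ψ ∘ₗ (π : X →ₗ[ℂ] Q)) (φ₁ := (ι : J →ₗ[ℂ] X) ∘ₗ (P m i).φ)
    (φ₂ := (c : ℂ) • Φ i m) ((P m i).cp_ψ.comp (cps m)) ((PQ i).cp_ψ.comp (isCPMap_starAlgHom π))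
    (fun a => ((P m i).norm_ψ _).trans (ns m a)) (fun a => ((PQ i).norm_ψ _).trans (hπn a))
    ((isCPMap_starAlgHom ι).comp (P m i).cp_φ) ((cΦ i m).smul hc0)
    (fun x y hx hy hxy => ?_) (fun x y hx hy hxy => ?_) (fun y => ?_) (fun y => ?_)
    (fun x y => ?_), fun a ha => ?_⟩
  · change ι ((P m i).φ x) * ι ((P m i).φ y) = 0
    rw [← map_mul, (P m i).zero_φ x y hx hy hxy, map_zero]
  · rw [LinearMap.smul_apply, LinearMap.smul_apply, smul_mul_smul_comm, zΦ i m x y hx hy hxy,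
      smul_zero]
  · exact (hiso _).trans_le ((P m i).norm_φ y)
  · rw [LinearMap.smul_apply, norm_smul, Complex.norm_real, Real.norm_eq_abs, abs_of_nonneg hc0]
    calc _ ≤ c * ((1 + 3 * ε) * ‖y‖) := mul_le_mul_of_nonneg_left (m4 i y) hc0
      _ = ‖y‖ := by rw [← mul_assoc, hcm, one_mul]
  · have h := aΦ i m y _ ⟨x, rfl⟩
    refine ⟨?_, ?_⟩
    · rw [LinearMap.smul_apply, smul_mul_assoc]
      exact (congrArg _ h.1).trans (smul_zero _)
    · rw [LinearMap.smul_apply, mul_smul_comm]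
      exact (congrArg _ h.2).trans (smul_zero _)
  · have hu : ‖∑ i, ι ((P m i).θ (s m a)) - p m * a * p m‖ ≤ ε := by
      rw [← hs, ← map_sum, ← map_sub, hiso]
      have := hP m (s m a) (Finset.mem_image_of_mem _ ha)
      rw [hese] at this
      exact this.trans m5.le
    refine (norm_extension_error_le h1c hcabs (hxK a ha) (hp.sa m) (hp.idem m) hu (m1 a ha).le
      ((m3 a ha).trans (add_le_add_left (hπb a ha) _)) (m2 a ha).le ?_).trans_lt ?_
    · rw [Finset.smul_sum, ← Finset.sum_add_distrib]
      rfl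
    · have : 3 * ε + (n * (ε * K) + ε + ε) + 3 * ε * K = ε₀ - ε := by rw [← hεε]; ring
      linarith

end Extension

/-- Let `A` be a separable nuclear C*-algebra and let `I`
be a closed two-sided ideal of `A` such that `0 → I → A → A/I → 0` is a
quasidiagonal extension, and let `π : A → Q` be a surjective *-homomorphism
with kernel `I`.  Here the ideal is presented by a C*-algebra `I` together
with an isometric *-homomorphism `ι : I → A` whose range is exactly
`ker π` (which is automatically a closed two-sided ideal of `A`);
quasidiagonality is witnessed by a sequence `p n` of projections in the
ideal forming an approximate identity for the ideal (`happid`) which is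
quasicentral in `A` (`hqc`).  Then
`nucdim(A) = max {nucdim(I), nucdim(Q)}`. -/
theorem nucDim_of_quasidiagonal_extension (I A Q : CStarBundle)
    (hsep : TopologicalSpace.SeparableSpace A.X)
    (hnuc : IsNuclearCStar A)
    (ι : I.X →⋆ₙₐ[ℂ] A.X) (hiso : ∀ x : I.X, ‖ι x‖ = ‖x‖)
    (π : A.X →⋆ₙₐ[ℂ] Q.X) (hπ : Function.Surjective π)
    (hexact : Set.range ι = {a : A.X | π a = 0})
    (p : ℕ → A.X)
    (hsa : ∀ n, star (p n) = p n)
    (hidem : ∀ n, p n * p n = p n)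
    (hmem : ∀ n, π (p n) = 0)
    (happid : ∀ x : A.X, π x = 0 →
      Filter.Tendsto (fun n => ‖p n * x - x‖) Filter.atTop (nhds 0))
    (hqc : ∀ a : A.X,
      Filter.Tendsto (fun n => ‖p n * a - a * p n‖) Filter.atTop (nhds 0)) :
    nucDim A = max (nucDim I) (nucDim Q) := by
  have hp : IsQuasicentral π p := ⟨hsa, hidem, hmem,
    fun x hx => tendsto_zero_iff_norm_tendsto_zero.2 (happid x hx),
    fun a => tendsto_zero_iff_norm_tendsto_zero.2 (hqc a)⟩
  refine nucDim_eq_max fun d => ?_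
  rw [nucDimLE_iff, nucDimLE_iff, nucDimLE_iff]
  exact ⟨fun h => ⟨h.ideal ι hiso π hexact p hsa hidem hmem happid, h.quotient π hπ⟩,
    fun h => h.1.extension h.2 ι hiso hπ hexact hp⟩
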